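/- arXiv:2512.24631 — 3 statements merged into one kernel-verified Lean document; each statement's English description precedes it below -/
import Mathlib

section
/- Let κ > 0 be a fixed small number, let x ≥ 2 and 2 ≤ N ≤ x^{1/2−κ}. Then for arbitrary complex numbers a_1, …, a_N one has ∑_{p ≤ x} |∑_{n ≤ N} a_n (n/p)|² ≪_κ (x / log x) · ∑_{m,n ≤ N, mn a perfect square} |a_m a_n|, where the outer sum runs over odd primes p ≤ x. -/
open Finset Filter

noncomputable section

/-- `S ℓ p = ∑_{n ≤ ℓ} (n/p)`, the quadratic character sum (Legendre symbol for odd prime `p`). -/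
def S (ℓ p : ℕ) : ℤ := ∑ n ∈ Finset.Icc 1 ℓ, jacobiSym (n : ℤ) p

/-- the first-passage time `f_ε(p) = min {ℓ ≥ 1 : S_ℓ(p) < ε ℓ}`. -/
def fpt (ε : ℝ) (p : ℕ) : ℕ := sInf {ℓ : ℕ | 1 ≤ ℓ ∧ ((S ℓ p : ℝ)) < ε * ℓ}

/-- the odd primes up to a real number `x`. -/
def oddPrimesUpTo (x : ℝ) : Finset ℕ :=
  (Finset.range (⌊x⌋₊ + 1)).filter (fun p => p.Prime ∧ p ≠ 2)

/-- `π_odd(x)`, the number of odd primes up to `x`. -/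
def piOdd (x : ℝ) : ℕ := (oddPrimesUpTo x).card

/-- `P_ℓ(x)`, the density of odd primes `p ≤ x` with `S_ℓ(p) ≥ ε ℓ`. -/
def Pdens (ε : ℝ) (ℓ : ℕ) (x : ℝ) : ℝ :=
  (((oddPrimesUpTo x).filter (fun p => ε * ℓ ≤ (S ℓ p : ℝ))).card : ℝ) / (piOdd x : ℝ)

/-- `a_m(x) = N_m(x)/π_odd(x)`, the proportion of odd primes `p ≤ x` with `f_ε(p) > m`. -/
def aCoef (ε : ℝ) (m : ℕ) (x : ℝ) : ℝ :=
  (((oddPrimesUpTo x).filter (fun p => m < fpt ε p)).card : ℝ) / (piOdd x : ℝ)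

/-- `c_u(ℓ)`, the number of triples `(a,b,c) ∈ {1,…,ℓ}³` with `abc = u`. -/
def cCoef (ℓ u : ℕ) : ℕ :=
  ((Finset.Icc 1 ℓ ×ˢ Finset.Icc 1 ℓ ×ˢ Finset.Icc 1 ℓ).filter
    (fun t => t.1 * t.2.1 * t.2.2 = u)).card

/-- `C_3(ℓ) = ∑_{u,v ≤ ℓ³, uv = □} c_u(ℓ) c_v(ℓ)`. -/
def C3 (ℓ : ℕ) : ℕ :=
  ∑ q ∈ (Finset.Icc 1 (ℓ ^ 3) ×ˢ Finset.Icc 1 (ℓ ^ 3)).filter (fun q => IsSquare (q.1 * q.2)),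
    cCoef ℓ q.1 * cCoef ℓ q.2

lemma T_unit {q : ℕ} [NeZero q] (χ : ZMod q → ℂ) (hmul : ∀ a b, χ (a*b) = χ a * χ b)
    (u b : ZMod q) (hu : IsUnit u) :
    χ u * ∑ a, χ a * ZMod.stdAddChar (a * (u * b)) = ∑ a, χ a * ZMod.stdAddChar (a * b) := by
  rw [Finset.mul_sum]
  obtain ⟨u, rfl⟩ := hu
  refine Fintype.sum_equiv (Units.mulRight u) _ _ fun a => ?_
  simp only [Units.mulRight_apply]
  rw [hmul, mul_assoc a]; ring

lemma orth {q : ℕ} [NeZero q] (c : ZMod q) :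
    ∑ b : ZMod q, ZMod.stdAddChar (b * c) = if c = 0 then (q : ℂ) else 0 := by
  have := AddChar.sum_mulShift c (ZMod.isPrimitive_stdAddChar q)
  simpa [ZMod.card] using this

lemma parseval {q : ℕ} [NeZero q] (χ : ZMod q → ℂ) :
    ∑ b, ‖∑ a, χ a * ZMod.stdAddChar (a * b)‖ ^ 2 = q * ∑ a, ‖χ a‖ ^ 2 := by
  have key : ∀ z : ℂ, ((‖z‖ ^ 2 : ℝ) : ℂ) = z * (starRingEnd ℂ) z := fun z => by
    rw [Complex.mul_conj, Complex.normSq_eq_norm_sq]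
  have hc : ∀ y : ZMod q, (starRingEnd ℂ) (ZMod.stdAddChar y) = ZMod.stdAddChar (-y) := by
    intro y; rw [AddChar.map_neg_eq_conj]
  apply Complex.ofReal_injective
  push_cast
  have : ∀ b : ZMod q, ((‖∑ a, χ a * ZMod.stdAddChar (a * b)‖ : ℝ) : ℂ) ^ 2
      = ∑ a, ∑ a', χ a * (starRingEnd ℂ) (χ a') * ZMod.stdAddChar (b * (a - a')) := by
    intro b
    rw [← Complex.ofReal_pow, key, map_sum, Finset.sum_mul_sum]
    refine sum_congr rfl fun a _ => sum_congr rfl fun a' _ => ?_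
    rw [map_mul (starRingEnd ℂ), hc, mul_sub, sub_eq_add_neg, AddChar.map_add_eq_mul, mul_comm b a, mul_comm b a']
    ring
  simp_rw [this]
  rw [sum_comm, mul_sum]
  refine sum_congr rfl fun a _ => ?_
  rw [sum_comm]
  simp_rw [← mul_sum, orth, sub_eq_zero]
  simp only [mul_ite, mul_zero, sum_ite_eq, mem_univ, if_true]
  rw [← Complex.ofReal_pow, key]; ring

lemma T_bound {q : ℕ} [NeZero q] (χ : ZMod q → ℂ) (hmul : ∀ a b, χ (a*b) = χ a * χ b)
    (h0 : ∀ a, ¬ IsUnit a → χ a = 0) (h1 : ∀ a, IsUnit a → ‖χ a‖ = 1)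
    (hprim : ∀ b : ZMod q, ¬ IsUnit b → ∃ u, IsUnit u ∧ u * b = b ∧ χ u = -1) (b : ZMod q) :
    ‖∑ a, χ a * ZMod.stdAddChar (a * b)‖ ≤ if IsUnit b then √q else 0 := by
  classical
  set T : ZMod q → ℂ := fun b => ∑ a, χ a * ZMod.stdAddChar (a * b) with hT
  have hz : ∀ b, ¬ IsUnit b → T b = 0 := by
    intro b hb
    obtain ⟨u, hu, hub, hχ⟩ := hprim b hb
    have := T_unit χ hmul u b hu
    rw [hub, hχ] at this
    have h2 : -1 * T b = T b := this
    have h3 : 2 * T b = 0 := by linear_combination (-1 : ℂ) * h2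
    simpa using h3
  have hun : ∀ b, IsUnit b → ‖T b‖ = ‖T 1‖ := by
    intro b hb
    have := T_unit χ hmul b 1 hb
    rw [mul_one] at this
    have h2 : χ b * T b = T 1 := this
    rw [← h2, norm_mul, h1 b hb, one_mul]
  change ‖T b‖ ≤ _
  have hP := parseval χ
  have e1 : ∑ b, ‖T b‖ ^ 2 = (#{b : ZMod q | IsUnit b}) * ‖T 1‖ ^ 2 := by
    rw [← nsmul_eq_mul, ← sum_const, sum_filter]
    refine sum_congr rfl fun b _ => ?_
    split_ifs with h
    · rw [hun b h]
    · rw [hz b h]; simp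
  have e2 : ∑ b, ‖χ b‖ ^ 2 = (#{b : ZMod q | IsUnit b} : ℝ) := by
    rw [card_filter]; push_cast
    refine sum_congr rfl fun b _ => ?_
    split_ifs with h
    · rw [h1 b h]; simp
    · rw [h0 b h]; simp
  have e3 : (#{b : ZMod q | IsUnit b} : ℝ) * ‖T 1‖ ^ 2 = q * (#{b : ZMod q | IsUnit b} : ℝ) := by
    rw [← e1, ← e2]; exact hP
  have hpos : (0:ℝ) < (#{b : ZMod q | IsUnit b} : ℝ) := by
    exact_mod_cast card_pos.2 ⟨1, by simp⟩
  have e4 : ‖T 1‖ ^ 2 = q := by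
    apply mul_left_cancel₀ hpos.ne'; rw [e3]; ring
  split_ifs with h
  · rw [hun b h]; exact Real.le_sqrt_of_sq_le e4.le
  · rw [hz b h]; simp

lemma geo_bound {q : ℕ} [NeZero q] (k : ℕ) (hk : k ∈ Ico 1 q) (L : ℕ) :
    ‖∑ j ∈ range L, (ZMod.stdAddChar (-(k : ZMod q))) ^ j‖ ≤ q / 2 * (1 / k + 1 / ((q:ℝ) - k)) := by
  rw [mem_Ico] at hk
  have hk0 : (0:ℝ) < k := by exact_mod_cast hk.1
  have hkq : (k:ℝ) < q := by exact_mod_cast hk.2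
  have hq : (0:ℝ) < q := hk0.trans hkq
  set z : ℂ := ZMod.stdAddChar (-(k : ZMod q)) with hz
  have hz' : z = Complex.exp (Complex.I * ((-(2 * Real.pi * k / q) : ℝ) : ℂ)) := by
    have := ZMod.stdAddChar_coe (N := q) (-(k:ℤ))
    push_cast at this
    rw [hz, this]; congr 1; push_cast; ring
  have hn : ‖z‖ = 1 := by
    rw [hz', mul_comm]; exact Complex.norm_exp_ofReal_mul_I _
  have hs : ‖z - 1‖ = 2 * Real.sin (Real.pi * k / q) := by
    rw [hz', Complex.norm_exp_I_mul_ofReal_sub_one]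
    have : -(2 * Real.pi * k / q) / 2 = - (Real.pi * k / q) := by ring
    rw [this, Real.sin_neg, mul_neg, norm_neg, Real.norm_eq_abs, abs_of_nonneg]
    apply mul_nonneg (by norm_num)
    apply Real.sin_nonneg_of_nonneg_of_le_pi (by positivity)
    rw [div_le_iff₀ hq]; exact mul_le_mul_of_nonneg_left hkq.le Real.pi_pos.le
  have hrec : 2 ≤ ‖z - 1‖ * (q / 2 * (1 / k + 1 / ((q:ℝ) - k))) := by
    rw [hs]
    have hqk : 0 < (q:ℝ) - k := by linarith
    rcases le_total (k:ℝ) (q/2) with h | h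
    · have := Real.mul_le_sin (x := Real.pi * k / q) (by positivity) (by
        rw [div_le_iff₀ hq]; nlinarith [Real.pi_pos])
      have e : 2 / Real.pi * (Real.pi * k / q) = 2 * k / q := by
        field_simp
      rw [e] at this
      calc (2:ℝ) = 2 * (2 * k / q) * (q / 2 * (1 / k + 0)) := by field_simp; ring
        _ ≤ _ := by
          have i1 : 0 ≤ 1 / ((q:ℝ) - k) := one_div_nonneg.2 hqk.le
          have i2 : 0 ≤ 1 / (k:ℝ) := by positivity
          apply mul_le_mul (by linarith) _ (by positivity) _
          · apply mul_le_mul_of_nonneg_left (by linarith) (by positivity)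
          · refine mul_nonneg (by norm_num) (le_trans ?_ this)
            apply div_nonneg _ hq.le
            linarith
    · have := Real.mul_le_sin (x := Real.pi - Real.pi * k / q) (by
        rw [sub_nonneg, div_le_iff₀ hq]; nlinarith [Real.pi_pos]) (by
        have : Real.pi / 2 ≤ Real.pi * k / q := by
          rw [le_div_iff₀ hq]; nlinarith [Real.pi_pos]
        linarith)
      rw [Real.sin_pi_sub] at this
      have e : 2 / Real.pi * (Real.pi - Real.pi * k / q) = 2 * (q - k) / q := by
        field_simp
      rw [e] at this
      calc (2:ℝ) = 2 * (2 * (q - k) / q) * (q / 2 * (0 + 1 / ((q:ℝ) - k))) := by field_simp; ring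
        _ ≤ _ := by
          have i1 : 0 ≤ 1 / ((q:ℝ) - k) := one_div_nonneg.2 hqk.le
          have i2 : 0 ≤ 1 / (k:ℝ) := by positivity
          apply mul_le_mul (by linarith) _ (by positivity) _
          · apply mul_le_mul_of_nonneg_left (by linarith) (by positivity)
          · refine mul_nonneg (by norm_num) (le_trans ?_ this)
            apply div_nonneg _ hq.le
            linarith
  have hne : 0 < ‖z - 1‖ := by
    rcases (norm_nonneg (z - 1)).eq_or_lt with h | h
    · rw [← h] at hrec; norm_num at hrec
    · exact h
  have hz1 : z ≠ 1 := by
    intro h; rw [h] at hne; simp at hne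
  have hnum : ‖z ^ L - 1‖ ≤ 2 := by
    refine (norm_sub_le _ _).trans ?_
    rw [norm_pow, hn]; norm_num
  rw [geom_sum_eq hz1, norm_div, div_le_iff₀ hne, mul_comm]
  exact hnum.trans hrec

lemma PV_abs {q : ℕ} [NeZero q] (hq : 1 < q) (χ : ZMod q → ℂ) (hmul : ∀ a b, χ (a*b) = χ a * χ b)
    (h0 : ∀ a, ¬ IsUnit a → χ a = 0) (h1 : ∀ a, IsUnit a → ‖χ a‖ = 1)
    (hprim : ∀ b : ZMod q, ¬ IsUnit b → ∃ u, IsUnit u ∧ u * b = b ∧ χ u = -1) (c : ZMod q) (L : ℕ) :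
    ‖∑ j ∈ range L, χ (c + j)‖ ≤ √q * (1 + Real.log q) := by
  set T : ZMod q → ℂ := fun b => ∑ a, χ a * ZMod.stdAddChar (a * b) with hT
  have hqpos : (0:ℝ) < q := by positivity
  have inv : ∀ y, (q:ℂ) * χ y = ∑ b, T b * ZMod.stdAddChar (-(b * y)) := by
    intro y
    simp_rw [hT, sum_mul]
    rw [sum_comm]
    have : ∀ a b : ZMod q, χ a * ZMod.stdAddChar (a * b) * ZMod.stdAddChar (-(b * y))
        = χ a * ZMod.stdAddChar (b * (a - y)) := by
      intro a b
      rw [mul_assoc, ← AddChar.map_add_eq_mul]; congr 2; ring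
    simp_rw [this, ← mul_sum, orth, sub_eq_zero]
    simp only [mul_ite, mul_zero, sum_ite_eq', mem_univ, if_true]; ring
  have e1 : (q:ℂ) * ∑ j ∈ range L, χ (c + j) = ∑ b, T b * ZMod.stdAddChar (-(b * c)) *
      ∑ j ∈ range L, (ZMod.stdAddChar (-b)) ^ j := by
    rw [mul_sum]; simp_rw [inv, mul_sum]
    rw [sum_comm]
    refine sum_congr rfl fun b _ => sum_congr rfl fun j _ => ?_
    rw [mul_assoc, ← AddChar.map_nsmul_eq_pow, ← AddChar.map_add_eq_mul]; congr 2
    simp; ring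
  have e2 : (q:ℝ) * ‖∑ j ∈ range L, χ (c + j)‖ ≤ ∑ k ∈ Ico 1 q, √q * (q / 2 * (1 / k + 1 / ((q:ℝ) - k))) := by
    have : (q:ℝ) * ‖∑ j ∈ range L, χ (c + j)‖ = ‖(q:ℂ) * ∑ j ∈ range L, χ (c + j)‖ := by
      rw [norm_mul]; simp
    rw [this, e1]
    have hr : ∀ f : ZMod q → ℂ, ∑ b, f b = ∑ k ∈ range q, f (k : ZMod q) := by
      intro f
      symm
      refine sum_bij (fun k _ => (k : ZMod q)) (by simp) ?_ ?_ (by simp)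
      · intro a ha b hb h
        rw [ZMod.natCast_eq_natCast_iff] at h
        exact Nat.ModEq.eq_of_lt_of_lt h (mem_range.1 ha) (mem_range.1 hb)
      · intro b _
        exact ⟨b.val, by simpa using ZMod.val_lt b, by simp⟩
    rw [hr, range_eq_Ico, sum_eq_sum_Ico_succ_bot (by omega)]
    have hT0 : T ((0:ℕ) : ZMod q) = 0 := by
      have := T_bound χ hmul h0 h1 hprim ((0:ℕ) : ZMod q)
      have h : ¬ IsUnit ((0:ℕ) : ZMod q) := by
        have : Fact (1 < q) := ⟨hq⟩
        simp
      rw [if_neg h] at this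
      exact norm_le_zero_iff.1 this
    rw [hT0]
    simp only [zero_mul, zero_add]
    refine (norm_sum_le _ _).trans (sum_le_sum fun k hk => ?_)
    rw [norm_mul, norm_mul]
    have hb := T_bound χ hmul h0 h1 hprim (k : ZMod q)
    have hT1 : ‖T (k : ZMod q)‖ ≤ √q := hb.trans (by split_ifs <;> simp)
    have hc1 : ‖(ZMod.stdAddChar (-((k : ZMod q) * c)) : ℂ)‖ = 1 := by
      rw [ZMod.stdAddChar_apply]; exact Circle.norm_coe _
    rw [hc1, mul_one]
    exact mul_le_mul hT1 (geo_bound k hk L) (norm_nonneg _) (by positivity)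
  have e3 : ∑ k ∈ Ico 1 q, √q * (q / 2 * (1 / k + 1 / ((q:ℝ) - k))) = √q * q * ∑ k ∈ Ico 1 q, 1 / (k:ℝ) := by
    have hrefl : ∑ k ∈ Ico 1 q, 1 / ((q:ℝ) - k) = ∑ k ∈ Ico 1 q, 1 / (k:ℝ) := by
      refine sum_bij' (fun k _ => q - k) (fun k _ => q - k) ?_ ?_ ?_ ?_ ?_
      · intro a ha; rw [mem_Ico] at *; omega
      · intro a ha; rw [mem_Ico] at *; omega
      · intro a ha; rw [mem_Ico] at *; omega
      · intro a ha; rw [mem_Ico] at *; omega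
      · intro a ha; rw [mem_Ico] at ha; rw [Nat.cast_sub ha.2.le]
    rw [← mul_sum, ← mul_sum, sum_add_distrib, hrefl]; ring
  have e4 : ∑ k ∈ Ico 1 q, 1 / (k:ℝ) ≤ 1 + Real.log q := by
    refine le_trans ?_ (harmonic_le_one_add_log q)
    rw [harmonic_eq_sum_Icc]; push_cast
    simp_rw [one_div]
    apply sum_le_sum_of_subset_of_nonneg
    · intro a; simp; omega
    · intros; positivity
  rw [e3] at e2
  have : (q:ℝ) * ‖∑ j ∈ range L, χ (c + j)‖ ≤ q * (√q * (1 + Real.log q)) := by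
    refine e2.trans ?_
    rw [mul_comm (√q), mul_assoc]; gcongr
  exact le_of_mul_le_mul_left this hqpos

lemma PV_jacobi {q : ℕ} (hq : 1 < q) (hodd : Odd q) (hsq : Squarefree q) (c : ℤ) (L : ℕ) :
    |∑ j ∈ range L, (jacobiSym (c + j) q : ℝ)| ≤ √q * (1 + Real.log q) := by
  have hq0 : NeZero q := ⟨by omega⟩
  set χ : ZMod q → ℂ := fun a => (jacobiSym (a.val : ℤ) q : ℂ) with hχ
  have hcast : ∀ z : ℤ, χ (z : ZMod q) = (jacobiSym z q : ℂ) := by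
    intro z
    simp only [hχ]
    congr 1
    apply jacobiSym.mod_left'
    rw [ZMod.val_intCast]; simp
  have hsurj : ∀ a : ZMod q, ∃ z : ℤ, (z : ZMod q) = a := ZMod.intCast_surjective
  have hunit : ∀ z : ℤ, IsUnit (z : ZMod q) ↔ z.gcd q = 1 := by
    intro z
    rw [ZMod.coe_int_isUnit_iff_isCoprime, Int.isCoprime_iff_gcd_eq_one, Int.gcd_comm]
  have hmul : ∀ a b, χ (a*b) = χ a * χ b := by
    intro a b
    obtain ⟨a, rfl⟩ := hsurj a
    obtain ⟨b, rfl⟩ := hsurj b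
    rw [← Int.cast_mul, hcast, hcast, hcast, jacobiSym.mul_left]; push_cast; rfl
  have h0 : ∀ a, ¬ IsUnit a → χ a = 0 := by
    intro a ha
    obtain ⟨a, rfl⟩ := hsurj a
    rw [hunit] at ha
    rw [hcast, jacobiSym.eq_zero_iff_not_coprime.2 ha]; simp
  have h1 : ∀ a, IsUnit a → ‖χ a‖ = 1 := by
    intro a ha
    obtain ⟨a, rfl⟩ := hsurj a
    rw [hunit] at ha
    rw [hcast]
    rcases jacobiSym.eq_one_or_neg_one ha with h | h <;> rw [h] <;> simp
  have hprim : ∀ b : ZMod q, ¬ IsUnit b → ∃ u, IsUnit u ∧ u * b = b ∧ χ u = -1 := by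
    intro b hb
    obtain ⟨b, rfl⟩ := hsurj b
    rw [hunit] at hb
    obtain ⟨p, hp, hpd⟩ := Nat.exists_prime_and_dvd hb
    have hpb : (p : ℤ) ∣ b := (Int.natCast_dvd_natCast.2 hpd).trans (Int.gcd_dvd_left ..)
    have hpq : p ∣ q := by
      have := (Int.natCast_dvd_natCast.2 hpd).trans (Int.gcd_dvd_right ..)
      exact_mod_cast this
    obtain ⟨r, rfl⟩ := hpq
    have hcop : Nat.Coprime p r := Nat.coprime_of_squarefree_mul hsq
    have : Fact p.Prime := ⟨hp⟩
    have hp2 : p ≠ 2 := by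
      rintro rfl
      rw [Nat.odd_mul] at hodd
      exact absurd hodd.1 (by decide)
    obtain ⟨n, hn⟩ := FiniteField.exists_nonsquare (F := ZMod p) (by rw [ZMod.ringChar_zmod_n]; exact hp2)
    have hr0 : r ≠ 0 := by rintro rfl; simp at hq
    obtain ⟨u, hu1, hu2⟩ := Nat.chineseRemainder hcop n.val 1
    have hJp : jacobiSym (u : ℤ) p = -1 := by
      rw [ZMod.nonsquare_iff_jacobiSym_eq_neg_one]
      have : ((u:ℤ) : ZMod p) = n := by
        have := (ZMod.natCast_eq_natCast_iff _ _ _).2 hu1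
        push_cast; rw [this]; simp
      rw [this]; exact hn
    have hJr : jacobiSym (u : ℤ) r = 1 := by
      have : (u : ℤ) % r = 1 % r := by exact_mod_cast hu2
      rw [jacobiSym.mod_left' this, jacobiSym.one_left]
    have hJ : jacobiSym (u : ℤ) (p * r) = -1 := by
      rw [jacobiSym.mul_right' _ hp.ne_zero hr0, hJp, hJr]; norm_num
    refine ⟨((u:ℤ) : ZMod (p*r)), ?_, ?_, ?_⟩
    · rw [hunit]
      by_contra h
      have h' := jacobiSym.eq_zero_iff_not_coprime.2 h
      rw [hJ] at h'
      norm_num at h'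
    · rw [← Int.cast_mul, ZMod.intCast_eq_intCast_iff_dvd_sub]
      have hru : (r:ℤ) ∣ 1 - u := by
        have := (Nat.modEq_iff_dvd (n := r) (a := u) (b := 1)).1 hu2
        simpa using this
      have : b - u * b = b * (1 - u) := by ring
      rw [this]; push_cast
      exact mul_dvd_mul hpb hru
    · rw [hcast, hJ]; simp
  have := PV_abs hq χ hmul h0 h1 hprim (c : ZMod q) L
  have e : ∑ j ∈ range L, χ ((c : ZMod q) + j) = ((∑ j ∈ range L, (jacobiSym (c + j) q : ℝ) : ℝ) : ℂ) := by
    push_cast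
    refine sum_congr rfl fun j _ => ?_
    have h := hcast (c + j)
    push_cast at h
    exact h
  rw [e, Complex.norm_real] at this
  exact this

/-- odd part of the Jacobi symbol -/
def FJ (M k : ℕ) : ℝ := if Odd k then (jacobiSym (M : ℤ) k : ℝ) else 0

lemma jac_abs_le (a : ℤ) (k : ℕ) : |(jacobiSym a k : ℝ)| ≤ 1 := by
  rcases jacobiSym.trichotomy a k with h | h | h <;> rw [h] <;> simp

lemma FJ_abs_le (M k : ℕ) : |FJ M k| ≤ 1 := by
  unfold FJ; split_ifs
  · exact jac_abs_le _ _
  · simp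

lemma FJ_mul (M k l : ℕ) : FJ M (k * l) = FJ M k * FJ M l := by
  unfold FJ
  by_cases hk : Odd k
  · by_cases hl : Odd l
    · rw [if_pos (hk.mul hl), if_pos hk, if_pos hl, jacobiSym.mul_right' _ hk.pos.ne' hl.pos.ne']
      push_cast; rfl
    · rw [if_neg hl, if_neg (by rw [Nat.odd_mul]; tauto)]; simp
  · rw [if_neg hk, if_neg (by rw [Nat.odd_mul]; tauto)]; simp

lemma dilate (f : ℕ → ℝ) (d K : ℕ) (hd : 0 < d) :
    ∑ k ∈ (Icc 1 K).filter (fun k => d ∣ k), f k = ∑ l ∈ Icc 1 (K / d), f (d * l) := by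
  symm
  refine sum_bij (fun l _ => d * l) ?_ ?_ ?_ (by simp)
  · intro l hl
    rw [mem_Icc] at hl
    rw [mem_filter, mem_Icc]
    refine ⟨⟨Nat.mul_pos hd hl.1, ?_⟩, dvd_mul_right _ _⟩
    rw [mul_comm]; exact (Nat.le_div_iff_mul_le hd).1 hl.2
  · intro a _ b _ h
    exact Nat.eq_of_mul_eq_mul_left hd h
  · intro k hk
    rw [mem_filter, mem_Icc] at hk
    obtain ⟨⟨h1, h2⟩, l, rfl⟩ := hk
    refine ⟨l, ?_, rfl⟩
    rw [mem_Icc]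
    refine ⟨Nat.pos_of_mul_pos_left h1, (Nat.le_div_iff_mul_le hd).2 (by rw [mul_comm]; exact h2)⟩

lemma FJ_dilate (M : ℕ) (B : ℝ) (hB : ∀ K, |∑ k ∈ Icc 1 K, FJ M k| ≤ B) (d K : ℕ) (hd : 0 < d) :
    |∑ k ∈ (Icc 1 K).filter (fun k => d ∣ k), FJ M k| ≤ B := by
  rw [dilate _ _ _ hd]
  simp_rw [FJ_mul, ← mul_sum]
  rw [abs_mul]
  calc _ ≤ 1 * |∑ k ∈ Icc 1 (K/d), FJ M k| := by gcongr; exact FJ_abs_le _ _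
    _ ≤ B := by rw [one_mul]; exact hB _

lemma sum_range_eight (g : ℕ → ℝ) (L : ℕ) :
    ∑ k ∈ range (8 * L), g k = ∑ r ∈ range 8, ∑ j ∈ range L, g (8 * j + r) := by
  induction L with
  | zero => simp
  | succ L ih =>
    rw [mul_add, mul_one, sum_range_add, ih, ← sum_add_distrib]
    refine sum_congr rfl fun r _ => ?_
    rw [sum_range_succ]

lemma sum_Icc_split (g : ℕ → ℝ) (h0 : g 0 = 0) (hg : ∀ k, |g k| ≤ 1) (B : ℝ)
    (hB : ∀ L, |∑ k ∈ range (8 * L), g k| ≤ B) (K : ℕ) :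
    |∑ k ∈ Icc 1 K, g k| ≤ B + 8 := by
  have e : ∑ k ∈ Icc 1 K, g k = ∑ k ∈ range (K + 1), g k := by
    rw [range_eq_Ico, sum_eq_sum_Ico_succ_bot (by omega), h0, zero_add]; rfl
  have e2 : K + 1 = 8 * ((K+1)/8) + (K+1) % 8 := by omega
  rw [e, e2, sum_range_add]
  refine (abs_add_le _ _).trans (add_le_add (hB _) ?_)
  refine (abs_sum_le_sum_abs _ _).trans ((sum_le_card_nsmul _ _ 1 fun k _ => hg _).trans ?_)
  have : (K+1) % 8 ≤ 8 := by omega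
  simp only [card_range, nsmul_eq_mul, mul_one]
  exact_mod_cast this

lemma class_odd (s : ℕ) (hs : Odd s) (r : ℕ) (hr : Odd r) :
    ∃ (c : ℝ) (t : ℤ), |c| ≤ 1 ∧ ∀ j : ℕ, (jacobiSym (s : ℤ) (8 * j + r) : ℝ) = c * jacobiSym (t + j) s := by
  have hcop : IsCoprime (8:ℤ) (s:ℤ) := by
    rw [Int.isCoprime_iff_gcd_eq_one]
    change Nat.gcd 8 s = 1
    have : Nat.Coprime (2^3) s := Nat.Coprime.pow_left 3 (Nat.coprime_two_left.2 hs)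
    exact this
  obtain ⟨u, v, huv⟩ := hcop
  refine ⟨(jacobiSym (ZMod.χ₄ r) s : ℝ) * (jacobiSym 8 s : ℝ), u * r, ?_, fun j => ?_⟩
  · rw [abs_mul]; exact mul_le_one₀ (jac_abs_le _ _) (abs_nonneg _) (jac_abs_le _ _)
  have hodd : Odd (8 * j + r) := by
    rw [Nat.odd_add, Nat.odd_mul]; simp [show ¬ Odd 8 by decide, show ¬ Even r by simpa using hr]
  rw [jacobiSym.quadratic_reciprocity' hs hodd, qrSign]
  have h1 : (ZMod.χ₄ ((8 * j + r : ℕ) : ZMod 4)) = ZMod.χ₄ (r : ZMod 4) := by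
    congr 1
    push_cast
    have : (8 : ZMod 4) = 0 := by decide
    rw [this]; simp
  have h2 : jacobiSym ((8 * j + r : ℕ) : ℤ) s = jacobiSym 8 s * jacobiSym (u * r + j) s := by
    rw [← jacobiSym.mul_left]
    apply jacobiSym.mod_left'
    apply (Int.emod_emod_of_dvd _ dvd_rfl |>.symm.trans _)
    rw [Int.emod_emod_of_dvd _ dvd_rfl]
    apply Int.ModEq.eq
    rw [Int.modEq_iff_dvd]
    refine ⟨-(v * r), ?_⟩
    push_cast
    linear_combination (r:ℤ) * huv
  rw [h1, h2]; push_cast; ring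

lemma sqrt_log_mono {a b : ℕ} (ha : 1 ≤ a) (hab : a ≤ b) :
    √(a:ℝ) * (1 + Real.log a) ≤ √(b:ℝ) * (1 + Real.log b) := by
  have ha' : (1:ℝ) ≤ a := by exact_mod_cast ha
  have hab' : (a:ℝ) ≤ b := by exact_mod_cast hab
  have : 0 ≤ Real.log a := Real.log_nonneg ha'
  apply mul_le_mul (Real.sqrt_le_sqrt hab') _ (by positivity) (by positivity)
  have := Real.log_le_log (by positivity) hab'
  linarith

lemma FJ_sum_sf (s : ℕ) (hs : Squarefree s) (hs1 : 1 < s) (K : ℕ) :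
    |∑ k ∈ Icc 1 K, FJ s k| ≤ 16 * (√s * (1 + Real.log s)) := by
  have h1 : (1:ℝ) ≤ √s * (1 + Real.log s) := by
    have := sqrt_log_mono (le_refl 1) hs1.le
    simpa using this
  have main : ∀ L, |∑ k ∈ range (8 * L), FJ s k| ≤ 8 * (√s * (1 + Real.log s)) := by
    intro L
    rw [sum_range_eight]
    -- decomposition
    obtain ⟨e, s', hs', hdec⟩ : ∃ e s' : ℕ, Odd s' ∧ s = 2 ^ e * s' := by
      obtain ⟨e, s', h, h'⟩ := Nat.exists_eq_two_pow_mul_odd (n := s) (by omega)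
      exact ⟨e, s', h, h'⟩
    have hle : s' ≤ s := by rw [hdec]; exact Nat.le_mul_of_pos_left _ (by positivity)
    have hclass : ∀ r, Odd r → ∃ (c : ℝ) (t : ℤ), |c| ≤ 1 ∧
        ∀ j : ℕ, FJ s (8 * j + r) = c * jacobiSym (t + j) s' := by
      intro r hr
      obtain ⟨c, t, hc, h⟩ := class_odd s' hs' r hr
      refine ⟨(ZMod.χ₈ (r : ZMod 8) : ℝ) ^ e * c, t, ?_, fun j => ?_⟩
      · rw [abs_mul, abs_pow]
        refine mul_le_one₀ (pow_le_one₀ (abs_nonneg _) ?_) (abs_nonneg _) hc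
        have : ∀ y : ZMod 8, |ZMod.χ₈ y| ≤ 1 := by decide
        exact_mod_cast this r
      have hodd : Odd (8 * j + r) := by
        rw [Nat.odd_add, Nat.odd_mul]
        simp [show ¬ Odd 8 by decide, show ¬ Even r by simpa using hr]
      unfold FJ
      rw [if_pos hodd, hdec]
      push_cast
      rw [jacobiSym.mul_left, jacobiSym.pow_left, jacobiSym.at_two hodd]
      push_cast
      rw [h j]
      have : (8 : ZMod 8) = 0 := by decide
      rw [this]; simp; ring
    by_cases h : s' = 1
    · -- s = 2
      have he : e = 1 := by
        rw [h, mul_one] at hdec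
        rw [hdec] at hs
        have h0 : e ≠ 0 := by rintro rfl; omega
        have := (Nat.squarefree_pow_iff (n := 2) (k := e) (by norm_num) h0).1 hs
        exact this.2
      have hs2 : s = 2 := by rw [hdec, h, he]; norm_num
      have : ∑ r ∈ range 8, ∑ j ∈ range L, FJ s (8 * j + r) = 0 := by
        rw [sum_comm]
        apply sum_eq_zero
        intro j _
        have hv : ∀ r, Odd r → FJ s (8 * j + r) = ZMod.χ₈ (r : ZMod 8) := by
          intro r hr
          have hodd : Odd (8 * j + r) := by
            rw [Nat.odd_add, Nat.odd_mul]
            simp [show ¬ Odd 8 by decide, show ¬ Even r by simpa using hr]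
          unfold FJ
          rw [if_pos hodd, hs2]
          have h8 : (8 : ZMod 8) = 0 := by decide
          have := jacobiSym.at_two hodd
          push_cast at this ⊢
          rw [this, h8]; simp
        have hv0 : ∀ r, ¬ Odd r → FJ s (8 * j + r) = 0 := by
          intro r hr
          unfold FJ
          rw [if_neg]
          rw [Nat.odd_add, Nat.odd_mul]
          simp [show ¬ Odd 8 by decide, show Even r by simpa using hr]
        simp only [sum_range_succ, sum_range_zero]
        rw [hv0 0 (by decide), hv 1 (by decide), hv0 2 (by decide), hv 3 (by decide),
          hv0 4 (by decide), hv 5 (by decide), hv0 6 (by decide), hv 7 (by decide)]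
        have a1 : ZMod.χ₈ ((1:ℕ) : ZMod 8) = 1 := by decide
        have a3 : ZMod.χ₈ ((3:ℕ) : ZMod 8) = -1 := by decide
        have a5 : ZMod.χ₈ ((5:ℕ) : ZMod 8) = -1 := by decide
        have a7 : ZMod.χ₈ ((7:ℕ) : ZMod 8) = 1 := by decide
        rw [a1, a3, a5, a7]; norm_num
      rw [this, abs_zero]; linarith
    · have hs'1 : 1 < s' := by have := hs'.pos; omega
      have hsf : Squarefree s' := hs.squarefree_of_dvd ⟨2 ^ e, by rw [hdec]; ring⟩
      refine (abs_sum_le_sum_abs _ _).trans ((sum_le_card_nsmul _ _ (√s * (1 + Real.log s)) ?_).trans ?_)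
      · intro r _
        by_cases hr : Odd r
        · obtain ⟨c, t, hc, hh⟩ := hclass r hr
          simp_rw [hh, ← mul_sum]
          rw [abs_mul]
          calc _ ≤ 1 * (√s' * (1 + Real.log s')) := by
                gcongr
                exact PV_jacobi hs'1 hs' hsf t L
            _ ≤ _ := by rw [one_mul]; exact sqrt_log_mono hs'1.le hle
        · rw [sum_eq_zero]
          · rw [abs_zero]; linarith
          · intro j _
            unfold FJ
            rw [if_neg]
            rw [Nat.odd_add, Nat.odd_mul]
            simp [show ¬ Odd 8 by decide, show Even r by simpa using hr]
      · simp
  have := sum_Icc_split (FJ s) (by simp [FJ]) (FJ_abs_le s) _ main K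
  linarith

lemma FJ_sum (M : ℕ) (hM : ¬ IsSquare M) (K : ℕ) :
    |∑ k ∈ Icc 1 K, FJ M k| ≤ 16 * (√M * (1 + Real.log M)) := by
  obtain ⟨s, t, hst, hs⟩ := Nat.sq_mul_squarefree M
  have hM0 : M ≠ 0 := by rintro rfl; exact hM ⟨0, rfl⟩
  have ht : t ≠ 0 := by rintro rfl; simp at hst; exact hM0 hst.symm
  have hs0 : s ≠ 0 := by rintro rfl; simp at hst; exact hM0 hst.symm
  have hs1 : 1 < s := by
    rcases Nat.lt_or_ge 1 s with h | h
    · exact h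
    · have : s = 1 := by omega
      exact absurd ⟨t, by rw [← hst, this]; ring⟩ hM
  have hFJ : ∀ k ∈ Icc 1 K, FJ M k = ∑ d ∈ t.divisors, (ArithmeticFunction.moebius d : ℝ) * if d ∣ k then FJ s k else 0 := by
    intro k hk
    rw [mem_Icc] at hk
    have e1 : FJ M k = if Nat.gcd t k = 1 then FJ s k else 0 := by
      unfold FJ
      split_ifs with h1 h2 h2
      · rw [← hst]; push_cast
        rw [jacobiSym.mul_left, jacobiSym.sq_one', one_mul]
        exact h2
      · rw [← hst]; push_cast
        rw [jacobiSym.mul_left, jacobiSym.pow_left, (jacobiSym.eq_zero_iff (a := (t:ℤ)) (b := k)).2 ⟨by omega, h2⟩]; simp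
      · rfl
      · rfl
    rw [e1]
    have e2 : ∑ d ∈ t.divisors, (ArithmeticFunction.moebius d : ℝ) * (if d ∣ k then FJ s k else 0)
        = (∑ d ∈ (Nat.gcd t k).divisors, (ArithmeticFunction.moebius d : ℝ)) * FJ s k := by
      have : (Nat.gcd t k).divisors = t.divisors.filter (fun d => d ∣ k) := by
        ext d; simp [Nat.dvd_gcd_iff, ht]
      rw [this, sum_filter, sum_mul]
      refine sum_congr rfl fun d _ => ?_
      split_ifs <;> simp
    rw [e2]
    have e3 := congrArg (fun f => f (Nat.gcd t k)) ArithmeticFunction.moebius_mul_coe_zeta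
    simp only [ArithmeticFunction.coe_mul_zeta_apply, ArithmeticFunction.one_apply] at e3
    have e4 : ∑ d ∈ (Nat.gcd t k).divisors, (ArithmeticFunction.moebius d : ℝ) = if Nat.gcd t k = 1 then 1 else 0 := by
      exact_mod_cast e3
    rw [e4]; split_ifs <;> simp
  rw [sum_congr rfl hFJ, sum_comm]
  simp_rw [← mul_sum, ← sum_filter]
  have hb := FJ_sum_sf s hs hs1
  refine (abs_sum_le_sum_abs _ _).trans ((sum_le_card_nsmul _ _ (16 * (√s * (1 + Real.log s))) ?_).trans ?_)
  · intro d hd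
    rw [abs_mul]
    have : |(ArithmeticFunction.moebius d : ℝ)| ≤ 1 := by exact_mod_cast ArithmeticFunction.abs_moebius_le_one
    calc _ ≤ 1 * (16 * (√s * (1 + Real.log s))) := by
          gcongr
          exact FJ_dilate s _ hb d K (Nat.pos_of_mem_divisors hd)
      _ = _ := one_mul _
  · rw [nsmul_eq_mul]
    have hc : (#t.divisors : ℝ) ≤ t := by exact_mod_cast Nat.card_divisors_le_self t
    have hsM : s ≤ M := by rw [← hst]; exact Nat.le_mul_of_pos_left _ (by positivity)
    have hsqrt : √(M:ℝ) = t * √s := by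
      rw [← hst]; push_cast
      rw [Real.sqrt_mul (by positivity), Real.sqrt_sq (by positivity)]
    have hlog : Real.log s ≤ Real.log M := Real.log_le_log (by positivity) (by exact_mod_cast hsM)
    have hl0 : 0 ≤ Real.log s := Real.log_natCast_nonneg s
    calc _ ≤ (t:ℝ) * (16 * (√s * (1 + Real.log M))) := by gcongr
      _ = _ := by rw [hsqrt]; ring

/-- `μ²(l)/φ(l)` -/
def hS (l : ℕ) : ℝ := if Squarefree l then 1 / (Nat.totient l : ℝ) else 0

lemma hS_nonneg (l : ℕ) : 0 ≤ hS l := by unfold hS; split_ifs <;> positivity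

lemma sum_inv_sq (D : ℕ) : ∑ t ∈ Icc 1 D, 1 / (t:ℝ)^2 ≤ 2 := by
  have : ∀ n : ℕ, ∑ t ∈ Icc 1 (n+1), 1 / (t:ℝ)^2 ≤ 2 - 1 / ((n:ℝ)+1) := by
    intro n
    induction n with
    | zero => norm_num
    | succ n ih =>
      rw [sum_Icc_succ_top (by omega)]
      have : 1 / (((n+1+1 : ℕ) : ℝ))^2 ≤ 1 / ((n:ℝ)+1) - 1 / ((n:ℝ)+1+1) := by
        push_cast
        rw [div_sub_div _ _ (by positivity) (by positivity), div_le_div_iff₀ (by positivity) (by positivity)]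
        have : (0:ℝ) ≤ n := by positivity
        nlinarith
      push_cast at this ⊢
      linarith
  rcases D with _ | n
  · simp
  · have h := this n
    have : 0 ≤ 1 / ((n:ℝ)+1) := by positivity
    linarith

lemma log_le_sum_hS (D : ℕ) : Real.log (D + 1) ≤ 2 * ∑ l ∈ Icc 1 D, hS l := by
  have h1 : Real.log (D+1) ≤ ∑ n ∈ Icc 1 D, 1 / (n:ℝ) := by
    have := log_add_one_le_harmonic D
    rw [harmonic_eq_sum_Icc] at this
    push_cast at this
    simpa [one_div] using this
  have h2 : ∑ n ∈ Icc 1 D, 1 / (n:ℝ) ≤ (∑ t ∈ Icc 1 D, 1 / (t:ℝ)^2) * ∑ l ∈ Icc 1 D, hS l := by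
    rw [sum_mul_sum, ← sum_product']
    have hch : ∀ n : ℕ, ∃ q : ℕ × ℕ, q.1^2 * q.2 = n ∧ Squarefree q.2 := by
      intro n
      obtain ⟨a, b, h, h'⟩ := Nat.sq_mul_squarefree n
      exact ⟨(b, a), h, h'⟩
    choose g hg1 hg2 using hch
    have hinj : Set.InjOn g (Icc 1 D : Finset ℕ) := by
      intro a _ b _ h
      rw [← hg1 a, ← hg1 b, h]
    calc ∑ n ∈ Icc 1 D, 1 / (n:ℝ) ≤ ∑ n ∈ Icc 1 D, (1 / ((g n).1:ℝ)^2 * hS (g n).2) := by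
          refine sum_le_sum fun n hn => ?_
          rw [mem_Icc] at hn
          unfold hS
          rw [if_pos (hg2 n)]
          have e := hg1 n
          have hpos : 0 < (g n).2 := Nat.pos_of_ne_zero (by intro h; rw [h] at e; omega)
          have hpos1 : 0 < (g n).1 := Nat.pos_of_ne_zero (by intro h; rw [h] at e; omega)
          rw [div_mul_div_comm, one_mul]
          have ht : 0 < Nat.totient (g n).2 := Nat.totient_pos.2 hpos
          apply one_div_le_one_div_of_le (by positivity)
          have : (g n).1^2 * Nat.totient (g n).2 ≤ n := by
            conv_rhs => rw [← e]
            exact Nat.mul_le_mul_left _ (Nat.totient_le _)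
          exact_mod_cast this
      _ = ∑ q ∈ (Icc 1 D).image g, (1 / (q.1:ℝ)^2 * hS q.2) := by
          rw [sum_image hinj]
      _ ≤ _ := by
          apply sum_le_sum_of_subset_of_nonneg
          · intro q hq
            rw [mem_image] at hq
            obtain ⟨n, hn, rfl⟩ := hq
            rw [mem_Icc] at hn
            have e := hg1 n
            have hpos : 0 < (g n).2 := Nat.pos_of_ne_zero (by intro h; rw [h] at e; omega)
            have hpos1 : 0 < (g n).1 := Nat.pos_of_ne_zero (by intro h; rw [h] at e; omega)
            rw [mem_product, mem_Icc, mem_Icc]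
            refine ⟨⟨hpos1, ?_⟩, hpos, ?_⟩ <;> nlinarith [Nat.mul_pos hpos1 hpos]
          · intro q _ _
            exact mul_nonneg (by positivity) (hS_nonneg _)
  have h3 : 0 ≤ ∑ l ∈ Icc 1 D, hS l := sum_nonneg fun l _ => hS_nonneg l
  exact h1.trans (h2.trans (mul_le_mul_of_nonneg_right (sum_inv_sq D) h3))

lemma inner_moebius (f l : ℕ) (hl : Squarefree l) (hf : 0 < f) :
    ∑ d ∈ l.divisors.filter (fun d => f ∣ d), (ArithmeticFunction.moebius d : ℝ)
      = if l = f then (ArithmeticFunction.moebius f : ℝ) else 0 := by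
  have hl0 : l ≠ 0 := hl.ne_zero
  by_cases hfl : f ∣ l
  · obtain ⟨g, rfl⟩ := hfl
    have hg0 : g ≠ 0 := by rintro rfl; simp at hl0
    have e1 : ∑ d ∈ (f * g).divisors.filter (fun d => f ∣ d), (ArithmeticFunction.moebius d : ℝ)
        = ∑ e ∈ g.divisors, (ArithmeticFunction.moebius (f * e) : ℝ) := by
      symm
      refine sum_bij (fun e _ => f * e) ?_ ?_ ?_ (by simp)
      · intro e he
        rw [Nat.mem_divisors] at he
        rw [mem_filter, Nat.mem_divisors]
        exact ⟨⟨mul_dvd_mul_left f he.1, hl0⟩, dvd_mul_right _ _⟩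
      · intro a _ b _ h; exact Nat.eq_of_mul_eq_mul_left hf h
      · intro d hd
        rw [mem_filter, Nat.mem_divisors] at hd
        obtain ⟨⟨h1, _⟩, e, rfl⟩ := hd
        exact ⟨e, Nat.mem_divisors.2 ⟨Nat.dvd_of_mul_dvd_mul_left hf h1, hg0⟩, rfl⟩
    have e2 : ∀ e ∈ g.divisors, (ArithmeticFunction.moebius (f * e) : ℝ)
        = ArithmeticFunction.moebius f * ArithmeticFunction.moebius e := by
      intro e he
      have hc : Nat.Coprime f e :=
        Nat.Coprime.coprime_dvd_right (Nat.dvd_of_mem_divisors he) (Nat.coprime_of_squarefree_mul hl)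
      rw [ArithmeticFunction.isMultiplicative_moebius.map_mul_of_coprime hc]; push_cast; rfl
    rw [e1, sum_congr rfl e2, ← mul_sum]
    have e3 := congrArg (fun F => F g) ArithmeticFunction.moebius_mul_coe_zeta
    simp only [ArithmeticFunction.coe_mul_zeta_apply, ArithmeticFunction.one_apply] at e3
    have e4 : ∑ d ∈ g.divisors, (ArithmeticFunction.moebius d : ℝ) = if g = 1 then 1 else 0 := by
      exact_mod_cast e3
    rw [e4]
    have : f * g = f ↔ g = 1 := by
      constructor
      · intro h; exact Nat.eq_of_mul_eq_mul_left hf (by rw [h, mul_one])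
      · rintro rfl; simp
    simp only [this]; split_ifs <;> simp
  · rw [if_neg (by rintro rfl; exact hfl dvd_rfl)]
    apply sum_eq_zero
    intro d hd
    rw [mem_filter, Nat.mem_divisors] at hd
    exact absurd (hd.2.trans hd.1.1) hfl

lemma selberg (D : ℕ) (hD : 1 ≤ D) : ∃ lam : ℕ → ℝ, lam 1 = 1 ∧ (∀ d, |lam d| ≤ d) ∧
    ∑ d ∈ Icc 1 D, ∑ e ∈ Icc 1 D, lam d * lam e / (Nat.lcm d e : ℝ) ≤ 2 / Real.log (D + 1) := by
  set L := ∑ l ∈ Icc 1 D, hS l with hL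
  have hlog : 0 < Real.log (D + 1) := Real.log_pos (by
    have : (1:ℝ) ≤ D := by exact_mod_cast hD
    linarith)
  have hLlog := log_le_sum_hS D
  have hLpos : 0 < L := by rw [← hL] at hLlog; linarith
  set G : ℕ → ℝ := fun d => ∑ l ∈ (Icc 1 D).filter (fun l => d ∣ l), hS l with hG
  set lam : ℕ → ℝ := fun d => (ArithmeticFunction.moebius d : ℝ) * d / L * G d with hlam
  refine ⟨lam, ?_, ?_, ?_⟩
  · have : G 1 = L := by simp [hG, hL]
    simp only [hlam, this]; simp; field_simp
  · intro d
    have hG0 : 0 ≤ G d := sum_nonneg fun l _ => hS_nonneg l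
    have hGL : G d ≤ L := sum_le_sum_of_subset_of_nonneg (filter_subset _ _) fun l _ _ => hS_nonneg l
    have hmu : |(ArithmeticFunction.moebius d : ℝ)| ≤ 1 := by
      exact_mod_cast ArithmeticFunction.abs_moebius_le_one
    simp only [hlam]
    rw [abs_mul, abs_div, abs_mul, abs_of_pos hLpos, abs_of_nonneg hG0, Nat.abs_cast]
    calc _ ≤ 1 * (d:ℝ) / L * L := by gcongr
      _ = d := by field_simp
  · set y : ℕ → ℝ := fun f => ∑ d ∈ (Icc 1 D).filter (fun d => f ∣ d), lam d / d with hy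
    have hyv : ∀ f ∈ Icc 1 D, y f = 1 / L * (hS f * ArithmeticFunction.moebius f) := by
      intro f hf
      rw [mem_Icc] at hf
      have e1 : y f = 1 / L * ∑ d ∈ Icc 1 D, ∑ l ∈ Icc 1 D,
          if f ∣ d ∧ d ∣ l then hS l * (ArithmeticFunction.moebius d : ℝ) else 0 := by
        simp only [hy]
        rw [sum_filter, mul_sum]
        refine sum_congr rfl fun d hd => ?_
        rw [mem_Icc] at hd
        have hd0 : (d:ℝ) ≠ 0 := by have := hd.1; positivity
        split_ifs with h
        · simp only [h, true_and, hlam, hG]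
          rw [sum_filter, mul_sum, sum_div, mul_sum]
          refine sum_congr rfl fun l _ => ?_
          split_ifs
          · field_simp
          · simp
        · simp [h]
      rw [e1, sum_comm]
      congr 1
      have e2 : ∀ l ∈ Icc 1 D, (∑ d ∈ Icc 1 D, if f ∣ d ∧ d ∣ l then hS l * (ArithmeticFunction.moebius d : ℝ) else 0)
          = if l = f then hS f * (ArithmeticFunction.moebius f : ℝ) else 0 := by
        intro l hl
        rw [mem_Icc] at hl
        rw [← sum_filter, ← mul_sum]
        have : (Icc 1 D).filter (fun d => f ∣ d ∧ d ∣ l) = l.divisors.filter (fun d => f ∣ d) := by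
          ext d
          rw [mem_filter, mem_filter, mem_Icc, Nat.mem_divisors]
          constructor
          · rintro ⟨_, h1, h2⟩; exact ⟨⟨h2, by omega⟩, h1⟩
          · rintro ⟨⟨h2, _⟩, h1⟩
            have := Nat.le_of_dvd (by omega) h2
            exact ⟨⟨Nat.pos_of_dvd_of_pos h2 (by omega), by omega⟩, h1, h2⟩
        rw [this]
        by_cases hs : Squarefree l
        · rw [inner_moebius f l hs (by omega)]
          split_ifs with h
          · rw [h]
          · simp
        · have : hS l = 0 := by unfold hS; rw [if_neg hs]
          rw [this, zero_mul]
          split_ifs with h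
          · rw [← h, this, zero_mul]
          · rfl
      rw [sum_congr rfl e2, sum_ite_eq', if_pos (by rw [mem_Icc]; exact hf)]
    have hdiag : ∑ d ∈ Icc 1 D, ∑ e ∈ Icc 1 D, lam d * lam e / (Nat.lcm d e : ℝ)
        = ∑ f ∈ Icc 1 D, (Nat.totient f : ℝ) * y f ^ 2 := by
      have e1 : ∀ d ∈ Icc 1 D, ∀ e ∈ Icc 1 D, lam d * lam e / (Nat.lcm d e : ℝ)
          = ∑ f ∈ Icc 1 D, (Nat.totient f : ℝ) * ((if f ∣ d then lam d / d else 0) * (if f ∣ e then lam e / e else 0)) := by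
        intro d hd e he
        rw [mem_Icc] at hd he
        have hg : (Nat.gcd d e : ℝ) = ∑ f ∈ (Icc 1 D).filter (fun f => f ∣ d ∧ f ∣ e), (Nat.totient f : ℝ) := by
          have : (Icc 1 D).filter (fun f => f ∣ d ∧ f ∣ e) = (Nat.gcd d e).divisors := by
            ext f
            rw [mem_filter, mem_Icc, Nat.mem_divisors, Nat.dvd_gcd_iff]
            constructor
            · rintro ⟨_, h⟩; exact ⟨h, (Nat.gcd_pos_of_pos_left _ (by omega)).ne'⟩
            · rintro ⟨h, _⟩
              have := Nat.le_of_dvd (by omega) h.1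
              exact ⟨⟨Nat.pos_of_dvd_of_pos h.1 (by omega), by omega⟩, h⟩
          rw [this]
          exact_mod_cast (Nat.sum_totient (Nat.gcd d e)).symm
        have hgl : (Nat.gcd d e : ℝ) * Nat.lcm d e = d * e := by exact_mod_cast Nat.gcd_mul_lcm d e
        have hd0 : (d:ℝ) ≠ 0 := by have := hd.1; positivity
        have he0 : (e:ℝ) ≠ 0 := by have := he.1; positivity
        have hl0 : (Nat.lcm d e : ℝ) ≠ 0 := by
          have := Nat.lcm_pos (m := d) (n := e) (by omega) (by omega)
          positivity
        have : lam d * lam e / (Nat.lcm d e : ℝ) = lam d / d * (lam e / e) * Nat.gcd d e := by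
          field_simp
          linear_combination (-(lam d * lam e)) * hgl
        rw [this, hg, sum_filter, mul_sum]
        refine sum_congr rfl fun f _ => ?_
        by_cases h1 : f ∣ d <;> by_cases h2 : f ∣ e <;> simp [h1, h2]
        ring
      rw [sum_congr rfl fun d hd => sum_congr rfl fun e he => e1 d hd e he]
      rw [sum_congr rfl fun d hd => sum_comm, sum_comm]
      refine sum_congr rfl fun f _ => ?_
      simp_rw [← mul_sum]
      simp only [hy]
      rw [sq, sum_filter, sum_mul]
    rw [hdiag]
    have e5 : ∑ f ∈ Icc 1 D, (Nat.totient f : ℝ) * y f ^ 2 = 1 / L := by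
      have : ∀ f ∈ Icc 1 D, (Nat.totient f : ℝ) * y f ^ 2 = (1 / L)^2 * hS f := by
        intro f hf
        rw [hyv f hf]
        rw [mem_Icc] at hf
        unfold hS
        split_ifs with h
        · have hm : (ArithmeticFunction.moebius f : ℝ)^2 = 1 := by
            exact_mod_cast ArithmeticFunction.moebius_sq_eq_one_of_squarefree h
          have ht : (Nat.totient f : ℝ) ≠ 0 := by
            have := Nat.totient_pos.2 (show 0 < f by omega)
            positivity
          rw [mul_pow, mul_pow, hm]; field_simp
        · simp
      rw [sum_congr rfl this, ← mul_sum, ← hL]; field_simp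
    rw [e5, div_le_div_iff₀ hLpos hlog]
    linarith

/-- Selberg weight -/
def wS (D : ℕ) (lam : ℕ → ℝ) (k : ℕ) : ℝ := (∑ d ∈ (Icc 1 D).filter (fun d => d ∣ k), lam d) ^ 2

lemma wS_sum (D : ℕ) (lam G : ℕ → ℝ) (K : ℕ) :
    ∑ k ∈ Icc 1 K, wS D lam k * G k = ∑ d ∈ Icc 1 D, ∑ e ∈ Icc 1 D, lam d * lam e *
      ∑ k ∈ (Icc 1 K).filter (fun k => Nat.lcm d e ∣ k), G k := by
  have : ∀ k, wS D lam k * G k = ∑ d ∈ Icc 1 D, ∑ e ∈ Icc 1 D, lam d * lam e * (if Nat.lcm d e ∣ k then G k else 0) := by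
    intro k
    unfold wS
    rw [sq, sum_filter, sum_mul_sum, sum_mul]
    refine sum_congr rfl fun d _ => ?_
    rw [sum_mul]
    refine sum_congr rfl fun e _ => ?_
    simp only [Nat.lcm_dvd_iff]
    by_cases h1 : d ∣ k <;> by_cases h2 : e ∣ k <;> simp [h1, h2]
  simp_rw [this]
  rw [sum_comm]
  refine sum_congr rfl fun d _ => ?_
  rw [sum_comm]
  refine sum_congr rfl fun e _ => ?_
  rw [← mul_sum, ← sum_filter]

lemma lam_sum (D : ℕ) (lam : ℕ → ℝ) (h : ∀ d, |lam d| ≤ d) :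
    ∑ d ∈ Icc 1 D, ∑ e ∈ Icc 1 D, |lam d * lam e| ≤ (D:ℝ)^4 := by
  have : ∀ d ∈ Icc 1 D, ∀ e ∈ Icc 1 D, |lam d * lam e| ≤ (D:ℝ)^2 := by
    intro d hd e he
    rw [mem_Icc] at hd he
    have h1 : (d:ℝ) ≤ D := by exact_mod_cast hd.2
    have h2 : (e:ℝ) ≤ D := by exact_mod_cast he.2
    rw [abs_mul, sq]
    exact mul_le_mul ((h d).trans h1) ((h e).trans h2) (abs_nonneg _) (by positivity)
  calc _ ≤ ∑ d ∈ Icc 1 D, ∑ e ∈ Icc 1 D, (D:ℝ)^2 := sum_le_sum fun d hd => sum_le_sum fun e he => this d hd e he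
    _ = _ := by simp; ring

lemma wS_bound (D : ℕ) (lam : ℕ → ℝ) (h : ∀ d, |lam d| ≤ d) (G : ℕ → ℝ) (K : ℕ) (B : ℝ) 
    (hB : ∀ d, 0 < d → |∑ k ∈ (Icc 1 K).filter (fun k => d ∣ k), G k| ≤ B) :
    |∑ k ∈ Icc 1 K, wS D lam k * G k| ≤ (D:ℝ)^4 * B := by
  have hB0 : 0 ≤ B := (abs_nonneg _).trans (hB 1 one_pos)
  rw [wS_sum]
  calc _ ≤ ∑ d ∈ Icc 1 D, ∑ e ∈ Icc 1 D, |lam d * lam e| * B := by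
        refine (abs_sum_le_sum_abs _ _).trans (sum_le_sum fun d hd => ?_)
        refine (abs_sum_le_sum_abs _ _).trans (sum_le_sum fun e he => ?_)
        rw [mem_Icc] at hd he
        rw [abs_mul]
        exact mul_le_mul_of_nonneg_left (hB _ (Nat.lcm_pos (by omega) (by omega))) (abs_nonneg _)
    _ = (∑ d ∈ Icc 1 D, ∑ e ∈ Icc 1 D, |lam d * lam e|) * B := by simp_rw [sum_mul]
    _ ≤ _ := mul_le_mul_of_nonneg_right (lam_sum D lam h) hB0

lemma wS_total (D : ℕ) (lam : ℕ → ℝ) (h : ∀ d, |lam d| ≤ d) (K : ℕ) :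
    ∑ k ∈ Icc 1 K, wS D lam k ≤
      K * (∑ d ∈ Icc 1 D, ∑ e ∈ Icc 1 D, lam d * lam e / (Nat.lcm d e : ℝ)) + (D:ℝ)^4 := by
  have e1 := wS_sum D lam (fun _ => 1) K
  simp only [mul_one] at e1
  rw [e1]
  refine le_trans ?_ (add_le_add_right (lam_sum D lam h) _)
  rw [mul_sum, ← sum_add_distrib]
  refine sum_le_sum fun d hd => ?_
  rw [mul_sum, ← sum_add_distrib]
  refine sum_le_sum fun e he => ?_
  rw [mem_Icc] at hd he
  have hl := Nat.lcm_pos (m := d) (n := e) (by omega) (by omega)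
  have hc : ∑ k ∈ (Icc 1 K).filter (fun k => Nat.lcm d e ∣ k), (1:ℝ) = ((K / Nat.lcm d e : ℕ) : ℝ) := by
    rw [sum_const, nsmul_eq_mul, mul_one]
    norm_cast
    have := Nat.Ioc_filter_dvd_card_eq_div K (Nat.lcm d e)
    rw [← this]; rfl
  rw [hc]
  set l := Nat.lcm d e
  have hl' : (0:ℝ) < l := by exact_mod_cast hl
  have h1 : ((K / l : ℕ) : ℝ) ≤ (K:ℝ) / l := Nat.cast_div_le
  have h2 : (K:ℝ) / l ≤ ((K / l : ℕ) : ℝ) + 1 := by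
    rw [div_le_iff₀ hl']
    have := Nat.lt_div_mul_add (a := K) hl
    have h3 : K ≤ (K / l + 1) * l := by rw [add_mul, one_mul]; omega
    exact_mod_cast h3
  have : lam d * lam e * (((K / l : ℕ) : ℝ) - (K:ℝ) / l) ≤ |lam d * lam e| := by
    refine (le_abs_self _).trans ?_
    rw [abs_mul]
    apply mul_le_of_le_one_right (abs_nonneg _)
    rw [abs_le]; constructor <;> linarith
  calc _ = K * (lam d * lam e / l) + lam d * lam e * (((K / l : ℕ) : ℝ) - (K:ℝ) / l) := by ring
    _ ≤ _ := by linarith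

/-- the diagonal-type sum -/
def RS (N : ℕ) (a : ℕ → ℂ) : ℝ :=
  ∑ q ∈ (Finset.Icc 1 N ×ˢ Finset.Icc 1 N).filter (fun q => IsSquare (q.1 * q.2)), ‖a q.1 * a q.2‖

lemma RS_nonneg (N : ℕ) (a : ℕ → ℂ) : 0 ≤ RS N a := sum_nonneg fun _ _ => norm_nonneg _

lemma l1_sq (N : ℕ) (a : ℕ → ℂ) : (∑ n ∈ Icc 1 N, ‖a n‖) ^ 2 ≤ N * RS N a := by
  have h1 := sq_sum_le_card_mul_sum_sq (s := Icc 1 N) (f := fun n => ‖a n‖)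
  simp only [Nat.card_Icc, Nat.add_sub_cancel] at h1
  refine h1.trans (mul_le_mul_of_nonneg_left ?_ (by positivity))
  have hinj : Set.InjOn (fun n : ℕ => (n, n)) (Icc 1 N : Finset ℕ) := by
    intro a _ b _ h; exact (Prod.mk.inj h).1
  calc ∑ n ∈ Icc 1 N, ‖a n‖^2 = ∑ q ∈ (Icc 1 N).image (fun n => (n, n)), ‖a q.1 * a q.2‖ := by
        rw [sum_image hinj]
        refine sum_congr rfl fun n _ => ?_
        rw [norm_mul, sq]
    _ ≤ _ := by
        apply sum_le_sum_of_subset_of_nonneg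
        · intro q hq
          rw [mem_image] at hq
          obtain ⟨n, hn, rfl⟩ := hq
          rw [mem_filter, mem_product]
          exact ⟨⟨hn, hn⟩, n, rfl⟩
        · intros; exact norm_nonneg _

lemma S_le (N : ℕ) (a : ℕ → ℂ) (k : ℕ) :
    ‖∑ n ∈ Icc 1 N, a n * (jacobiSym (n : ℤ) k : ℂ)‖ ^ 2 ≤ N * RS N a := by
  refine le_trans ?_ (l1_sq N a)
  apply pow_le_pow_left₀ (norm_nonneg _)
  refine (norm_sum_le _ _).trans (sum_le_sum fun n _ => ?_)
  rw [norm_mul]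
  apply mul_le_of_le_one_right (norm_nonneg _)
  have := jac_abs_le (n:ℤ) k
  rw [← Complex.ofReal_intCast, Complex.norm_real]; exact this

lemma S_expand (N : ℕ) (a : ℕ → ℂ) (k : ℕ) :
    ((if Odd k then ‖∑ n ∈ Icc 1 N, a n * (jacobiSym (n : ℤ) k : ℂ)‖ ^ 2 else 0 : ℝ) : ℂ)
      = ∑ q ∈ Icc 1 N ×ˢ Icc 1 N, a q.1 * (starRingEnd ℂ) (a q.2) * (FJ (q.1 * q.2) k : ℂ) := by
  unfold FJ
  split_ifs with h
  · rw [← Complex.normSq_eq_norm_sq, ← Complex.mul_conj, map_sum, sum_mul_sum, ← sum_product']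
    refine sum_congr rfl fun q _ => ?_
    push_cast
    rw [jacobiSym.mul_left, map_mul]
    push_cast
    simp; ring
  · simp

lemma S_total (N : ℕ) (a : ℕ → ℂ) (D K : ℕ) (lam : ℕ → ℝ) (h : ∀ d, |lam d| ≤ d) (W B : ℝ)
    (hW : ∑ k ∈ Icc 1 K, wS D lam k ≤ W)
    (hB : ∀ m ∈ Icc 1 N, ∀ n ∈ Icc 1 N, ¬ IsSquare (m * n) → ∀ K', |∑ k ∈ Icc 1 K', FJ (m * n) k| ≤ B)
    (hB0 : 0 ≤ B) :
    ∑ k ∈ Icc 1 K, wS D lam k * (if Odd k then ‖∑ n ∈ Icc 1 N, a n * (jacobiSym (n : ℤ) k : ℂ)‖ ^ 2 else 0)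
      ≤ W * RS N a + (D:ℝ)^4 * B * (N * RS N a) := by
  have hw0 : ∀ k, 0 ≤ wS D lam k := fun k => sq_nonneg _
  set X := ∑ k ∈ Icc 1 K, wS D lam k * (if Odd k then ‖∑ n ∈ Icc 1 N, a n * (jacobiSym (n : ℤ) k : ℂ)‖ ^ 2 else 0) with hX
  have e1 : (X : ℂ) = ∑ q ∈ Icc 1 N ×ˢ Icc 1 N, a q.1 * (starRingEnd ℂ) (a q.2) *
      ((∑ k ∈ Icc 1 K, wS D lam k * FJ (q.1 * q.2) k : ℝ) : ℂ) := by
    rw [hX, Complex.ofReal_sum]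
    simp_rw [Complex.ofReal_mul, S_expand, mul_sum]
    rw [sum_comm]
    refine sum_congr rfl fun q _ => ?_
    rw [Complex.ofReal_sum, mul_sum]
    refine sum_congr rfl fun k _ => ?_
    push_cast; ring
  have e2 : X ≤ ∑ q ∈ Icc 1 N ×ˢ Icc 1 N, ‖a q.1 * a q.2‖ * |∑ k ∈ Icc 1 K, wS D lam k * FJ (q.1 * q.2) k| := by
    calc X ≤ ‖(X:ℂ)‖ := by rw [Complex.norm_real]; exact le_abs_self _
      _ ≤ _ := by
        rw [e1]
        refine (norm_sum_le _ _).trans (sum_le_sum fun q _ => ?_)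
        rw [norm_mul, norm_mul, norm_mul, Complex.norm_real, Real.norm_eq_abs, Complex.norm_conj]
  refine e2.trans ?_
  have e3 : ∀ q ∈ Icc 1 N ×ˢ Icc 1 N, ‖a q.1 * a q.2‖ * |∑ k ∈ Icc 1 K, wS D lam k * FJ (q.1 * q.2) k|
      ≤ W * (if IsSquare (q.1 * q.2) then ‖a q.1 * a q.2‖ else 0) + (D:ℝ)^4 * B * (‖a q.1‖ * ‖a q.2‖) := by
    intro q hq
    rw [mem_product] at hq
    have hn := norm_nonneg (a q.1 * a q.2)
    split_ifs with hs
    · have : |∑ k ∈ Icc 1 K, wS D lam k * FJ (q.1 * q.2) k| ≤ W := by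
        refine le_trans ((abs_sum_le_sum_abs _ _).trans (sum_le_sum fun k _ => ?_)) hW
        rw [abs_mul, abs_of_nonneg (hw0 k)]
        exact mul_le_of_le_one_right (hw0 k) (FJ_abs_le _ _)
      have h2 : 0 ≤ (D:ℝ)^4 * B * (‖a q.1‖ * ‖a q.2‖) := by positivity
      nlinarith
    · have := wS_bound D lam h (FJ (q.1 * q.2)) K B
        (fun d hd => FJ_dilate _ B (hB _ hq.1 _ hq.2 hs) d K hd)
      rw [mul_zero, zero_add, norm_mul]
      rw [norm_mul] at hn
      nlinarith
  refine (sum_le_sum e3).trans ?_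
  rw [sum_add_distrib, ← mul_sum, ← mul_sum, ← sum_filter]
  apply add_le_add
  · exact le_rfl
  · apply mul_le_mul_of_nonneg_left _ (by positivity)
    refine le_trans (le_of_eq ?_) (l1_sq N a)
    rw [sq, sum_mul_sum, ← sum_product']

lemma prime_sum_le (N : ℕ) (a : ℕ → ℂ) (D : ℕ) (hD : 1 ≤ D) (x : ℝ) (hx : 0 ≤ x) (hN : 2 ≤ N) :
    ∑ p ∈ oddPrimesUpTo x, ‖∑ n ∈ Finset.Icc 1 N, a n * (jacobiSym (n : ℤ) p : ℂ)‖ ^ 2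
      ≤ (2 * x / Real.log (D + 1) + 34 * ((D:ℝ)^4 * (N:ℝ)^2 * (1 + 2 * Real.log N))) * RS N a := by
  obtain ⟨lam, h1, h2, h3⟩ := selberg D hD
  have hN1 : (1:ℝ) ≤ N := by exact_mod_cast (by omega : 1 ≤ N)
  have hD1 : (1:ℝ) ≤ D := by exact_mod_cast hD
  have hlN : 0 ≤ Real.log N := Real.log_nonneg hN1
  have hR := RS_nonneg N a
  set K := ⌊x⌋₊
  have hKx : (K:ℝ) ≤ x := Nat.floor_le hx
  have hlog : 0 < Real.log (D + 1) := Real.log_pos (by linarith)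
  have hW : ∑ k ∈ Icc 1 K, wS D lam k ≤ 2 * x / Real.log (D + 1) + (D:ℝ)^4 := by
    refine (wS_total D lam h2 K).trans (add_le_add_left ?_ _)
    calc _ ≤ (K:ℝ) * (2 / Real.log (D+1)) := mul_le_mul_of_nonneg_left h3 (by positivity)
      _ ≤ x * (2 / Real.log (D+1)) := by gcongr
      _ = _ := by ring
  set B : ℝ := 16 * (N * (1 + 2 * Real.log N)) with hBdef
  have hB0 : 0 ≤ B := by positivity
  have hB : ∀ m ∈ Icc 1 N, ∀ n ∈ Icc 1 N, ¬ IsSquare (m * n) → ∀ K', |∑ k ∈ Icc 1 K', FJ (m * n) k| ≤ B := by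
    intro m hm n hn hs K'
    rw [mem_Icc] at hm hn
    refine (FJ_sum _ hs K').trans ?_
    have hmn : ((m * n : ℕ) : ℝ) ≤ (N:ℝ)^2 := by
      have : m * n ≤ N^2 := by rw [sq]; exact Nat.mul_le_mul hm.2 hn.2
      exact_mod_cast this
    have hmn0 : (0:ℝ) < ((m * n : ℕ) : ℝ) := by
      exact_mod_cast Nat.mul_pos hm.1 hn.1
    have a1 : √((m * n : ℕ) : ℝ) ≤ N := by
      rw [Real.sqrt_le_left (by positivity)]; exact hmn
    have a2 : Real.log ((m * n : ℕ) : ℝ) ≤ 2 * Real.log N := by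
      refine (Real.log_le_log hmn0 hmn).trans (le_of_eq ?_)
      rw [Real.log_pow]; norm_num
    have a3 : 0 ≤ Real.log ((m * n : ℕ) : ℝ) := Real.log_natCast_nonneg _
    rw [hBdef]
    gcongr
  have hT := S_total N a D K lam h2 _ B hW hB hB0
  set f : ℕ → ℝ := fun k => ‖∑ n ∈ Icc 1 N, a n * (jacobiSym (n : ℤ) k : ℂ)‖ ^ 2 with hf
  have hf0 : ∀ k, 0 ≤ f k := fun k => by positivity
  have hsplit : ∑ p ∈ oddPrimesUpTo x, f p ≤ ∑ p ∈ Icc 1 D, f p +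
      ∑ k ∈ Icc 1 K, wS D lam k * (if Odd k then f k else 0) := by
    have hterm0 : ∀ k, 0 ≤ wS D lam k * (if Odd k then f k else 0) := by
      intro k
      apply mul_nonneg (sq_nonneg _); split_ifs; exact hf0 k; exact le_rfl
    rw [← sum_filter_add_sum_filter_not (oddPrimesUpTo x) (fun p => p ≤ D)]
    apply add_le_add
    · apply sum_le_sum_of_subset_of_nonneg
      · intro p hp
        rw [mem_filter, oddPrimesUpTo, mem_filter] at hp
        rw [mem_Icc]
        exact ⟨hp.1.2.1.one_lt.le, hp.2⟩
      · intro k _ _; exact hf0 k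
    · calc _ ≤ ∑ p ∈ (oddPrimesUpTo x).filter (fun p => ¬ p ≤ D), wS D lam p * (if Odd p then f p else 0) := by
            refine sum_le_sum fun p hp => ?_
            rw [mem_filter, oddPrimesUpTo, mem_filter] at hp
            obtain ⟨⟨_, hp1, hp2⟩, hp3⟩ := hp
            rw [if_pos (hp1.odd_of_ne_two hp2)]
            have : wS D lam p = 1 := by
              unfold wS
              have : (Icc 1 D).filter (fun d => d ∣ p) = {1} := by
                ext d
                rw [mem_filter, mem_Icc, mem_singleton]
                constructor
                · rintro ⟨⟨_, h⟩, hd⟩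
                  rcases (Nat.dvd_prime hp1).1 hd with h' | h'
                  · exact h'
                  · omega
                · rintro rfl; exact ⟨⟨le_rfl, hD⟩, one_dvd _⟩
              rw [this, sum_singleton, h1]; norm_num
            rw [this, one_mul]
        _ ≤ _ := by
            apply sum_le_sum_of_subset_of_nonneg
            · intro p hp
              rw [mem_filter, oddPrimesUpTo, mem_filter, mem_range] at hp
              rw [mem_Icc]
              exact ⟨hp.1.2.1.one_lt.le, by have := hp.1.1; omega⟩
            · intro k _ _; exact hterm0 k
  have hsmall : ∑ p ∈ Icc 1 D, f p ≤ D * (N * RS N a) := by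
    refine (sum_le_card_nsmul _ _ _ fun p _ => S_le N a p).trans ?_
    simp
  refine hsplit.trans ((add_le_add hsmall hT).trans ?_)
  set l := 1 + 2 * Real.log N with hl
  have hl1 : 1 ≤ l := by linarith
  have b1 : (D:ℝ) * N ≤ D^4 * N^2 * l := by
    calc (D:ℝ) * N = D^1 * N^1 * 1 := by ring
      _ ≤ D^4 * N^2 * l := by gcongr <;> norm_num
  have b2 : (D:ℝ)^4 ≤ D^4 * N^2 * l := by
    calc (D:ℝ)^4 = D^4 * 1 * 1 := by ring
      _ ≤ D^4 * N^2 * l := by gcongr; exact one_le_pow₀ hN1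
  have : (D:ℝ) * (N * RS N a) + ((2 * x / Real.log (D + 1) + (D:ℝ)^4) * RS N a + (D:ℝ)^4 * B * (N * RS N a))
      = (D * N + 2 * x / Real.log (D + 1) + (D:ℝ)^4 + 16 * (D^4 * N^2 * l)) * RS N a := by
    rw [hBdef]; ring
  rw [this]
  apply mul_le_mul_of_nonneg_right _ hR
  have b3 : 0 ≤ (D:ℝ)^4 * N^2 * l := by positivity
  linarith

/-- The quadratic large sieve for prime moduli: for fixed `κ > 0`, `x ≥ 2`,
`2 ≤ N ≤ x^(1/2-κ)` and arbitrary complex `a_1, …, a_N`,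
`∑_{p ≤ x} |∑_{n ≤ N} a_n (n/p)|² ≪_κ (x/log x) ∑_{m,n ≤ N, mn=□} |a_m a_n|`. -/
theorem stmt1 (κ : ℝ) (hκ : 0 < κ) :
    ∃ C : ℝ, 0 < C ∧ ∀ (x : ℝ) (N : ℕ) (a : ℕ → ℂ),
      2 ≤ x → 2 ≤ N → (N : ℝ) ≤ x ^ ((1 : ℝ)/2 - κ) →
      ∑ p ∈ oddPrimesUpTo x,
          ‖∑ n ∈ Finset.Icc 1 N, a n * (jacobiSym (n : ℤ) p : ℂ)‖ ^ 2
        ≤ C * (x / Real.log x) *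
          ∑ q ∈ (Finset.Icc 1 N ×ˢ Finset.Icc 1 N).filter (fun q => IsSquare (q.1 * q.2)),
            ‖a q.1 * a q.2‖ := by
  refine ⟨16 / κ + 34 * (12 / κ^2), by positivity, ?_⟩
  intro x N a hx hN hNx
  have hx0 : 0 < x := by linarith
  have hx1 : 1 ≤ x := by linarith
  set D := ⌊x ^ (κ/8)⌋₊ with hDdef
  have hD : 1 ≤ D := Nat.le_floor (by simpa using Real.one_le_rpow hx1 (by positivity))
  have hDle : (D:ℝ) ≤ x ^ (κ/8) := Nat.floor_le (by positivity)
  have hDge : x ^ (κ/8) ≤ D + 1 := (Nat.lt_floor_add_one _).le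
  refine (prime_sum_le N a D hD x hx0.le hN).trans ?_
  change _ ≤ _ * RS N a
  apply mul_le_mul_of_nonneg_right _ (RS_nonneg N a)
  have hlogx : 0 < Real.log x := Real.log_pos (by linarith)
  have hlog2 : (2/3:ℝ) ≤ Real.log x := by
    have := Real.log_two_gt_d9
    have := Real.log_le_log (by norm_num) hx
    linarith
  have hlogD : κ / 8 * Real.log x ≤ Real.log (D + 1) := by
    rw [← Real.log_rpow hx0]
    exact Real.log_le_log (by positivity) hDge
  have t1 : 2 * x / Real.log (D + 1) ≤ 16 / κ * (x / Real.log x) := by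
    calc _ ≤ 2 * x / (κ / 8 * Real.log x) := by gcongr
      _ = _ := by field_simp; norm_num
  have t2 : (D:ℝ)^4 * (N:ℝ)^2 * (1 + 2 * Real.log N) ≤ 12 / κ^2 * (x / Real.log x) := by
    have hN0 : (0:ℝ) < N := by positivity
    have u1 : (D:ℝ)^4 ≤ x ^ (κ/2) := by
      calc (D:ℝ)^4 ≤ (x ^ (κ/8))^4 := by gcongr
        _ = _ := by rw [← Real.rpow_natCast, ← Real.rpow_mul hx0.le]; congr 1; push_cast; ring
    have u2 : (N:ℝ)^2 ≤ x ^ (1 - 2 * κ) := by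
      calc (N:ℝ)^2 ≤ (x ^ ((1:ℝ)/2 - κ))^2 := by gcongr
        _ = _ := by rw [← Real.rpow_natCast, ← Real.rpow_mul hx0.le]; congr 1; push_cast; ring
    have u3 : 2 * Real.log N ≤ Real.log x := by
      have : (N:ℝ)^2 ≤ x := by
        refine u2.trans ?_
        calc x ^ (1 - 2*κ) ≤ x ^ (1:ℝ) := Real.rpow_le_rpow_of_exponent_le hx1 (by linarith)
          _ = x := Real.rpow_one x
      have h := Real.log_le_log (by positivity) this
      rw [Real.log_pow] at h
      exact_mod_cast h
    have u4 : Real.log x ≤ x ^ (κ/2) / (κ/2) := Real.log_le_rpow_div hx0.le (by positivity)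
    rw [← mul_div_assoc, le_div_iff₀ hlogx]
    have hlN : 0 ≤ Real.log N := Real.log_natCast_nonneg _
    calc (D:ℝ)^4 * (N:ℝ)^2 * (1 + 2 * Real.log N) * Real.log x
        ≤ x ^ (κ/2) * x ^ (1 - 2 * κ) * (3 * Real.log x) * Real.log x := by
          gcongr
          linarith
      _ = 3 * (x ^ (κ/2) * x ^ (1 - 2 * κ)) * (Real.log x) ^ 2 := by ring
      _ ≤ 3 * (x ^ (κ/2) * x ^ (1 - 2 * κ)) * (x ^ (κ/2) / (κ/2)) ^ 2 := by gcongr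
      _ = 12 / κ^2 * (x ^ (κ/2) * x ^ (1 - 2 * κ) * x ^ (κ/2) * x ^ (κ/2)) := by field_simp; norm_num
      _ = 12 / κ^2 * x ^ (1 - κ/2) := by
          rw [← Real.rpow_add hx0, ← Real.rpow_add hx0, ← Real.rpow_add hx0]; congr 2; ring
      _ ≤ 12 / κ^2 * x ^ (1:ℝ) := by
          gcongr
          linarith
      _ = _ := by rw [Real.rpow_one]
  linarith

end
end

section
/- Fix ε ∈ (0,1], κ ∈ (0, 1/6) and δ ∈ (0,1). Then for all x ≥ 2 and all integers ℓ with 2 ≤ ℓ ≤ x^{1/6−κ}, one has the uniform bound P_ℓ(x) ≪_{ε,κ,δ} ℓ^{−3+δ}. -/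
open Finset Filter

noncomputable section

open scoped NumberTheorySymbols in
/-- The Jacobi symbol as a Dirichlet character. -/
def jchar (a : ℕ) [NeZero a] : DirichletCharacter ℂ a where
  toFun z := (jacobiSym (z.val : ℤ) a : ℂ)
  map_one' := by
    have h : jacobiSym (((1 : ZMod a).val : ℕ) : ℤ) a = jacobiSym 1 a := by
      apply jacobiSym.mod_left'
      rw [← ZMod.intCast_eq_intCast_iff']
      simp
    rw [h, jacobiSym.one_left]; simp
  map_mul' x y := by
    have h : jacobiSym (((x * y).val : ℕ) : ℤ) a = jacobiSym ((x.val : ℤ) * (y.val : ℤ)) a := by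
      apply jacobiSym.mod_left'
      rw [← ZMod.intCast_eq_intCast_iff']
      simp
    rw [h, jacobiSym.mul_left]; push_cast; rfl
  map_nonunit' x hx := by
    have : jacobiSym (x.val : ℤ) a = 0 := by
      rw [jacobiSym.eq_zero_iff_not_coprime]
      intro h
      apply hx
      rw [← ZMod.natCast_zmod_val x, ZMod.isUnit_iff_coprime]
      rwa [Int.gcd_natCast_natCast] at h
    show ((jacobiSym (x.val : ℤ) a : ℤ) : ℂ) = 0
    rw [this]; simp

lemma jchar_int (a : ℕ) [NeZero a] (t : ℤ) : jchar a (t : ZMod a) = (jacobiSym t a : ℂ) := by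
  show ((jacobiSym (((t : ZMod a).val : ℕ) : ℤ) a : ℤ) : ℂ) = _
  congr 1
  apply jacobiSym.mod_left'
  rw [← ZMod.intCast_eq_intCast_iff']
  simp

lemma jchar_inv (a : ℕ) [NeZero a] : (jchar a)⁻¹ = jchar a := by
  rw [inv_eq_iff_mul_eq_one]
  ext u
  obtain ⟨t, ht⟩ := ZMod.intCast_surjective (u : ZMod a)
  rw [MulChar.mul_apply, MulChar.one_apply_coe, ← ht, jchar_int]
  have hc : t.gcd a = 1 := by
    have := u.isUnit
    rw [← ht] at this
    rw [← Int.isCoprime_iff_gcd_eq_one]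
    by_contra hcon
    rw [← DirichletCharacter.apply_eq_zero_iff (jchar a)] at hcon
    have h2 : IsUnit (jchar a (t : ZMod a)) := this.map _
    rw [hcon] at h2; simp at h2
  have := jacobiSym.sq_one hc
  rw [sq] at this
  exact_mod_cast this

lemma jchar_primitive (a : ℕ) [NeZero a] (ho : Odd a) (hs : Squarefree a) :
    (jchar a).IsPrimitive := by
  rw [DirichletCharacter.isPrimitive_def]
  by_contra hne
  set f := (jchar a).conductor with hf
  have hfa : f ∣ a := DirichletCharacter.conductor_dvd_level _
  obtain ⟨g, hg⟩ := hfa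
  have hg1 : g ≠ 1 := by rintro rfl; simp at hg; exact hne hg.symm
  obtain ⟨p, hp, hpg⟩ := Nat.exists_prime_and_dvd hg1
  have hpa : p ∣ a := hg ▸ hpg.mul_left f
  obtain ⟨m, hm⟩ := hpa
  have hm0 : m ≠ 0 := by rintro rfl; exact (NeZero.ne a) (by simpa using hm)
  have : NeZero m := ⟨hm0⟩
  have := Fact.mk hp
  have : NeZero p := ⟨hp.ne_zero⟩
  have hcop : Nat.Coprime p m := by
    rw [Nat.squarefree_iff_prime_squarefree] at hs
    rw [hp.coprime_iff_not_dvd]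
    rintro ⟨k, hk⟩
    exact hs p hp ⟨k, by rw [hm, hk]; ring⟩
  have hfm : f ∣ m := by
    obtain ⟨k, hk⟩ := hpg
    refine ⟨k, ?_⟩
    have : p * m = p * (f * k) := by rw [← hm, hg, hk]; ring
    exact Nat.eq_of_mul_eq_mul_left hp.pos this
  have hp2 : p ≠ 2 := by
    rintro rfl
    rw [hm] at ho
    exact (Nat.not_odd_iff_even.mpr (even_two_mul m)) ho
  have hF : (jchar a).FactorsThrough m :=
    DirichletCharacter.FactorsThrough.mono (jchar a) (DirichletCharacter.factorsThrough_conductor (jchar a)) hfm ⟨p, by rw [mul_comm]; exact hm⟩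
  obtain ⟨z, hz⟩ := FiniteField.exists_nonsquare (F := ZMod p) (by rwa [ZMod.ringChar_zmod_n])
  obtain ⟨t, ht1, ht2⟩ := Nat.chineseRemainder hcop z.val 1
  have hJp : jacobiSym (t : ℤ) p = -1 := by
    apply ZMod.nonsquare_iff_jacobiSym_eq_neg_one.mpr
    have : ((t : ℤ) : ZMod p) = z := by
      have := (ZMod.natCast_eq_natCast_iff _ _ _).mpr ht1
      simpa using this
    rwa [this]
  have hJm : jacobiSym (t : ℤ) m = 1 := by
    rw [← jacobiSym.one_left m]
    apply jacobiSym.mod_left'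
    have : t % m = 1 % m := ht2
    exact_mod_cast this
  have hJ : jacobiSym (t : ℤ) a = -1 := by
    rw [hm, jacobiSym.mul_right, hJp, hJm]; norm_num
  have hta : IsCoprime (t : ℤ) (a : ℤ) := by
    rw [Int.isCoprime_iff_gcd_eq_one]
    by_contra h
    have h' := jacobiSym.eq_zero_iff_not_coprime.mpr h
    omega
  have h1 := jchar_int a t
  rw [hF.eq_changeLevel, DirichletCharacter.changeLevel_eq_cast_of_dvd' _ _ hta, hJ] at h1
  have h2 : ((t : ℤ) : ZMod m) = 1 := by
    have := (ZMod.natCast_eq_natCast_iff _ _ _).mpr ht2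
    simpa using this
  rw [h2, map_one] at h1
  norm_num at h1

open ZMod in
lemma jchar_expand (a : ℕ) [NeZero a] (ho : Odd a) (hs : Squarefree a) :
    ∃ G : ℂ, ‖G‖ = √a ∧ ∀ k : ZMod a, G * jchar a k = ∑ j, stdAddChar (j * k) * jchar a j := by
  have hd : ∀ k, ZMod.dft (jchar a) k = jchar a (-k) * gaussSum (jchar a) stdAddChar := by
    intro k
    have := (jchar_primitive a ho hs).fourierTransform_eq_inv_mul_gaussSum k
    rwa [jchar_inv] at this
  set G := gaussSum (jchar a) stdAddChar with hG
  refine ⟨G, ?_, ?_⟩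
  · have h1 := congrFun (ZMod.dft_dft (jchar a)) (-1)
    have h2 : ZMod.dft (jchar a) = fun k => G * jchar a (-k) := by
      ext k; rw [hd, mul_comm]
    have h3 : ZMod.dft (fun k => G * jchar a (-k)) = fun k => G * ZMod.dft (jchar a) (-k) := by
      rw [ZMod.dft_const_mul, ZMod.dft_comp_neg]
    rw [h2, h3, h2] at h1
    simp only [neg_neg, map_one, smul_eq_mul, mul_one] at h1
    have hn : ‖jchar a (-1)‖ = 1 := by
      have : IsUnit (-1 : ZMod a) := isUnit_one.neg
      obtain ⟨u, hu⟩ := this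
      rw [← hu]; exact DirichletCharacter.unit_norm_eq_one _ u
    have h4 := congrArg norm h1
    simp only [norm_mul, hn, mul_one, Complex.norm_natCast] at h4
    rw [← h4, Real.sqrt_mul_self (norm_nonneg _)]
  · intro k
    have := hd (-k)
    rw [ZMod.dft_apply, neg_neg] at this
    rw [mul_comm, ← this]
    apply Finset.sum_congr rfl
    intro j _
    simp

lemma geom_bd (z : ℂ) (hz : ‖z‖ = 1) (hz1 : z ≠ 1) (T : ℕ) :
    ‖∑ t ∈ Finset.range T, z ^ t‖ ≤ 2 / ‖z - 1‖ := by
  rw [geom_sum_eq hz1, norm_div]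
  gcongr
  calc ‖z ^ T - 1‖ ≤ ‖z ^ T‖ + ‖(1:ℂ)‖ := norm_sub_le _ _
    _ = 2 := by rw [norm_pow, hz]; norm_num

lemma stdAdd_bd (a : ℕ) [NeZero a] (j : ℕ) (h0 : 0 < j) (h1 : j < a) :
    2 / ‖ZMod.stdAddChar ((j : ℕ) : ZMod a) - 1‖ ≤ a / 2 * (1 / j + 1 / ((a - j : ℕ) : ℝ)) := by
  have ha : (0:ℝ) < a := by exact_mod_cast (NeZero.pos a)
  have e1 : ZMod.stdAddChar ((j : ℕ) : ZMod a) = Complex.exp (Complex.I * (2 * Real.pi * j / a : ℝ)) := by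
    have := ZMod.stdAddChar_coe (N := a) (j : ℤ)
    push_cast at this
    rw [this]; congr 1; push_cast; ring
  rw [e1, Complex.norm_exp_I_mul_ofReal_sub_one, Real.norm_eq_abs]
  have hj : (0:ℝ) < j := by exact_mod_cast h0
  have hja : (j:ℝ) < a := by exact_mod_cast h1
  have e2 : (2 * Real.pi * j / a) / 2 = Real.pi * (j / a) := by ring
  rw [e2]
  set θ : ℝ := j / a with hθ
  have hθ0 : 0 < θ := by positivity
  have hθ1 : θ < 1 := by rw [hθ, div_lt_one ha]; exact hja
  have hs : 2 * min θ (1 - θ) ≤ Real.sin (Real.pi * θ) := by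
    rcases le_total θ (1/2) with h | h
    · rw [min_eq_left (by linarith)]
      have := Real.mul_le_sin (x := Real.pi * θ) (by positivity) (by nlinarith [Real.pi_pos])
      calc 2 * θ = 2 / Real.pi * (Real.pi * θ) := by field_simp
        _ ≤ _ := this
    · rw [min_eq_right (by linarith)]
      have := Real.mul_le_sin (x := Real.pi * (1 - θ)) (by have := Real.pi_pos; apply mul_nonneg <;> linarith) (by nlinarith [Real.pi_pos])
      calc 2 * (1 - θ) = 2 / Real.pi * (Real.pi * (1 - θ)) := by field_simp
        _ ≤ _ := this
        _ = _ := by rw [mul_sub, mul_one, Real.sin_pi_sub]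
  have hm : 0 < min θ (1 - θ) := lt_min hθ0 (by linarith)
  rw [abs_of_nonneg (by linarith), Nat.cast_sub h1.le]
  calc 2 / (2 * Real.sin (Real.pi * θ)) ≤ 2 / (2 * (2 * min θ (1 - θ))) := by gcongr
    _ = 1 / 2 * (1 / min θ (1 - θ)) := by field_simp; try norm_num
    _ ≤ 1 / 2 * (1 / θ + 1 / (1 - θ)) := by
      gcongr
      have : 0 < 1 / θ := by positivity
      have : 0 < 1 / (1 - θ) := by apply one_div_pos.mpr; linarith
      rcases min_choice θ (1 - θ) with h | h <;> rw [h] <;> linarith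
    _ = _ := by
      have : (a:ℝ) - j ≠ 0 := by linarith
      rw [hθ]; field_simp

/-- Polya-Vinogradov for the Jacobi symbol. -/
lemma polya (a : ℕ) (ho : Odd a) (hs : Squarefree a) (ha1 : 1 < a) (s : ℤ) (T : ℕ) :
    |((∑ t ∈ Finset.range T, jacobiSym ((t : ℤ) + s) a : ℤ) : ℝ)| ≤ √a * (1 + Real.log a) := by
  have : NeZero a := ⟨by omega⟩
  have ha : (0:ℝ) < a := by exact_mod_cast (NeZero.pos a)
  obtain ⟨G, hG, hE⟩ := jchar_expand a ho hs
  have hsum : G * ((∑ t ∈ Finset.range T, jacobiSym ((t : ℤ) + s) a : ℤ) : ℂ)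
      = ∑ j : ZMod a, jchar a j * ZMod.stdAddChar (j * (s : ZMod a)) *
        ∑ t ∈ Finset.range T, (ZMod.stdAddChar j) ^ t := by
    push_cast
    simp_rw [← jchar_int, Finset.mul_sum]
    rw [Finset.sum_comm]
    apply Finset.sum_congr rfl
    intro t _
    rw [hE]
    apply Finset.sum_congr rfl
    intro j _
    rw [← AddChar.map_nsmul_eq_pow]
    push_cast
    rw [mul_add, AddChar.map_add_eq_mul, nsmul_eq_mul, mul_comm j (t : ZMod a)]
    ring
  have hinj : Set.InjOn (fun j : ℕ => (j : ZMod a)) (Finset.range a : Finset ℕ) := by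
    intro i hi j hj hij
    simp at hi hj
    have := (ZMod.natCast_eq_natCast_iff' _ _ _).mp hij
    rwa [Nat.mod_eq_of_lt hi, Nat.mod_eq_of_lt hj] at this
  have hre : ∀ F : ZMod a → ℝ, ∑ j : ZMod a, F j = ∑ j ∈ Finset.range a, F j := by
    intro F
    have : (Finset.univ : Finset (ZMod a)) = (Finset.range a).image (fun j : ℕ => (j : ZMod a)) := by
      symm
      rw [Finset.eq_univ_iff_forall]
      intro z
      rw [Finset.mem_image]
      exact ⟨z.val, Finset.mem_range.mpr (ZMod.val_lt z), by simp⟩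
    rw [this, Finset.sum_image hinj]
  have hbd : ‖G * ((∑ t ∈ Finset.range T, jacobiSym ((t : ℤ) + s) a : ℤ) : ℂ)‖ ≤ a * (1 + Real.log a) := by
    rw [hsum]
    refine (norm_sum_le _ _).trans ?_
    rw [hre]
    have hpt : ∀ j ∈ Finset.Ico 1 a, ‖jchar a (j : ZMod a) * ZMod.stdAddChar ((j : ZMod a) * (s : ZMod a)) *
        ∑ t ∈ Finset.range T, (ZMod.stdAddChar (j : ZMod a)) ^ t‖ ≤ a / 2 * (1 / j + 1 / ((a - j : ℕ) : ℝ)) := by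
      intro j hj
      rw [Finset.mem_Ico] at hj
      rw [norm_mul, norm_mul, AddChar.norm_apply, mul_one]
      have h1 : ‖jchar a (j : ZMod a)‖ ≤ 1 := DirichletCharacter.norm_le_one _ _
      have hne : ZMod.stdAddChar (j : ZMod a) ≠ 1 := by
        intro h
        have h2 : ZMod.stdAddChar (j : ZMod a) = ZMod.stdAddChar (0 : ZMod a) := by simpa using h
        have := ZMod.injective_stdAddChar h2
        rw [ZMod.natCast_eq_zero_iff] at this
        exact absurd (Nat.le_of_dvd hj.1 this) (by omega)
      have h3 := (geom_bd _ (AddChar.norm_apply _ _) hne T).trans (stdAdd_bd a j hj.1 hj.2)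
      have h4 := mul_le_mul h1 h3 (norm_nonneg _) zero_le_one
      rwa [one_mul] at h4
    rw [Finset.range_eq_Ico, Finset.sum_eq_sum_Ico_succ_bot (by omega)]
    have hz : jchar a ((0:ℕ) : ZMod a) = 0 := by
      have := DirichletCharacter.map_zero' (jchar a) (by omega); simpa using this
    rw [hz]
    simp only [zero_mul, norm_zero, zero_add]
    refine (Finset.sum_le_sum hpt).trans ?_
    rw [← Finset.mul_sum, Finset.sum_add_distrib]
    have hrefl : ∑ j ∈ Finset.Ico 1 a, (1 / ((a - j : ℕ) : ℝ)) = ∑ j ∈ Finset.Ico 1 a, (1 / (j:ℝ)) := by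
      have := Finset.sum_Ico_reflect (fun j : ℕ => (1 / (j:ℝ))) 1 (m := a) (n := a) (by omega)
      rw [this]; simp [show a + 1 - a = 1 by omega]
    rw [hrefl]
    have hh : ∑ j ∈ Finset.Ico 1 a, (1 / (j:ℝ)) ≤ 1 + Real.log a := by
      have h5 := harmonic_le_one_add_log a
      rw [harmonic_eq_sum_Icc] at h5
      push_cast at h5
      refine le_trans ?_ h5
      simp_rw [one_div]
      apply Finset.sum_le_sum_of_subset_of_nonneg
      · intro j; simp; omega
      · intros; positivity
    nlinarith
  rw [norm_mul, hG] at hbd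
  have : ‖((∑ t ∈ Finset.range T, jacobiSym ((t : ℤ) + s) a : ℤ) : ℂ)‖ = |((∑ t ∈ Finset.range T, jacobiSym ((t : ℤ) + s) a : ℤ) : ℝ)| := by
    rw [Complex.norm_intCast]
  rw [this] at hbd
  have hsq : √(a:ℝ) * √a = a := Real.mul_self_sqrt ha.le
  have hsp : 0 < √(a:ℝ) := Real.sqrt_pos.mpr ha
  refine le_of_mul_le_mul_left ?_ hsp
  rw [← mul_assoc, hsq]; exact hbd
lemma ap8 (a : ℕ) (ho : Odd a) (hs : Squarefree a) (ha1 : 1 < a) (c : ℕ) (hc1 : 1 ≤ c) (hc8 : c < 8)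
    (Y : ℕ) :
    |((∑ k ∈ (Finset.Icc 1 Y).filter (fun k => k % 8 = c), jacobiSym (k : ℤ) a : ℤ) : ℝ)|
      ≤ √a * (1 + Real.log a) := by
  have hset : (Finset.Icc 1 Y).filter (fun k => k % 8 = c)
      = (Finset.range ((Y + 8 - c) / 8)).image (fun t => 8 * t + c) := by
    ext k
    simp only [Finset.mem_filter, Finset.mem_Icc, Finset.mem_image, Finset.mem_range]
    constructor
    · rintro ⟨⟨h1, h2⟩, h3⟩
      exact ⟨k / 8, by omega, by omega⟩
    · rintro ⟨t, h1, rfl⟩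
      omega
  have h8 : IsCoprime (8 : ℤ) (a : ℤ) := by
    have : Nat.Coprime 8 a := by
      have : Nat.Coprime (2 ^ 3) a := Nat.Coprime.pow_left 3 (by simpa using ho)
      simpa using this
    exact_mod_cast Nat.isCoprime_iff_coprime.mpr this
  obtain ⟨u, v, huv⟩ := h8
  have hJ : ∀ t : ℕ, jacobiSym ((8 * t + c : ℕ) : ℤ) a
      = jacobiSym 8 a * jacobiSym ((t : ℤ) + u * c) a := by
    intro t
    rw [← jacobiSym.mul_left]
    apply jacobiSym.mod_left'
    apply Int.ModEq.symm
    apply (Int.modEq_iff_dvd).mpr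
    refine ⟨v * c, ?_⟩
    push_cast
    linear_combination (-(c:ℤ)) * huv
  rw [hset, Finset.sum_image (by intro i _ j _ h; simp at h; omega)]
  simp_rw [hJ]
  rw [← Finset.mul_sum, Int.cast_mul, abs_mul]
  have h1 : |((jacobiSym 8 a : ℤ) : ℝ)| ≤ 1 := by
    rcases jacobiSym.trichotomy 8 a with h | h | h <;> rw [h] <;> norm_num
  calc _ ≤ 1 * (√a * (1 + Real.log a)) := by
        gcongr
        exact polya a ho hs ha1 _ _
    _ = _ := one_mul _

lemma apf (a : ℕ) (ho : Odd a) (hs : Squarefree a) (ha1 : 1 < a) (c : ℕ) (hc : c % 2 = 1) (hc8 : c < 8)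
    (X f : ℕ) (hf : 0 < f) :
    |((∑ k ∈ (Finset.Icc 1 X).filter (fun k => k % 8 = c), if f ∣ k then jacobiSym (k : ℤ) a else 0 : ℤ) : ℝ)|
      ≤ √a * (1 + Real.log a) := by
  have hnn : 0 ≤ √(a:ℝ) * (1 + Real.log a) := by
    have : 0 ≤ Real.log a := Real.log_natCast_nonneg a
    positivity
  rw [← Finset.sum_filter]
  rcases Nat.even_or_odd f with he | hodd
  · have : ((Finset.Icc 1 X).filter (fun k => k % 8 = c)).filter (fun k => f ∣ k) = ∅ := by
      rw [Finset.filter_eq_empty_iff]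
      intro k hk hfk
      rw [Finset.mem_filter] at hk
      have : 2 ∣ k := he.two_dvd.trans hfk
      omega
    rw [this]; simpa using hnn
  have hf2 : (f * f) % 8 = 1 := by
    obtain ⟨r, rfl⟩ := hodd
    have : r % 4 = 0 ∨ r % 4 = 1 ∨ r % 4 = 2 ∨ r % 4 = 3 := by omega
    have h8 : r % 8 < 8 := Nat.mod_lt _ (by norm_num)
    interval_cases h : r % 8 <;> simp [Nat.mul_mod, Nat.add_mod, h]
  have hset : ((Finset.Icc 1 X).filter (fun k => k % 8 = c)).filter (fun k => f ∣ k)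
      = ((Finset.Icc 1 (X / f)).filter (fun k => k % 8 = (f * c) % 8)).image (fun k => f * k) := by
    ext m
    simp only [Finset.mem_filter, Finset.mem_Icc, Finset.mem_image]
    constructor
    · rintro ⟨⟨⟨h1, h2⟩, h3⟩, k, rfl⟩
      refine ⟨k, ⟨⟨?_, ?_⟩, ?_⟩, rfl⟩
      · rcases Nat.eq_zero_or_pos k with rfl | h
        · simp at h1
        · exact h
      · rw [Nat.le_div_iff_mul_le hf]; linarith
      · rw [← h3, Nat.mul_mod_mod, ← mul_assoc, Nat.mul_mod, hf2]; simp
    · rintro ⟨k, ⟨⟨h1, h2⟩, h3⟩, rfl⟩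
      rw [Nat.le_div_iff_mul_le hf] at h2
      refine ⟨⟨⟨Nat.mul_pos hf h1, by linarith⟩, ?_⟩, Dvd.intro k rfl⟩
      rw [Nat.mul_mod, h3, Nat.mul_mod_mod, Nat.mod_mul_mod, ← mul_assoc, Nat.mul_mod, hf2]
      simp; omega
  rw [hset, Finset.sum_image (by intro i _ j _ h; exact Nat.eq_of_mul_eq_mul_left hf h)]
  have hJ : ∀ k : ℕ, jacobiSym ((f * k : ℕ) : ℤ) a = jacobiSym f a * jacobiSym k a := by
    intro k; rw [← jacobiSym.mul_left]; push_cast; rfl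
  simp_rw [hJ]
  rw [← Finset.mul_sum, Int.cast_mul, abs_mul]
  have h1 : |((jacobiSym f a : ℤ) : ℝ)| ≤ 1 := by
    rcases jacobiSym.trichotomy f a with h | h | h <;> rw [h] <;> norm_num
  have hodc : (f * c) % 8 % 2 = 1 := by
    have : Odd (f * c) := hodd.mul (Nat.odd_iff.mpr hc)
    rw [Nat.odd_iff] at this; omega
  calc _ ≤ 1 * (√a * (1 + Real.log a)) := by
        gcongr
        exact ap8 a ho hs ha1 _ (by omega) (by omega) _
    _ = _ := one_mul _

lemma moeb_sum (n : ℕ) :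
    ∑ d ∈ n.divisors, ArithmeticFunction.moebius d = if n = 1 then 1 else 0 := by
  rw [← ArithmeticFunction.coe_mul_zeta_apply, ArithmeticFunction.moebius_mul_coe_zeta,
    ArithmeticFunction.one_apply]

lemma jac_sq_moebius (m b : ℕ) (hb : 0 < b) :
    (jacobiSym m b) ^ 2 = ∑ e ∈ b.divisors, if e ∣ m then ArithmeticFunction.moebius e else 0 := by
  have hbne : NeZero b := ⟨hb.ne'⟩
  have h1 : ∑ e ∈ b.divisors, (if e ∣ m then ArithmeticFunction.moebius e else 0)
      = ∑ e ∈ (Nat.gcd m b).divisors, ArithmeticFunction.moebius e := by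
    rw [← Finset.sum_filter]
    congr 1
    ext e
    simp only [Finset.mem_filter, Nat.mem_divisors, Nat.dvd_gcd_iff]
    constructor
    · rintro ⟨⟨h1, h2⟩, h3⟩
      exact ⟨⟨h3, h1⟩, Nat.gcd_ne_zero_right hb.ne'⟩
    · rintro ⟨⟨h1, h2⟩, h3⟩
      exact ⟨⟨h2, hb.ne'⟩, h1⟩
  rw [h1, moeb_sum]
  by_cases h : Nat.gcd m b = 1
  · rw [jacobiSym.sq_one (by rwa [Int.gcd_natCast_natCast])]; simp [h]
  · rw [jacobiSym.eq_zero_iff_not_coprime.mpr (by rwa [Int.gcd_natCast_natCast])]; simp [h]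

lemma apq (q : ℕ) (ho : Odd q) (hns : ¬ IsSquare q) (c : ℕ) (hc : c % 2 = 1) (hc8 : c < 8)
    (X f : ℕ) (hf : 0 < f) :
    |((∑ k ∈ (Finset.Icc 1 X).filter (fun k => k % 8 = c), if f ∣ k then jacobiSym (k : ℤ) q else 0 : ℤ) : ℝ)|
      ≤ √q * (1 + Real.log q) := by
  obtain ⟨a, b, hab, hsq⟩ := Nat.sq_mul_squarefree q
  have hq0 : 0 < q := ho.pos
  have hb : 0 < b := by
    rcases Nat.eq_zero_or_pos b with rfl | h
    · simp at hab; omega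
    · exact h
  have ha0 : 0 < a := by
    rcases Nat.eq_zero_or_pos a with rfl | h
    · simp at hab; omega
    · exact h
  have ha1 : 1 < a := by
    rcases Nat.lt_or_ge 1 a with h | h
    · exact h
    · exfalso; apply hns
      have : a = 1 := by omega
      subst this
      exact ⟨b, by rw [← hab]; ring⟩
  have hao : Odd a := by
    rw [← hab] at ho
    exact (Nat.odd_mul.mp ho).2
  have : NeZero a := ⟨ha0.ne'⟩
  have : NeZero b := ⟨hb.ne'⟩
  have hJ : ∀ k : ℕ, (if f ∣ k then jacobiSym (k : ℤ) q else 0)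
      = ∑ e ∈ b.divisors, ArithmeticFunction.moebius e * (if Nat.lcm f e ∣ k then jacobiSym (k : ℤ) a else 0) := by
    intro k
    split_ifs with hfk
    · rw [← hab, jacobiSym.mul_right, jacobiSym.pow_right, jac_sq_moebius _ _ hb, Finset.sum_mul]
      apply Finset.sum_congr rfl
      intro e _
      by_cases he : e ∣ k
      · rw [if_pos he, if_pos (Nat.lcm_dvd hfk he)]
      · rw [if_neg he, if_neg (fun h => he ((Nat.dvd_lcm_right _ _).trans h))]; simp
    · symm
      apply Finset.sum_eq_zero
      intro e _
      rw [if_neg (fun h => hfk ((Nat.dvd_lcm_left _ _).trans h))]; simp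
  simp_rw [hJ]
  rw [Finset.sum_comm]
  simp_rw [← Finset.mul_sum]
  push_cast
  refine (Finset.abs_sum_le_sum_abs _ _).trans ?_
  have hpt : ∀ e ∈ b.divisors, |((ArithmeticFunction.moebius e : ℤ) : ℝ) * (∑ k ∈ (Finset.Icc 1 X).filter (fun k => k % 8 = c), (((if Nat.lcm f e ∣ k then jacobiSym (k : ℤ) a else 0) : ℤ) : ℝ))| ≤ √a * (1 + Real.log a) := by
    intro e he
    rw [abs_mul]
    have h1 : |((ArithmeticFunction.moebius e : ℤ) : ℝ)| ≤ 1 := by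
      have := ArithmeticFunction.abs_moebius_le_one (n := e)
      exact_mod_cast this
    have h2 := apf a hao hsq ha1 c hc hc8 X (Nat.lcm f e) (Nat.lcm_pos hf (Nat.pos_of_mem_divisors he))
    push_cast at h2
    calc _ ≤ 1 * (√a * (1 + Real.log a)) := by gcongr; exact_mod_cast h2
      _ = _ := one_mul _
  have h3 := Finset.sum_le_card_nsmul _ _ _ hpt
  push_cast at h3
  refine h3.trans ?_
  rw [nsmul_eq_mul]
  have hcard : (b.divisors.card : ℝ) ≤ b := by exact_mod_cast Nat.card_divisors_le_self b
  have hqs : √(q:ℝ) = b * √a := by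
    rw [← hab]; push_cast
    rw [Real.sqrt_mul (by positivity), Real.sqrt_sq (by positivity)]
  have hlog : Real.log a ≤ Real.log q := by
    apply Real.log_le_log (by exact_mod_cast ha0)
    have : a ≤ q := by rw [← hab]; exact Nat.le_mul_of_pos_left a (by positivity)
    exact_mod_cast this
  have hla : 0 ≤ Real.log a := Real.log_natCast_nonneg a
  rw [hqs, mul_assoc]
  gcongr
/-- odd part -/
def oddp (n : ℕ) : ℕ := n / 2 ^ (n.factorization 2)

lemma oddp_mul (n : ℕ) : 2 ^ (n.factorization 2) * oddp n = n := Nat.ordProj_mul_ordCompl_eq_self n 2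

lemma oddp_odd (n : ℕ) (hn : 0 < n) : Odd (oddp n) := by
  have := Nat.not_dvd_ordCompl Nat.prime_two hn.ne'
  rw [← Nat.not_even_iff_odd, even_iff_two_dvd]; exact this

lemma recip (n : ℕ) (hn : 0 < n) (c : ℕ) (hc : c % 2 = 1) (hc8 : c < 8) :
    ∃ s : ℤ, |s| ≤ 1 ∧ ∀ m : ℕ, m % 8 = c → jacobiSym n m = s * jacobiSym m (oddp n) := by
  have hq := oddp_odd n hn
  refine ⟨(ZMod.χ₈ c) ^ (n.factorization 2) * (if oddp n % 4 = 3 ∧ c % 4 = 3 then -1 else 1), ?_, ?_⟩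
  · rw [abs_mul, abs_pow]
    have h1 : |ZMod.χ₈ (c : ZMod 8)| ≤ 1 := by interval_cases c <;> decide
    have h2 : |(if oddp n % 4 = 3 ∧ c % 4 = 3 then (-1:ℤ) else 1)| ≤ 1 := by split_ifs <;> simp
    calc _ ≤ 1 * 1 := mul_le_mul (pow_le_one₀ (abs_nonneg _) h1) h2 (abs_nonneg _) (by norm_num)
      _ = 1 := by norm_num
  · intro m hm
    have hmo : Odd m := by rw [Nat.odd_iff]; omega
    have e : jacobiSym n m = jacobiSym 2 m ^ (n.factorization 2) * jacobiSym (oddp n : ℕ) m := by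
      rw [← jacobiSym.pow_left, ← jacobiSym.mul_left]
      congr 1
      exact_mod_cast (oddp_mul n).symm
    have e2 : ((m : ℕ) : ZMod 8) = (c : ZMod 8) := by
      rw [ZMod.natCast_eq_natCast_iff']; omega
    rw [e, jacobiSym.at_two hmo, e2, mul_assoc]
    congr 1
    rw [← jacobiSym.quadratic_reciprocity_if (Nat.odd_iff.mp hq) (Nat.odd_iff.mp hmo)]
    have : m % 4 = c % 4 := by omega
    rw [this]
    have hm1 : ∀ z : ℤ, (if oddp n % 4 = 3 ∧ c % 4 = 3 then (-1:ℤ) else 1) * z = if oddp n % 4 = 3 ∧ c % 4 = 3 then -z else z := by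
      intro z; split_ifs <;> simp
    rw [hm1]

lemma apn (n : ℕ) (hn : 0 < n) (hns : ¬ IsSquare (oddp n)) (c : ℕ) (hc : c % 2 = 1) (hc8 : c < 8)
    (X f : ℕ) (hf : 0 < f) :
    |∑ k ∈ (Finset.Icc 1 X).filter (fun k => k % 8 = c), if f ∣ k then ((jacobiSym n k : ℤ) : ℝ) else 0|
      ≤ √n * (1 + Real.log n) := by
  obtain ⟨s, hs1, hs⟩ := recip n hn c hc hc8
  have h := apq (oddp n) (oddp_odd n hn) hns c hc hc8 X f hf
  have e : ∑ k ∈ (Finset.Icc 1 X).filter (fun k => k % 8 = c), (if f ∣ k then ((jacobiSym n k : ℤ) : ℝ) else 0)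
    = (s : ℝ) * ((∑ k ∈ (Finset.Icc 1 X).filter (fun k => k % 8 = c), if f ∣ k then jacobiSym (k : ℤ) (oddp n) else 0 : ℤ) : ℝ) := by
    push_cast
    rw [Finset.mul_sum]
    apply Finset.sum_congr rfl
    intro k hk
    rw [Finset.mem_filter] at hk
    split_ifs
    · rw [hs k hk.2]; push_cast; rfl
    · simp
  rw [e, abs_mul]
  have hs2 : |(s:ℝ)| ≤ 1 := by exact_mod_cast hs1
  have hle : oddp n ≤ n := Nat.div_le_self _ _
  have hle' : (oddp n : ℝ) ≤ n := by exact_mod_cast hle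
  have hp : (0:ℝ) < oddp n := by exact_mod_cast (oddp_odd n hn).pos
  have hl : 0 ≤ Real.log (oddp n) := Real.log_natCast_nonneg _
  calc _ ≤ 1 * (√(oddp n) * (1 + Real.log (oddp n))) := by gcongr
    _ ≤ √n * (1 + Real.log n) := by
      rw [one_mul]
      gcongr

/-! Selberg sieve -/

lemma sum_inv_sq_le (R : ℕ) : ∑ b ∈ Finset.Icc 1 R, (1:ℝ) / (b:ℝ) ^ 2 ≤ 2 := by
  have : ∀ R : ℕ, ∑ b ∈ Finset.Icc 1 (R + 1), (1:ℝ) / (b:ℝ) ^ 2 ≤ 2 - 1 / ((R:ℝ) + 1) := by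
    intro R
    induction R with
    | zero => norm_num
    | succ k ih =>
      rw [Finset.sum_Icc_succ_top (by omega)]
      have : (1:ℝ) / ((k + 1 + 1 : ℕ) : ℝ) ^ 2 ≤ 1 / ((k:ℝ) + 1) - 1 / (((k + 1 : ℕ) : ℝ) + 1) := by
        push_cast
        rw [div_sub_div _ _ (by positivity) (by positivity), div_le_div_iff₀ (by positivity) (by positivity)]
        ring_nf
        nlinarith [(Nat.cast_nonneg k : (0:ℝ) ≤ k)]
      linarith
  rcases R with _ | R
  · simp
  · have h := this R
    have : 0 < 1 / ((R:ℝ) + 1) := by positivity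
    linarith

/-- sum of 1/k over squarefree k -/
def VV (R : ℕ) : ℝ := ∑ k ∈ Finset.Icc 1 R, ((ArithmeticFunction.moebius k : ℤ) : ℝ) ^ 2 / k

lemma VV_lower (R : ℕ) : Real.log R ≤ 2 * VV R := by
  have h1 : Real.log R ≤ ∑ n ∈ Finset.Icc 1 R, (1:ℝ) / n := by
    have h := log_add_one_le_harmonic R
    rw [harmonic_eq_sum_Icc] at h
    push_cast at h
    simp_rw [one_div]
    refine le_trans ?_ h
    rcases Nat.eq_zero_or_pos R with rfl | hR
    · simp
    · apply Real.log_le_log (by exact_mod_cast hR); linarith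
  refine h1.trans ?_
  choose a b hab hsq using Nat.sq_mul_squarefree
  set F : ℕ × ℕ → ℝ := fun p => ((ArithmeticFunction.moebius p.1 : ℤ) : ℝ) ^ 2 / p.1 * (1 / (p.2:ℝ) ^ 2) with hF
  have h2 : ∑ n ∈ Finset.Icc 1 R, (1:ℝ) / n = ∑ p ∈ (Finset.Icc 1 R).image (fun n => (a n, b n)), F p := by
    rw [Finset.sum_image]
    · apply Finset.sum_congr rfl
      intro n hn
      simp only [hF]
      have := ArithmeticFunction.moebius_sq_eq_one_of_squarefree (hsq n)
      have h3 : ((ArithmeticFunction.moebius (a n) : ℤ) : ℝ) ^ 2 = 1 := by exact_mod_cast this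
      rw [h3]
      have h4 : (n:ℝ) = (b n : ℝ) ^ 2 * a n := by exact_mod_cast (hab n).symm
      rw [h4, div_mul_div_comm]; congr 1 <;> ring
    · intro i _ j _ hij
      simp only [Prod.mk.injEq] at hij
      rw [← hab i, ← hab j, hij.1, hij.2]
  rw [h2]
  have h3 : (Finset.Icc 1 R).image (fun n => (a n, b n)) ⊆ Finset.Icc 1 R ×ˢ Finset.Icc 1 R := by
    intro p hp
    rw [Finset.mem_image] at hp
    obtain ⟨n, hn, rfl⟩ := hp
    rw [Finset.mem_Icc] at hn
    have hne := hab n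
    have ha : 0 < a n := Nat.pos_of_ne_zero (by intro h; rw [h] at hne; omega)
    have hb : 0 < b n := Nat.pos_of_ne_zero (by intro h; rw [h] at hne; simp at hne; omega)
    have h5 : a n ≤ n := by
      calc a n ≤ (b n) ^ 2 * a n := Nat.le_mul_of_pos_left _ (by positivity)
        _ = n := hne
    have h6 : b n ≤ n := by
      calc b n ≤ b n ^ 2 := Nat.le_self_pow (by norm_num) _
        _ ≤ (b n) ^ 2 * a n := Nat.le_mul_of_pos_right _ ha
        _ = n := hne
    simp only [Finset.mem_product, Finset.mem_Icc]
    omega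
  refine (Finset.sum_le_sum_of_subset_of_nonneg h3 (by intros; simp only [hF]; positivity)).trans ?_
  rw [Finset.sum_product]
  simp only [hF]
  simp_rw [← Finset.mul_sum]
  rw [← Finset.sum_mul, mul_comm]
  have := sum_inv_sq_le R
  have hV : 0 ≤ VV R := by unfold VV; positivity
  exact mul_le_mul_of_nonneg_right this hV

lemma VV_pos (R : ℕ) (hR : 1 ≤ R) : 0 < VV R := by
  unfold VV
  apply Finset.sum_pos' (by intros; positivity)
  exact ⟨1, by simp [hR], by simp⟩

def ff (R k : ℕ) : ℝ := ((ArithmeticFunction.moebius k : ℤ) : ℝ) / (k * VV R)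

/-- Selberg weights -/
def lam (R d : ℕ) : ℝ := d * ∑ k ∈ Finset.Icc 1 R,
  if d ∣ k then ((ArithmeticFunction.moebius (k / d) : ℤ) : ℝ) * ff R k else 0

lemma lam_one (R : ℕ) (hR : 1 ≤ R) : lam R 1 = 1 := by
  unfold lam ff
  have hV := VV_pos R hR
  simp only [Nat.cast_one, one_mul, one_dvd, if_true, Nat.div_one]
  have : ∀ k ∈ Finset.Icc 1 R, ((ArithmeticFunction.moebius k : ℤ) : ℝ) * (((ArithmeticFunction.moebius k : ℤ) : ℝ) / (k * VV R))
     = ((ArithmeticFunction.moebius k : ℤ) : ℝ) ^ 2 / k * (VV R)⁻¹ := by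
    intro k hk
    have : (k:ℝ) ≠ 0 := by rw [Finset.mem_Icc] at hk; exact_mod_cast (by omega : k ≠ 0)
    field_simp
  rw [Finset.sum_congr rfl this, ← Finset.sum_mul]
  exact mul_inv_cancel₀ hV.ne'

lemma lam_le (R d : ℕ) (hR : 1 ≤ R) : |lam R d| ≤ d := by
  have hV := VV_pos R hR
  unfold lam
  rw [abs_mul, Nat.abs_cast]
  have : |∑ k ∈ Finset.Icc 1 R, if d ∣ k then ((ArithmeticFunction.moebius (k / d) : ℤ) : ℝ) * ff R k else 0| ≤ 1 := by
    refine (Finset.abs_sum_le_sum_abs _ _).trans ?_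
    have hpt : ∀ k ∈ Finset.Icc 1 R, |if d ∣ k then ((ArithmeticFunction.moebius (k / d) : ℤ) : ℝ) * ff R k else 0|
       ≤ ((ArithmeticFunction.moebius k : ℤ) : ℝ) ^ 2 / k * (VV R)⁻¹ := by
      intro k hk
      have hk0 : (0:ℝ) < k := by rw [Finset.mem_Icc] at hk; exact_mod_cast (by omega : 0 < k)
      split_ifs
      · rw [abs_mul]
        have h1 : |((ArithmeticFunction.moebius (k / d) : ℤ) : ℝ)| ≤ 1 := by
          have := ArithmeticFunction.abs_moebius_le_one (n := k / d)
          exact_mod_cast this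
        have h2 : |ff R k| ≤ ((ArithmeticFunction.moebius k : ℤ) : ℝ) ^ 2 / k * (VV R)⁻¹ := by
          unfold ff
          rw [abs_div, abs_of_pos (by positivity : 0 < (k:ℝ) * VV R), div_mul_eq_mul_div, div_eq_mul_inv, div_eq_mul_inv, mul_inv]
          have : |((ArithmeticFunction.moebius k : ℤ) : ℝ)| = ((ArithmeticFunction.moebius k : ℤ) : ℝ) ^ 2 := by
            rcases ArithmeticFunction.moebius_eq_or k with h | h | h <;> rw [h] <;> norm_num
          rw [this]
          apply le_of_eq; ring
        calc _ ≤ 1 * |ff R k| := by gcongr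
          _ ≤ _ := by rw [one_mul]; exact h2
      · rw [abs_zero]; positivity
    refine (Finset.sum_le_sum hpt).trans ?_
    rw [← Finset.sum_mul]
    exact le_of_eq (mul_inv_cancel₀ hV.ne')
  calc _ ≤ (d:ℝ) * 1 := by gcongr
    _ = d := mul_one _

lemma lam_inv (R j : ℕ) (hj : j ∈ Finset.Icc 1 R) :
    ∑ d ∈ Finset.Icc 1 R, (if j ∣ d then lam R d / d else 0) = ff R j := by
  have e1 : ∀ d ∈ Finset.Icc 1 R, (if j ∣ d then lam R d / d else 0)
      = ∑ k ∈ Finset.Icc 1 R, ff R k * (if j ∣ d ∧ d ∣ k then ((ArithmeticFunction.moebius (k / d) : ℤ) : ℝ) else 0) := by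
    intro d hd
    have hd0 : (d:ℝ) ≠ 0 := by rw [Finset.mem_Icc] at hd; exact_mod_cast (by omega : d ≠ 0)
    by_cases h : j ∣ d
    · simp only [h, if_true, true_and]
      unfold lam
      rw [mul_div_cancel_left₀ _ hd0]
      apply Finset.sum_congr rfl
      intro k _
      split_ifs <;> ring
    · simp [h]
  rw [Finset.sum_congr rfl e1, Finset.sum_comm]
  simp_rw [← Finset.mul_sum]
  have e2 : ∀ k ∈ Finset.Icc 1 R, ∑ d ∈ Finset.Icc 1 R, (if j ∣ d ∧ d ∣ k then ((ArithmeticFunction.moebius (k / d) : ℤ) : ℝ) else 0) = if k = j then 1 else 0 := by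
    intro k hk
    rw [Finset.mem_Icc] at hk hj
    rw [← Finset.sum_filter]
    by_cases hjk : j ∣ k
    · obtain ⟨g, rfl⟩ := hjk
      have hg : 0 < g := Nat.pos_of_ne_zero (by rintro rfl; omega)
      have e3 : (Finset.Icc 1 R).filter (fun d => j ∣ d ∧ d ∣ j * g) = g.divisors.image (fun e => j * e) := by
        ext d
        simp only [Finset.mem_filter, Finset.mem_Icc, Finset.mem_image, Nat.mem_divisors]
        constructor
        · rintro ⟨_, ⟨e, rfl⟩, h⟩
          exact ⟨e, ⟨Nat.dvd_of_mul_dvd_mul_left (by omega) h, hg.ne'⟩, rfl⟩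
        · rintro ⟨e, ⟨he, _⟩, rfl⟩
          have h7 := Nat.mul_dvd_mul_left j he
          exact ⟨⟨Nat.mul_pos (by omega) (Nat.pos_of_dvd_of_pos he hg), (Nat.le_of_dvd (by omega) h7).trans hk.2⟩, Dvd.intro e rfl, h7⟩
      rw [e3, Finset.sum_image (by intro i _ i' _ h; exact Nat.eq_of_mul_eq_mul_left (by omega) h)]
      have e4 : ∀ e ∈ g.divisors, ((ArithmeticFunction.moebius (j * g / (j * e)) : ℤ) : ℝ) = ((ArithmeticFunction.moebius (g / e) : ℤ) : ℝ) := by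
        intro e _
        rw [Nat.mul_div_mul_left _ _ (by omega)]
      rw [Finset.sum_congr rfl e4, Nat.sum_div_divisors g (fun e => ((ArithmeticFunction.moebius e : ℤ) : ℝ))]
      have := moeb_sum g
      have h8 : ∑ d ∈ g.divisors, ((ArithmeticFunction.moebius d : ℤ) : ℝ) = if g = 1 then 1 else 0 := by
        exact_mod_cast this
      rw [h8]
      by_cases hg1 : g = 1
      · simp [hg1]
      · rw [if_neg hg1, if_neg]
        intro h
        apply hg1
        exact Nat.eq_of_mul_eq_mul_left (by omega : 0 < j) (by omega)
    · rw [if_neg (by rintro rfl; exact hjk dvd_rfl)]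
      apply Finset.sum_eq_zero
      intro d hd
      rw [Finset.mem_filter] at hd
      exact absurd (hd.2.1.trans hd.2.2) hjk
  rw [Finset.sum_congr rfl (fun k hk => by rw [e2 k hk])]
  simp only [mul_ite, mul_one, mul_zero, Finset.sum_ite_eq', hj, if_true]

lemma quad_form (R : ℕ) (hR : 1 ≤ R) :
    ∑ d ∈ Finset.Icc 1 R, ∑ e ∈ Finset.Icc 1 R, lam R d * lam R e / (Nat.lcm d e : ℕ) ≤ 1 / VV R := by
  have hV := VV_pos R hR
  have e1 : ∀ d ∈ Finset.Icc 1 R, ∀ e ∈ Finset.Icc 1 R, lam R d * lam R e / (Nat.lcm d e : ℕ)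
     = ∑ k ∈ Finset.Icc 1 R, (Nat.totient k : ℝ) * ((if k ∣ d then lam R d / d else 0) * (if k ∣ e then lam R e / e else 0)) := by
    intro d hd e he
    rw [Finset.mem_Icc] at hd he
    have hd0 : (0:ℝ) < d := by exact_mod_cast (by omega : 0 < d)
    have he0 : (0:ℝ) < e := by exact_mod_cast (by omega : 0 < e)
    have hl0 : (0:ℝ) < (Nat.lcm d e : ℕ) := by exact_mod_cast Nat.lcm_pos (by omega) (by omega)
    have h1 : ((Nat.gcd d e : ℕ) : ℝ) * (Nat.lcm d e : ℕ) = d * e := by exact_mod_cast Nat.gcd_mul_lcm d e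
    have h2 : ((Nat.gcd d e : ℕ) : ℝ) = ∑ k ∈ Finset.Icc 1 R, if k ∣ d ∧ k ∣ e then (Nat.totient k : ℝ) else 0 := by
      rw [← Finset.sum_filter]
      have : (Finset.Icc 1 R).filter (fun k => k ∣ d ∧ k ∣ e) = (Nat.gcd d e).divisors := by
        ext k
        simp only [Finset.mem_filter, Finset.mem_Icc, Nat.mem_divisors, Nat.dvd_gcd_iff]
        constructor
        · rintro ⟨_, h⟩
          exact ⟨h, Nat.gcd_ne_zero_left (by omega)⟩
        · rintro ⟨h, _⟩
          exact ⟨⟨Nat.pos_of_dvd_of_pos h.1 (by omega), (Nat.le_of_dvd (by omega) h.1).trans hd.2⟩, h⟩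
      rw [this]
      exact_mod_cast (Nat.sum_totient (Nat.gcd d e)).symm
    have h3 : lam R d * lam R e / (Nat.lcm d e : ℕ) = (Nat.gcd d e : ℕ) * (lam R d / d * (lam R e / e)) := by
      field_simp
      linear_combination (-(lam R d * lam R e)) * h1
    rw [h3, h2, Finset.sum_mul]
    apply Finset.sum_congr rfl
    intro k _
    by_cases hk1 : k ∣ d <;> by_cases hk2 : k ∣ e <;> simp [hk1, hk2]
  rw [Finset.sum_congr rfl (fun d hd => Finset.sum_congr rfl (fun e he => e1 d hd e he))]
  have e2 : ∑ d ∈ Finset.Icc 1 R, ∑ e ∈ Finset.Icc 1 R, ∑ k ∈ Finset.Icc 1 R, (Nat.totient k : ℝ) * ((if k ∣ d then lam R d / d else 0) * (if k ∣ e then lam R e / e else 0))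
    = ∑ k ∈ Finset.Icc 1 R, (Nat.totient k : ℝ) * (ff R k) ^ 2 := by
    rw [Finset.sum_congr rfl (fun d _ => Finset.sum_comm), Finset.sum_comm]
    apply Finset.sum_congr rfl
    intro k hk
    rw [← lam_inv R k hk, sq, Finset.sum_mul_sum, Finset.mul_sum]
    apply Finset.sum_congr rfl
    intro d _
    rw [Finset.mul_sum]
  rw [e2]
  have hpt : ∀ k ∈ Finset.Icc 1 R, (Nat.totient k : ℝ) * (ff R k) ^ 2 ≤ ((ArithmeticFunction.moebius k : ℤ) : ℝ) ^ 2 / k * (1 / (VV R) ^ 2) := by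
    intro k hk
    have hk0 : (0:ℝ) < k := by rw [Finset.mem_Icc] at hk; exact_mod_cast (by omega : 0 < k)
    have : (Nat.totient k : ℝ) ≤ k := by exact_mod_cast Nat.totient_le k
    calc _ ≤ (k:ℝ) * (ff R k) ^ 2 := by gcongr
      _ = _ := by unfold ff; field_simp
  refine (Finset.sum_le_sum hpt).trans ?_
  rw [← Finset.sum_mul]
  apply le_of_eq
  show VV R * _ = _
  field_simp

/-- Selberg weight -/
def ww (R m : ℕ) : ℝ := (∑ d ∈ Finset.Icc 1 R, if d ∣ m then lam R d else 0) ^ 2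

lemma ww_eq (R m : ℕ) : ww R m = ∑ d ∈ Finset.Icc 1 R, ∑ e ∈ Finset.Icc 1 R,
    lam R d * lam R e * (if Nat.lcm d e ∣ m then 1 else 0) := by
  unfold ww
  rw [sq, Finset.sum_mul_sum]
  apply Finset.sum_congr rfl; intro d _
  apply Finset.sum_congr rfl; intro e _
  by_cases h1 : d ∣ m <;> by_cases h2 : e ∣ m <;> simp [h1, h2, Nat.lcm_dvd_iff]

lemma lam_sum_le (R : ℕ) (hR : 1 ≤ R) (E : ℝ) (_hE : 0 ≤ E) (G : ℕ → ℕ → ℝ)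
    (hG : ∀ d ∈ Finset.Icc 1 R, ∀ e ∈ Finset.Icc 1 R, |G d e| ≤ E) :
    |∑ d ∈ Finset.Icc 1 R, ∑ e ∈ Finset.Icc 1 R, lam R d * lam R e * G d e| ≤ R ^ 4 * E := by
  have hpt : ∀ d ∈ Finset.Icc 1 R, ∀ e ∈ Finset.Icc 1 R, |lam R d * lam R e * G d e| ≤ R ^ 2 * E := by
    intro d hd e he
    have h1 : |lam R d| ≤ R := (lam_le R d hR).trans (by exact_mod_cast (Finset.mem_Icc.mp hd).2)
    have h2 : |lam R e| ≤ R := (lam_le R e hR).trans (by exact_mod_cast (Finset.mem_Icc.mp he).2)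
    rw [abs_mul, abs_mul, sq]
    have := hG d hd e he
    gcongr
  calc _ ≤ ∑ d ∈ Finset.Icc 1 R, ∑ e ∈ Finset.Icc 1 R, |lam R d * lam R e * G d e| :=
        (Finset.abs_sum_le_sum_abs _ _).trans (Finset.sum_le_sum fun d _ => Finset.abs_sum_le_sum_abs _ _)
    _ ≤ ∑ d ∈ Finset.Icc 1 R, ∑ e ∈ Finset.Icc 1 R, (R:ℝ) ^ 2 * E :=
        Finset.sum_le_sum fun d hd => Finset.sum_le_sum fun e he => hpt d hd e he
    _ = _ := by simp; ring

lemma ww_sum (R : ℕ) (hR : 1 ≤ R) (X : ℕ) :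
    ∑ m ∈ Finset.Icc 1 X, ww R m ≤ X / VV R + R ^ 4 := by
  simp_rw [ww_eq]
  rw [Finset.sum_comm]
  rw [Finset.sum_congr rfl (fun d _ => Finset.sum_comm)]
  simp_rw [← Finset.mul_sum]
  have hcount : ∀ f : ℕ, ∑ m ∈ Finset.Icc 1 X, (if f ∣ m then (1:ℝ) else 0) = ((X / f : ℕ) : ℝ) := by
    intro f
    rw [Finset.sum_boole]
    congr 1
    have := Nat.Ioc_filter_dvd_card_eq_div X f
    rw [← this]; rfl
  simp_rw [hcount]
  have hG := lam_sum_le R hR 1 (by norm_num) (fun d e => ((X / Nat.lcm d e : ℕ) : ℝ) - (X:ℝ) / (Nat.lcm d e : ℕ)) (by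
    intro d hd e he
    rw [Finset.mem_Icc] at hd he
    have hl : 0 < Nat.lcm d e := Nat.lcm_pos (by omega) (by omega)
    have hl0 : (0:ℝ) < (Nat.lcm d e : ℕ) := by exact_mod_cast hl
    have h1 : ((X / Nat.lcm d e : ℕ) : ℝ) ≤ (X:ℝ) / (Nat.lcm d e : ℕ) := Nat.cast_div_le
    have h2 : (X:ℝ) / (Nat.lcm d e : ℕ) ≤ ((X / Nat.lcm d e : ℕ) : ℝ) + 1 := by
      rw [div_le_iff₀ hl0]
      have := (Nat.lt_mul_div_succ X hl).le
      have h3 : (X:ℝ) ≤ (Nat.lcm d e : ℕ) * ((X / Nat.lcm d e : ℕ) + 1) := by exact_mod_cast this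
      linarith
    rw [abs_le]; constructor <;> linarith)
  have hsplit : ∑ d ∈ Finset.Icc 1 R, ∑ e ∈ Finset.Icc 1 R, lam R d * lam R e * ((X / Nat.lcm d e : ℕ) : ℝ)
    = (X:ℝ) * (∑ d ∈ Finset.Icc 1 R, ∑ e ∈ Finset.Icc 1 R, lam R d * lam R e / (Nat.lcm d e : ℕ))
     + ∑ d ∈ Finset.Icc 1 R, ∑ e ∈ Finset.Icc 1 R, lam R d * lam R e * (((X / Nat.lcm d e : ℕ) : ℝ) - (X:ℝ) / (Nat.lcm d e : ℕ)) := by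
    rw [Finset.mul_sum, ← Finset.sum_add_distrib]
    apply Finset.sum_congr rfl; intro d _
    rw [Finset.mul_sum, ← Finset.sum_add_distrib]
    apply Finset.sum_congr rfl; intro e _
    ring
  rw [hsplit]
  have h1 := (abs_le.mp hG).2
  have h2 := mul_le_mul_of_nonneg_left (quad_form R hR) (Nat.cast_nonneg X : (0:ℝ) ≤ X)
  rw [mul_one_div] at h2
  linarith

lemma ww_prime (R p : ℕ) (hR : 1 ≤ R) (hp : p.Prime) (hpR : R < p) : ww R p = 1 := by
  unfold ww
  rw [Finset.sum_eq_single 1]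
  · simp [lam_one R hR]
  · intro d hd hd1
    rw [Finset.mem_Icc] at hd
    rw [if_neg]
    intro h
    rcases (Nat.dvd_prime hp).mp h with h | h <;> omega
  · intro h; simp at h; omega

lemma ww_nonneg (R m : ℕ) : 0 ≤ ww R m := sq_nonneg _

lemma ww_char (R : ℕ) (hR : 1 ≤ R) (n : ℕ) (hn : 0 < n) (hns : ¬ IsSquare (oddp n)) (c : ℕ) (hc : c % 2 = 1) (hc8 : c < 8)
    (X : ℕ) :
    |∑ k ∈ (Finset.Icc 1 X).filter (fun k => k % 8 = c), ww R k * ((jacobiSym n k : ℤ) : ℝ)|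
      ≤ R ^ 4 * (√n * (1 + Real.log n)) := by
  have e : ∑ k ∈ (Finset.Icc 1 X).filter (fun k => k % 8 = c), ww R k * ((jacobiSym n k : ℤ) : ℝ)
     = ∑ d ∈ Finset.Icc 1 R, ∑ e ∈ Finset.Icc 1 R, lam R d * lam R e *
      ∑ k ∈ (Finset.Icc 1 X).filter (fun k => k % 8 = c), if Nat.lcm d e ∣ k then ((jacobiSym n k : ℤ) : ℝ) else 0 := by
    simp_rw [ww_eq, Finset.sum_mul]
    rw [Finset.sum_comm]
    rw [Finset.sum_congr rfl (fun d _ => Finset.sum_comm)]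
    apply Finset.sum_congr rfl; intro d _
    apply Finset.sum_congr rfl; intro e _
    rw [Finset.mul_sum]
    apply Finset.sum_congr rfl; intro k _
    split_ifs <;> ring
  rw [e]
  have hl : 0 ≤ Real.log n := Real.log_natCast_nonneg _
  apply lam_sum_le R hR _ (by positivity)
  intro d hd e he
  rw [Finset.mem_Icc] at hd he
  exact apn n hn hns c hc hc8 X _ (Nat.lcm_pos (by omega) (by omega))
lemma divisor_bound (η : ℝ) (hη : 0 < η) :
    ∃ C : ℝ, 1 ≤ C ∧ ∀ n : ℕ, 0 < n → (n.divisors.card : ℝ) ≤ C * (n:ℝ) ^ η := by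
  set A : ℝ := 1 + 1 / (η * Real.log 2) with hA
  have hl2 : 0 < Real.log 2 := Real.log_pos (by norm_num)
  have hA1 : 1 ≤ A := by rw [hA]; have : 0 < 1 / (η * Real.log 2) := by positivity
                         linarith
  obtain ⟨N, hN⟩ := exists_nat_ge ((2:ℝ) ^ (1 / η))
  refine ⟨A ^ N, one_le_pow₀ hA1, ?_⟩
  intro n hn
  rw [Nat.card_divisors hn.ne']
  have hfac : (n:ℝ) ^ η = ∏ p ∈ n.primeFactors, ((p:ℝ) ^ (n.factorization p)) ^ η := by
    rw [Real.finsetProd_rpow _ _ (by intros; positivity)]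
    congr 1
    conv_lhs => rw [← Nat.prod_factorization_pow_eq_self hn.ne']
    rw [Finsupp.prod]
    push_cast
    rfl
  push_cast
  have hpt : ∀ p ∈ n.primeFactors, ((n.factorization p : ℝ) + 1) ≤ (if p < N then A else 1) * ((p:ℝ) ^ (n.factorization p)) ^ η := by
    intro p hp
    have hpp := Nat.prime_of_mem_primeFactors hp
    set k := n.factorization p
    have h2p : (2:ℝ) ≤ p := by exact_mod_cast hpp.two_le
    split_ifs with h
    · have h1 : 1 + k * (η * Real.log 2) ≤ ((p:ℝ) ^ k) ^ η := by
        calc 1 + k * (η * Real.log 2) ≤ Real.exp (k * (η * Real.log 2)) := by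
              rw [add_comm]; exact Real.add_one_le_exp _
          _ = ((2:ℝ) ^ k) ^ η := by
              rw [← Real.rpow_natCast, ← Real.rpow_mul (by norm_num), Real.rpow_def_of_pos (by norm_num)]
              congr 1; ring
          _ ≤ _ := by gcongr
      calc (k:ℝ) + 1 ≤ A * (1 + k * (η * Real.log 2)) := by
            have h3 : A * (η * Real.log 2) = η * Real.log 2 + 1 := by rw [hA]; field_simp
            have h4 : (0:ℝ) ≤ k := Nat.cast_nonneg k
            have h5 : 0 < η * Real.log 2 := by positivity
            have : A * (1 + k * (η * Real.log 2)) = A + k * (η * Real.log 2 + 1) := by rw [← h3]; ring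
            rw [this]
            nlinarith
        _ ≤ _ := by gcongr
    · rw [one_mul]
      have h6 : (2:ℝ) ≤ (p:ℝ) ^ η := by
        calc (2:ℝ) = ((2:ℝ) ^ (1 / η)) ^ η := by
              rw [← Real.rpow_mul (by norm_num), one_div_mul_cancel hη.ne', Real.rpow_one]
          _ ≤ (p:ℝ) ^ η := by
              gcongr
              refine hN.trans ?_
              exact_mod_cast (not_lt.mp h)
      calc (k:ℝ) + 1 ≤ (2:ℝ) ^ k := by
            have : k + 1 ≤ 2 ^ k := Nat.lt_two_pow_self
            exact_mod_cast this
        _ ≤ ((p:ℝ) ^ η) ^ k := by gcongr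
        _ = _ := by
            rw [← Real.rpow_natCast, ← Real.rpow_natCast, ← Real.rpow_mul (by positivity), ← Real.rpow_mul (by positivity), mul_comm]
  refine (Finset.prod_le_prod (by intros; positivity) hpt).trans ?_
  rw [Finset.prod_mul_distrib, ← hfac]
  gcongr
  rw [Finset.prod_ite]
  simp only [Finset.prod_const, one_pow, mul_one]
  apply pow_le_pow_right₀ hA1
  calc _ ≤ (Finset.range N).card := by
        apply Finset.card_le_card
        intro p hp
        rw [Finset.mem_filter] at hp
        exact Finset.mem_range.mpr hp.2
    _ = N := Finset.card_range N

lemma sqfree_mul_sq {a b : ℕ} (ha : Squarefree a) (hb : Squarefree b) (h : IsSquare (a * b)) : a = b := by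
  have key : ∀ {a b : ℕ}, Squarefree a → IsSquare (a * b) → ∀ p, p.Prime → p ∣ a → p ∣ b := by
    intro a b ha h p hp hpa
    obtain ⟨r, hr⟩ := h
    have h1 : p ∣ r := by
      have : p ∣ r * r := hr ▸ hpa.mul_right b
      rcases (Nat.Prime.dvd_mul hp).mp this with h | h <;> exact h
    have h2 : p * p ∣ a * b := hr ▸ mul_dvd_mul h1 h1
    obtain ⟨g, rfl⟩ := hpa
    have h3 : p ∣ g * b := by
      rw [mul_assoc] at h2
      exact Nat.dvd_of_mul_dvd_mul_left hp.pos h2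
    rcases (Nat.Prime.dvd_mul hp).mp h3 with h | h
    · exfalso
      obtain ⟨k, rfl⟩ := h
      rw [Nat.squarefree_iff_prime_squarefree] at ha
      exact ha p hp ⟨k, by ring⟩
    · exact h
  rw [Nat.Squarefree.ext_iff ha hb]
  intro p hp
  exact ⟨key ha h p hp, key hb (by rwa [mul_comm]) p hp⟩

lemma oddp_mul' (a b : ℕ) : oddp (a * b) = oddp a * oddp b := Nat.ordCompl_mul a b 2

lemma pair_count (L : ℕ) (hL : 1 ≤ L) :
    ((((Finset.Icc 1 L ×ˢ Finset.Icc 1 L).filter (fun q => IsSquare (oddp (q.1 * q.2)))).card : ℕ) : ℝ)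
      ≤ 4 * L * (1 + Real.log L) := by
  classical
  choose s z hzs hsq using Nat.sq_mul_squarefree
  set key : ℕ → ℕ := fun u => oddp (s u) with hkey
  have spos : ∀ u, 1 ≤ u → 0 < s u := by
    intro u hu
    apply Nat.pos_of_ne_zero; intro h
    have := hzs u; rw [h] at this; omega
  have zpos : ∀ u, 1 ≤ u → 0 < z u := by
    intro u hu
    apply Nat.pos_of_ne_zero; intro h
    have := hzs u; rw [h] at this; simp at this; omega
  have hodvd : ∀ n, oddp n ∣ n := fun n => ⟨2 ^ (n.factorization 2), by rw [mul_comm]; exact (oddp_mul n).symm⟩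
  have hkeyeq : ∀ u v, 1 ≤ u → 1 ≤ v → IsSquare (oddp (u * v)) → key u = key v := by
    intro u v hu hv h
    apply sqfree_mul_sq ((hsq u).squarefree_of_dvd (hodvd _)) ((hsq v).squarefree_of_dvd (hodvd _))
    obtain ⟨r, hr⟩ := h
    have e : oddp (u * v) = (oddp (z u) * oddp (z v)) ^ 2 * (key u * key v) := by
      conv_lhs => rw [← hzs u, ← hzs v]
      rw [sq, sq]
      simp only [oddp_mul', hkey]
      ring
    have hpos : 0 < oddp (z u) * oddp (z v) :=
      Nat.mul_pos (oddp_odd _ (zpos u hu)).pos (oddp_odd _ (zpos v hv)).pos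
    have hd : (oddp (z u) * oddp (z v)) ^ 2 ∣ r ^ 2 := ⟨_, by rw [sq r, ← hr, e]⟩
    rw [Nat.pow_dvd_pow_iff (by norm_num)] at hd
    obtain ⟨g, rfl⟩ := hd
    refine ⟨g, ?_⟩
    apply Nat.eq_of_mul_eq_mul_left (pow_pos hpos 2)
    rw [← e, hr]; ring
  have keyle : ∀ u ∈ Finset.Icc 1 L, key u ∈ Finset.Icc 1 L := by
    intro u hu
    rw [Finset.mem_Icc] at hu ⊢
    have h1 : key u ≤ s u := Nat.div_le_self _ _
    have h2 : s u ≤ u := Nat.le_of_dvd hu.1 ⟨z u ^ 2, by rw [mul_comm]; exact (hzs u).symm⟩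
    exact ⟨(oddp_odd _ (spos u hu.1)).pos, by omega⟩
  set Fib : ℕ → Finset ℕ := fun a => (Finset.Icc 1 L).filter (fun u => key u = a) with hFib
  have fibcard : ∀ a ∈ Finset.Icc 1 L, (Fib a).card ≤ 2 * Nat.sqrt (L / a) := by
    intro a ha
    rw [Finset.mem_Icc] at ha
    have hsub : Fib a ⊆ (({a, 2 * a} : Finset ℕ) ×ˢ Finset.Icc 1 (Nat.sqrt (L / a))).image (fun p => p.2 ^ 2 * p.1) := by
      intro u hu
      simp only [hFib, Finset.mem_filter, Finset.mem_Icc] at hu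
      obtain ⟨⟨hu1, hu2⟩, hk⟩ := hu
      rw [Finset.mem_image]
      refine ⟨(s u, z u), ?_, hzs u⟩
      have h1 : (s u).factorization 2 ≤ 1 := (hsq u).natFactorization_le_one 2
      have h2 := oddp_mul (s u)
      have h2' : oddp (s u) = a := hk
      rw [h2'] at h2
      simp only [Finset.mem_product, Finset.mem_insert, Finset.mem_singleton, Finset.mem_Icc]
      refine ⟨?_, zpos u hu1, ?_⟩
      · interval_cases h : (s u).factorization 2 <;> omega
      · rw [Nat.le_sqrt', Nat.le_div_iff_mul_le (by omega)]
        calc z u ^ 2 * a ≤ z u ^ 2 * s u := by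
              gcongr
              rw [← h2]; exact Nat.le_mul_of_pos_left _ (by positivity)
          _ = u := hzs u
          _ ≤ L := hu2
    refine (Finset.card_le_card hsub).trans (Finset.card_image_le.trans ?_)
    rw [Finset.card_product, Nat.card_Icc]
    have : ({a, 2 * a} : Finset ℕ).card ≤ 2 := Finset.card_le_two
    simp only [Nat.add_sub_cancel]
    exact Nat.mul_le_mul_right _ this
  have hsub : (Finset.Icc 1 L ×ˢ Finset.Icc 1 L).filter (fun q => IsSquare (oddp (q.1 * q.2)))
     ⊆ (Finset.Icc 1 L).biUnion (fun a => Fib a ×ˢ Fib a) := by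
    rintro ⟨u, v⟩ h
    simp only [Finset.mem_filter, Finset.mem_product] at h
    obtain ⟨⟨hu, hv⟩, hs⟩ := h
    rw [Finset.mem_biUnion]
    refine ⟨key u, keyle u hu, ?_⟩
    have := hkeyeq u v (Finset.mem_Icc.mp hu).1 (Finset.mem_Icc.mp hv).1 hs
    simp only [hFib, Finset.mem_product, Finset.mem_filter]
    exact ⟨⟨hu, trivial⟩, hv, this.symm⟩
  have h1 : ((Finset.Icc 1 L ×ˢ Finset.Icc 1 L).filter (fun q => IsSquare (oddp (q.1 * q.2)))).card
      ≤ ∑ a ∈ Finset.Icc 1 L, 4 * (L / a) := by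
    refine (Finset.card_le_card hsub).trans (Finset.card_biUnion_le.trans ?_)
    apply Finset.sum_le_sum
    intro a ha
    rw [Finset.card_product]
    have h2 := fibcard a ha
    calc _ ≤ (2 * Nat.sqrt (L / a)) * (2 * Nat.sqrt (L / a)) := Nat.mul_le_mul h2 h2
      _ = 4 * (Nat.sqrt (L / a) * Nat.sqrt (L / a)) := by ring
      _ ≤ _ := by gcongr; exact Nat.sqrt_le _
  have h2 : ((∑ a ∈ Finset.Icc 1 L, 4 * (L / a) : ℕ) : ℝ) ≤ ∑ a ∈ Finset.Icc 1 L, 4 * L * ((a:ℝ))⁻¹ := by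
    push_cast
    apply Finset.sum_le_sum
    intro a _
    have : ((L / a : ℕ) : ℝ) ≤ (L:ℝ) / a := Nat.cast_div_le
    rw [mul_assoc, ← div_eq_mul_inv]
    gcongr
  have h3 := harmonic_le_one_add_log L
  rw [harmonic_eq_sum_Icc] at h3
  push_cast at h3
  calc _ ≤ ((∑ a ∈ Finset.Icc 1 L, 4 * (L / a) : ℕ) : ℝ) := by exact_mod_cast h1
    _ ≤ _ := h2
    _ = 4 * L * ∑ a ∈ Finset.Icc 1 L, ((a:ℝ))⁻¹ := by rw [Finset.mul_sum]
    _ ≤ _ := by gcongr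

/-- triples -/
def Tr (ℓ : ℕ) : Finset (ℕ × ℕ × ℕ) := Finset.Icc 1 ℓ ×ˢ Finset.Icc 1 ℓ ×ˢ Finset.Icc 1 ℓ

def pr (t : ℕ × ℕ × ℕ) : ℕ := t.1 * t.2.1 * t.2.2

lemma pr_mem {ℓ : ℕ} {t : ℕ × ℕ × ℕ} (ht : t ∈ Tr ℓ) : pr t ∈ Finset.Icc 1 (ℓ ^ 3) := by
  simp only [Tr, Finset.mem_product, Finset.mem_Icc] at ht
  obtain ⟨⟨h1, h2⟩, ⟨h3, h4⟩, h5, h6⟩ := ht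
  rw [Finset.mem_Icc]
  constructor
  · exact Nat.mul_pos (Nat.mul_pos h1 h3) h5
  · calc pr t ≤ ℓ * ℓ * ℓ := Nat.mul_le_mul (Nat.mul_le_mul h2 h4) h6
      _ = ℓ ^ 3 := by ring

lemma fib_pr (ℓ u : ℕ) (hu : 0 < u) : ((Tr ℓ).filter (fun t => pr t = u)).card ≤ u.divisors.card ^ 3 := by
  have : (Tr ℓ).filter (fun t => pr t = u) ⊆ u.divisors ×ˢ u.divisors ×ˢ u.divisors := by
    rintro ⟨a, b, c⟩ h
    rw [Finset.mem_filter] at h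
    have h2 : a * b * c = u := h.2
    simp only [Finset.mem_product, Nat.mem_divisors]
    subst h2
    exact ⟨⟨⟨b * c, by ring⟩, hu.ne'⟩, ⟨⟨a * c, by ring⟩, hu.ne'⟩, ⟨a * b, by ring⟩, hu.ne'⟩
  refine (Finset.card_le_card this).trans ?_
  rw [Finset.card_product, Finset.card_product]
  apply le_of_eq; ring

/-- number of 6-tuples whose product has square odd part -/
def MM (ℓ : ℕ) : ℕ := ((Tr ℓ ×ˢ Tr ℓ).filter (fun q => IsSquare (oddp (pr q.1 * pr q.2)))).card

lemma MM_bound (δ : ℝ) (hδ : 0 < δ) : ∃ C : ℝ, 0 < C ∧ ∀ ℓ : ℕ, 1 ≤ ℓ → (MM ℓ : ℝ) ≤ C * (ℓ:ℝ) ^ (3 + δ) := by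
  classical
  obtain ⟨D, hD1, hD⟩ := divisor_bound (δ / 36) (by positivity)
  refine ⟨D ^ 6 * (4 * (1 + 6 / δ)), by positivity, ?_⟩
  intro ℓ hℓ
  have hℓ0 : (0:ℝ) < ℓ := by exact_mod_cast hℓ
  have hℓ1 : (1:ℝ) ≤ ℓ := by exact_mod_cast hℓ
  set B : ℝ := D ^ 3 * (ℓ:ℝ) ^ (δ / 4) with hB
  have hB0 : 0 ≤ B := by positivity
  have hfib : ∀ u ∈ Finset.Icc 1 (ℓ ^ 3), (((Tr ℓ).filter (fun t => pr t = u)).card : ℝ) ≤ B := by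
    intro u hu
    rw [Finset.mem_Icc] at hu
    calc (((Tr ℓ).filter (fun t => pr t = u)).card : ℝ) ≤ (u.divisors.card : ℝ) ^ 3 := by
          exact_mod_cast fib_pr ℓ u hu.1
      _ ≤ (D * (u:ℝ) ^ (δ / 36)) ^ 3 := by
          gcongr; exact hD u hu.1
      _ ≤ (D * ((ℓ:ℝ) ^ 3) ^ (δ / 36)) ^ 3 := by
          gcongr; exact_mod_cast hu.2
      _ = B := by
          rw [hB, mul_pow]
          congr 1
          rw [← Real.rpow_natCast, ← Real.rpow_natCast, ← Real.rpow_mul (by positivity), ← Real.rpow_mul (by positivity)]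
          congr 1; push_cast; ring
  set Q := (Finset.Icc 1 (ℓ ^ 3) ×ˢ Finset.Icc 1 (ℓ ^ 3)).filter (fun q => IsSquare (oddp (q.1 * q.2))) with hQ
  have hsub : (Tr ℓ ×ˢ Tr ℓ).filter (fun q => IsSquare (oddp (pr q.1 * pr q.2)))
    ⊆ Q.biUnion (fun q => (Tr ℓ).filter (fun t => pr t = q.1) ×ˢ (Tr ℓ).filter (fun t => pr t = q.2)) := by
    rintro ⟨t, t'⟩ h
    simp only [Finset.mem_filter, Finset.mem_product] at h
    rw [Finset.mem_biUnion]
    refine ⟨(pr t, pr t'), ?_, ?_⟩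
    · simp only [hQ, Finset.mem_filter, Finset.mem_product]
      exact ⟨⟨pr_mem h.1.1, pr_mem h.1.2⟩, h.2⟩
    · simp only [Finset.mem_filter, Finset.mem_product]
      exact ⟨⟨h.1.1, trivial⟩, h.1.2, trivial⟩
  have h1 : (MM ℓ : ℝ) ≤ ∑ q ∈ Q, (((Tr ℓ).filter (fun t => pr t = q.1)).card : ℝ) * (((Tr ℓ).filter (fun t => pr t = q.2)).card : ℝ) := by
    have := (Finset.card_le_card hsub).trans Finset.card_biUnion_le
    simp_rw [Finset.card_product] at this
    unfold MM
    exact_mod_cast this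
  have h2 : ∑ q ∈ Q, (((Tr ℓ).filter (fun t => pr t = q.1)).card : ℝ) * (((Tr ℓ).filter (fun t => pr t = q.2)).card : ℝ) ≤ ∑ q ∈ Q, B * B := by
    apply Finset.sum_le_sum
    intro q hq
    simp only [hQ, Finset.mem_filter, Finset.mem_product] at hq
    exact mul_le_mul (hfib _ hq.1.1) (hfib _ hq.1.2) (by positivity) hB0
  have h3 := pair_count (ℓ ^ 3) (Nat.one_le_pow _ _ hℓ)
  rw [← hQ] at h3
  push_cast at h3
  have hlog : Real.log ((ℓ:ℝ) ^ 3) ≤ 6 / δ * (ℓ:ℝ) ^ (δ / 2) := by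
    rw [Real.log_pow]
    have := Real.log_le_rpow_div hℓ0.le (show 0 < δ / 2 by positivity)
    push_cast
    calc 3 * Real.log ℓ ≤ 3 * ((ℓ:ℝ) ^ (δ / 2) / (δ / 2)) := by gcongr
      _ = _ := by field_simp; norm_num
  have hone : (1:ℝ) ≤ (ℓ:ℝ) ^ (δ / 2) := Real.one_le_rpow hℓ1 (by positivity)
  calc (MM ℓ : ℝ) ≤ ∑ q ∈ Q, B * B := h1.trans h2
    _ = (Q.card : ℝ) * (B * B) := by simp
    _ ≤ (4 * (ℓ:ℝ) ^ 3 * (1 + Real.log ((ℓ:ℝ) ^ 3))) * (B * B) := by gcongr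
    _ ≤ (4 * (ℓ:ℝ) ^ 3 * ((1 + 6 / δ) * (ℓ:ℝ) ^ (δ / 2))) * (B * B) := by
        gcongr; rw [add_mul]; linarith
    _ = D ^ 6 * (4 * (1 + 6 / δ)) * ((ℓ:ℝ) ^ 3 * (ℓ:ℝ) ^ (δ / 2) * ((ℓ:ℝ) ^ (δ / 4) * (ℓ:ℝ) ^ (δ / 4))) := by
        rw [hB]; ring
    _ = _ := by
        congr 1
        rw [← Real.rpow_natCast, ← Real.rpow_add hℓ0, ← Real.rpow_add hℓ0, ← Real.rpow_add hℓ0]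
        congr 1; push_cast; ring

lemma S_cube (ℓ m : ℕ) : (S ℓ m) ^ 3 = ∑ t ∈ Tr ℓ, jacobiSym (pr t : ℕ) m := by
  unfold S Tr pr
  rw [Finset.sum_product, pow_succ, sq, Finset.sum_mul_sum, Finset.sum_mul]
  apply Finset.sum_congr rfl; intro a _
  rw [Finset.sum_product, Finset.sum_mul]
  apply Finset.sum_congr rfl; intro b _
  rw [Finset.mul_sum]
  apply Finset.sum_congr rfl; intro c _
  push_cast
  rw [jacobiSym.mul_left, jacobiSym.mul_left]

lemma S_six (ℓ m : ℕ) : (S ℓ m) ^ 6 = ∑ q ∈ Tr ℓ ×ˢ Tr ℓ, jacobiSym (pr q.1 * pr q.2 : ℕ) m := by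
  rw [show 6 = 3 * 2 by norm_num, pow_mul, S_cube, sq, Finset.sum_mul_sum, Finset.sum_product]
  apply Finset.sum_congr rfl; intro a _
  apply Finset.sum_congr rfl; intro b _
  push_cast
  rw [jacobiSym.mul_left]

lemma card_Tr (ℓ : ℕ) : (Tr ℓ).card = ℓ ^ 3 := by
  unfold Tr
  rw [Finset.card_product, Finset.card_product]; simp; ring

lemma moment (ℓ R X c : ℕ) (hℓ : 1 ≤ ℓ) (hR : 1 ≤ R) (hc : c % 2 = 1) (hc8 : c < 8) :
    ∑ k ∈ (Finset.Icc 1 X).filter (fun k => k % 8 = c), ww R k * ((S ℓ k : ℤ) : ℝ) ^ 6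
      ≤ MM ℓ * (X / VV R + R ^ 4) + ℓ ^ 6 * (R ^ 4 * (ℓ ^ 3 * (1 + 6 * Real.log ℓ))) := by
  classical
  have hℓ1 : (1:ℝ) ≤ ℓ := by exact_mod_cast hℓ
  have hll : 0 ≤ Real.log ℓ := Real.log_natCast_nonneg _
  have e : ∑ k ∈ (Finset.Icc 1 X).filter (fun k => k % 8 = c), ww R k * ((S ℓ k : ℤ) : ℝ) ^ 6
    = ∑ q ∈ Tr ℓ ×ˢ Tr ℓ, ∑ k ∈ (Finset.Icc 1 X).filter (fun k => k % 8 = c), ww R k * ((jacobiSym (pr q.1 * pr q.2 : ℕ) k : ℤ) : ℝ) := by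
    rw [Finset.sum_comm]
    apply Finset.sum_congr rfl; intro k _
    have := S_six ℓ k
    have h2 : ((S ℓ k : ℤ) : ℝ) ^ 6 = ∑ q ∈ Tr ℓ ×ˢ Tr ℓ, ((jacobiSym (pr q.1 * pr q.2 : ℕ) k : ℤ) : ℝ) := by
      exact_mod_cast this
    rw [h2, Finset.mul_sum]
  rw [e]
  set E : ℝ := R ^ 4 * (ℓ ^ 3 * (1 + 6 * Real.log ℓ)) with hE
  have hE0 : 0 ≤ E := by positivity
  set W : ℝ := X / VV R + R ^ 4 with hW
  have hpt : ∀ q ∈ Tr ℓ ×ˢ Tr ℓ, ∑ k ∈ (Finset.Icc 1 X).filter (fun k => k % 8 = c), ww R k * ((jacobiSym (pr q.1 * pr q.2 : ℕ) k : ℤ) : ℝ)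
      ≤ (if IsSquare (oddp (pr q.1 * pr q.2)) then W else 0) + E := by
    intro q hq
    rw [Finset.mem_product] at hq
    have h1 := Finset.mem_Icc.mp (pr_mem hq.1)
    have h2 := Finset.mem_Icc.mp (pr_mem hq.2)
    have hpos : 0 < pr q.1 * pr q.2 := Nat.mul_pos h1.1 h2.1
    split_ifs with hs
    · have h3 : ∑ k ∈ (Finset.Icc 1 X).filter (fun k => k % 8 = c), ww R k * ((jacobiSym (pr q.1 * pr q.2 : ℕ) k : ℤ) : ℝ) ≤ W := by
        calc _ ≤ ∑ k ∈ (Finset.Icc 1 X).filter (fun k => k % 8 = c), ww R k := by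
              apply Finset.sum_le_sum
              intro k _
              have : ((jacobiSym (pr q.1 * pr q.2 : ℕ) k : ℤ) : ℝ) ≤ 1 := by
                rcases jacobiSym.trichotomy (pr q.1 * pr q.2 : ℕ) k with h | h | h <;> rw [h] <;> norm_num
              calc _ ≤ ww R k * 1 := mul_le_mul_of_nonneg_left this (ww_nonneg _ _)
                _ = _ := mul_one _
          _ ≤ ∑ k ∈ Finset.Icc 1 X, ww R k :=
              Finset.sum_le_sum_of_subset_of_nonneg (Finset.filter_subset _ _) (fun _ _ _ => ww_nonneg _ _)
          _ ≤ W := ww_sum R hR X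
      linarith
    · rw [zero_add]
      refine (le_abs_self _).trans ((ww_char R hR _ hpos hs c hc hc8 X).trans ?_)
      have h6 : ((pr q.1 * pr q.2 : ℕ) : ℝ) ≤ (ℓ:ℝ) ^ 6 := by
        have : pr q.1 * pr q.2 ≤ ℓ ^ 3 * ℓ ^ 3 := Nat.mul_le_mul h1.2 h2.2
        rw [← pow_add] at this
        exact_mod_cast this
      have h7 : √((pr q.1 * pr q.2 : ℕ) : ℝ) ≤ (ℓ:ℝ) ^ 3 := by
        rw [Real.sqrt_le_left (by positivity), ← pow_mul]; exact h6
      have h8 : Real.log ((pr q.1 * pr q.2 : ℕ) : ℝ) ≤ 6 * Real.log ℓ := by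
        calc _ ≤ Real.log ((ℓ:ℝ) ^ 6) := Real.log_le_log (by exact_mod_cast hpos) h6
          _ = _ := by rw [Real.log_pow]; norm_num
      have h9 : 0 ≤ Real.log ((pr q.1 * pr q.2 : ℕ) : ℝ) := Real.log_natCast_nonneg _
      rw [hE]
      gcongr
  refine (Finset.sum_le_sum hpt).trans ?_
  rw [Finset.sum_add_distrib]
  apply add_le_add
  · rw [← Finset.sum_filter, Finset.sum_const, nsmul_eq_mul]; rfl
  · rw [Finset.sum_const, nsmul_eq_mul, Finset.card_product, card_Tr]
    apply le_of_eq; push_cast; ring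

lemma piOdd_lower (x : ℝ) (hx : 64 ≤ x) : x / 4 ≤ piOdd x * Real.log x := by
  have hL : 0 < Real.log x := Real.log_pos (by linarith)
  have h1 := Chebyshev.pi_ge' (x := x) (by linarith)
  rw [div_le_iff₀ hL] at h1
  have h2 : (Nat.primeCounting ⌊x⌋₊ : ℝ) ≤ piOdd x + 1 := by
    have : Nat.primeCounting ⌊x⌋₊ ≤ piOdd x + 1 := by
      unfold Nat.primeCounting Nat.primeCounting'
      rw [Nat.count_eq_card_filter_range]
      refine le_trans (Finset.card_le_card (t := insert 2 (oddPrimesUpTo x)) ?_) (Finset.card_insert_le _ _)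
      intro p hp
      simp only [Finset.mem_filter, Finset.mem_insert, oddPrimesUpTo] at hp ⊢
      by_cases h : p = 2
      · exact Or.inl h
      · exact Or.inr ⟨hp.1, hp.2, h⟩
    exact_mod_cast this
  have hlog : ∀ y : ℝ, 0 < y → Real.log y ≤ y / 16 + 4 * Real.log 2 - 1 := by
    intro y hy
    have h := Real.log_le_sub_one_of_pos (show 0 < y / 16 by positivity)
    rw [Real.log_div hy.ne' (by norm_num), show (16:ℝ) = 2 ^ 4 by norm_num, Real.log_pow] at h
    push_cast at h
    linarith
  have h3 := hlog x (by linarith)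
  have h4 := hlog (x + 2) (by linarith)
  have h5 := Real.log_two_gt_d9
  have h6 := Real.log_two_lt_d9
  have h7 : (Nat.primeCounting ⌊x⌋₊ : ℝ) * Real.log x ≤ (piOdd x + 1) * Real.log x := by gcongr
  have h8 : (x - 1) * 0.6931 ≤ (x - 1) * Real.log 2 := by
    apply mul_le_mul_of_nonneg_left <;> linarith
  nlinarith

lemma VV_one_le (R : ℕ) (hR : 1 ≤ R) : 1 ≤ VV R := by
  unfold VV
  have := Finset.single_le_sum (f := fun k : ℕ => ((ArithmeticFunction.moebius k : ℤ) : ℝ) ^ 2 / k)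
    (s := Finset.Icc 1 R) (fun i _ => by positivity) (Finset.mem_Icc.2 ⟨le_refl 1, hR⟩)
  simpa using this

lemma count_bound (ε x : ℝ) (hε : 0 < ε) (ℓ R : ℕ) (hℓ : 1 ≤ ℓ) (hR : 1 ≤ R) (B : ℝ)
    (hB : ∀ c : ℕ, c % 2 = 1 → c < 8 →
      ∑ k ∈ (Finset.Icc 1 ⌊x⌋₊).filter (fun k => k % 8 = c), ww R k * ((S ℓ k:ℤ):ℝ)^6 ≤ B) :
    (((oddPrimesUpTo x).filter (fun p => ε * ℓ ≤ (S ℓ p : ℝ))).card : ℝ) ≤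
      R + 4 * B / (ε * ℓ) ^ 6 := by
  set A := (oddPrimesUpTo x).filter (fun p => ε * ℓ ≤ (S ℓ p : ℝ)) with hA
  have hmem : ∀ p ∈ A, p ≤ ⌊x⌋₊ ∧ p.Prime ∧ p ≠ 2 ∧ ε * ℓ ≤ (S ℓ p : ℝ) := by
    intro p hp
    simp only [hA, Finset.mem_filter, oddPrimesUpTo, Finset.mem_range] at hp
    exact ⟨by omega, hp.1.2.1, hp.1.2.2, hp.2⟩
  have hsplit := Finset.card_filter_add_card_filter_not (s := A) (fun p => p ≤ R)
  have h1 : (A.filter (fun p => p ≤ R)).card ≤ R := by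
    refine le_trans (Finset.card_le_card (t := Finset.Icc 1 R) ?_) (by simp)
    intro p hp
    rw [Finset.mem_filter] at hp
    exact Finset.mem_Icc.2 ⟨(hmem p hp.1).2.1.one_le, hp.2⟩
  set T := A.filter (fun p => ¬ p ≤ R) with hT
  have hpos : 0 < (ε * ℓ) ^ 6 := by
    have : (0:ℝ) < ℓ := by exact_mod_cast hℓ
    positivity
  have h2 : (T.card : ℝ) * (ε * ℓ) ^ 6 ≤ 4 * B := by
    have e1 : (T.card : ℝ) * (ε * ℓ) ^ 6 ≤ ∑ p ∈ T, ww R p * ((S ℓ p:ℤ):ℝ)^6 := by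
      rw [← nsmul_eq_mul, ← Finset.sum_const]
      apply Finset.sum_le_sum
      intro p hp
      rw [hT, Finset.mem_filter] at hp
      obtain ⟨_, hp1, _, hp3⟩ := hmem p hp.1
      rw [ww_prime R p hR hp1 (by omega), one_mul]
      gcongr
    have hmaps : ∀ p ∈ T, p % 8 ∈ ({1, 3, 5, 7} : Finset ℕ) := by
      intro p hp
      rw [hT, Finset.mem_filter] at hp
      obtain ⟨_, hp1, hp2, _⟩ := hmem p hp.1
      have := hp1.eq_two_or_odd.resolve_left hp2
      simp only [Finset.mem_insert, Finset.mem_singleton]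
      omega
    rw [← Finset.sum_fiberwise_of_maps_to hmaps] at e1
    have e2 : ∑ c ∈ ({1, 3, 5, 7} : Finset ℕ), ∑ p ∈ T.filter (fun p => p % 8 = c), ww R p * ((S ℓ p:ℤ):ℝ)^6
        ≤ ∑ c ∈ ({1, 3, 5, 7} : Finset ℕ), B := by
      apply Finset.sum_le_sum
      intro c hc
      simp only [Finset.mem_insert, Finset.mem_singleton] at hc
      refine le_trans ?_ (hB c (by omega) (by omega))
      apply Finset.sum_le_sum_of_subset_of_nonneg
      · intro p hp
        rw [Finset.mem_filter, hT, Finset.mem_filter] at hp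
        obtain ⟨hp0, hp1, _, _⟩ := hmem p hp.1.1
        exact Finset.mem_filter.2 ⟨Finset.mem_Icc.2 ⟨hp1.one_le, hp0⟩, hp.2⟩
      · intro i _ _
        have := ww_nonneg R i
        have h6 : 0 ≤ ((S ℓ i:ℤ):ℝ)^6 := by positivity
        exact mul_nonneg this h6
    refine e1.trans (e2.trans ?_)
    simp
  have h3 : (A.card : ℝ) = ((A.filter (fun p => p ≤ R)).card : ℝ) + T.card := by
    exact_mod_cast hsplit.symm
  rw [h3]
  have h4 : (T.card : ℝ) ≤ 4 * B / (ε * ℓ) ^ 6 := by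
    rw [le_div_iff₀ hpos]; exact h2
  have h5 : ((A.filter (fun p => p ≤ R)).card : ℝ) ≤ R := by exact_mod_cast h1
  linarith

lemma final_ineq (ε κ x y w r V L K M CM q : ℝ) (hε : 0 < ε) (hκ : 0 < κ) (hx : 1 ≤ x)
    (hy : 1 ≤ y) (hw : 1 ≤ w) (hr0 : 0 ≤ r) (hr : r ≤ w) (hV : 0 < V) (hL : 0 < L)
    (hVL : κ * L ≤ 4 * V) (hK : (1 + L) * L ≤ K * w ^ 2) (hly : 6 * Real.log y ≤ L)
    (hxyw : (y * w) ^ 6 ≤ x) (hM : M ≤ CM * (y ^ 6 * q)) (hCM : 0 < CM) (hq : 1 ≤ q * y ^ 3)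
    (hq0 : 0 < q) (hM0 : 0 ≤ M) (hlog0 : 0 ≤ Real.log y) :
    (r + 4 * (M * (x / V + r ^ 4) + y ^ 6 * (r ^ 4 * (y ^ 3 * (1 + 6 * Real.log y)))) / (ε * y) ^ 6)
      * (4 * L / x) ≤ 4 * (K + 4 / ε ^ 6 * (CM * (4 / κ) + CM * K + K)) * q := by
  have hx0 : 0 < x := by linarith
  have hy0 : 0 < y := by linarith
  have hw0 : 0 < w := by linarith
  have hKw : 0 < K * w ^ 2 := lt_of_lt_of_le (by positivity) hK
  have hK0 : 0 < K := by
    by_contra h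
    nlinarith [mul_nonneg (neg_nonneg.2 (not_lt.1 h)) (sq_nonneg w)]
  have hLK : L ≤ K * w ^ 2 := le_trans (by nlinarith) hK
  have hyw : 1 ≤ y * w := by nlinarith
  -- basic
  have b1 : r * L ≤ K * q * x := by
    have a1 : r * L * y ^ 3 ≤ w * (K * w ^ 2) * y ^ 3 := by gcongr
    have a2 : (y * w) ^ 3 ≤ (y * w) ^ 6 := pow_le_pow_right₀ hyw (by norm_num)
    have a3 : r * L * y ^ 3 ≤ K * x := by
      calc _ ≤ _ := a1
        _ = K * (y * w) ^ 3 := by ring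
        _ ≤ K * x := by gcongr; exact a2.trans hxyw
    calc r * L = r * L * 1 := by ring
      _ ≤ r * L * (q * y ^ 3) := by gcongr
      _ = q * (r * L * y ^ 3) := by ring
      _ ≤ q * (K * x) := by gcongr
      _ = _ := by ring
  have b2 : M / y ^ 6 ≤ CM * q := by
    rw [div_le_iff₀ (by positivity)]; linarith
  have b3 : L / V ≤ 4 / κ := by
    rw [div_le_div_iff₀ hV hκ]; linarith
  have b4 : r ^ 4 * L ≤ K * x := by
    have a2 : w ^ 6 ≤ (y * w) ^ 6 := by
      apply pow_le_pow_left₀ hw0.le; nlinarith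
    calc r ^ 4 * L ≤ w ^ 4 * (K * w ^ 2) := by gcongr
      _ = K * w ^ 6 := by ring
      _ ≤ K * x := by gcongr; exact a2.trans hxyw
  have b5 : r ^ 4 * (y ^ 3 * (1 + 6 * Real.log y)) * L ≤ K * q * x := by
    have a1 : r ^ 4 * (y ^ 3 * (1 + 6 * Real.log y)) * L * y ^ 3 ≤ K * x := by
      calc _ ≤ w ^ 4 * (y ^ 3 * (1 + L)) * L * y ^ 3 := by gcongr
        _ = w ^ 4 * y ^ 6 * ((1 + L) * L) := by ring
        _ ≤ w ^ 4 * y ^ 6 * (K * w ^ 2) := by gcongr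
        _ = K * (y * w) ^ 6 := by ring
        _ ≤ K * x := by gcongr
    have hn : 0 ≤ r ^ 4 * (y ^ 3 * (1 + 6 * Real.log y)) * L := by positivity
    calc r ^ 4 * (y ^ 3 * (1 + 6 * Real.log y)) * L = r ^ 4 * (y ^ 3 * (1 + 6 * Real.log y)) * L * 1 := by ring
      _ ≤ r ^ 4 * (y ^ 3 * (1 + 6 * Real.log y)) * L * (q * y ^ 3) := by gcongr
      _ = q * (r ^ 4 * (y ^ 3 * (1 + 6 * Real.log y)) * L * y ^ 3) := by ring
      _ ≤ q * (K * x) := by gcongr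
      _ = _ := by ring
  have d1 : r * L / x ≤ K * q := by rw [div_le_iff₀ hx0]; exact b1
  have d4 : r ^ 4 * L / x ≤ K := by rw [div_le_iff₀ hx0]; exact b4
  have d5 : r ^ 4 * (y ^ 3 * (1 + 6 * Real.log y)) * L / x ≤ K * q := by rw [div_le_iff₀ hx0]; exact b5
  have g2 : M / y ^ 6 * (L / V) ≤ CM * q * (4 / κ) := by
    gcongr
  have g3 : M / y ^ 6 * (r ^ 4 * L / x) ≤ CM * q * K := by
    gcongr
  have e : (r + 4 * (M * (x / V + r ^ 4) + y ^ 6 * (r ^ 4 * (y ^ 3 * (1 + 6 * Real.log y)))) / (ε * y) ^ 6)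
      * (4 * L / x) = 4 * (r * L / x + 4 / ε ^ 6 * (M / y ^ 6 * (L / V) + M / y ^ 6 * (r ^ 4 * L / x)
        + r ^ 4 * (y ^ 3 * (1 + 6 * Real.log y)) * L / x)) := by
    generalize Real.log y = t
    field_simp
  rw [e]
  calc _ ≤ 4 * (K * q + 4 / ε ^ 6 * (CM * q * (4 / κ) + CM * q * K + K * q)) := by gcongr
    _ = _ := by ring

/-- For fixed `ε ∈ (0,1]`, `κ ∈ (0,1/6)`, `δ ∈ (0,1)`: for `x ≥ 2` and `2 ≤ ℓ ≤ x^(1/6-κ)`,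
`P_ℓ(x) ≪_{ε,κ,δ} ℓ^(-3+δ)`. -/
theorem stmt5 (ε κ δ : ℝ) (hε : 0 < ε) (hε1 : ε ≤ 1) (hκ : 0 < κ) (hκ' : κ < 1/6)
    (hδ : 0 < δ) (hδ1 : δ < 1) :
    ∃ C : ℝ, 0 < C ∧ ∀ (x : ℝ) (ℓ : ℕ), 2 ≤ x → 2 ≤ ℓ → (ℓ : ℝ) ≤ x ^ ((1 : ℝ)/6 - κ) →
      Pdens ε ℓ x ≤ C * (ℓ : ℝ) ^ ((-3 : ℝ) + δ) := by
  obtain ⟨CM, hCM, hMM⟩ := MM_bound δ hδ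
  set K : ℝ := (1 + 1 / κ) * (1 / κ) with hK
  have hK0 : 0 < K := by positivity
  refine ⟨4 * (K + 4 / ε ^ 6 * (CM * (4 / κ) + CM * K + K)), by positivity, ?_⟩
  intro x ℓ hx2 hℓ hℓx
  have hx0 : 0 < x := by linarith
  have hℓ2 : (2:ℝ) ≤ ℓ := by exact_mod_cast hℓ
  have hy0 : (0:ℝ) < ℓ := by linarith
  set w : ℝ := x ^ κ with hw
  have hw1 : 1 ≤ w := Real.one_le_rpow (by linarith) hκ.le
  have hxyw : ((ℓ:ℝ) * w) ^ 6 ≤ x := by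
    have h1 : (ℓ:ℝ) * w ≤ x ^ ((1:ℝ)/6) := by
      calc (ℓ:ℝ) * w ≤ x ^ ((1 : ℝ)/6 - κ) * x ^ κ := by gcongr
        _ = x ^ ((1:ℝ)/6) := by rw [← Real.rpow_add hx0]; ring_nf
    calc ((ℓ:ℝ) * w) ^ 6 ≤ (x ^ ((1:ℝ)/6)) ^ 6 := by gcongr
      _ = x := by
        rw [← Real.rpow_natCast, ← Real.rpow_mul hx0.le]; norm_num
  have hℓ6 : (ℓ:ℝ) ^ 6 ≤ x := by
    refine le_trans ?_ hxyw
    apply pow_le_pow_left₀ hy0.le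
    nlinarith
  have hx64 : 64 ≤ x := by
    refine le_trans ?_ hℓ6
    calc (64:ℝ) = 2 ^ 6 := by norm_num
      _ ≤ (ℓ:ℝ) ^ 6 := by gcongr
  have hL : 0 < Real.log x := Real.log_pos (by linarith)
  set R := ⌊w⌋₊ with hR
  have hR1 : 1 ≤ R := Nat.le_floor (by simpa using hw1)
  have hRw : (R:ℝ) ≤ w := Nat.floor_le (by linarith)
  have hR1' : (1:ℝ) ≤ R := by exact_mod_cast hR1
  have hRw2 : w / 2 ≤ R := by
    have := Nat.lt_floor_add_one w
    rw [← hR] at this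
    linarith
  have hV1 := VV_one_le R hR1
  have hVL : κ * Real.log x ≤ 4 * VV R := by
    have h1 := VV_lower R
    have h2 : Real.log (w / 2) ≤ Real.log R := Real.log_le_log (by linarith) hRw2
    rw [Real.log_div (by linarith) (by norm_num), hw, Real.log_rpow hx0] at h2
    have := Real.log_two_lt_d9
    linarith
  have hlw : Real.log x ≤ w / κ := Real.log_le_rpow_div hx0.le hκ
  have hKw : (1 + Real.log x) * Real.log x ≤ K * w ^ 2 := by
    have h1 : 1 + Real.log x ≤ (1 + 1 / κ) * w := by
      have : (1 + 1 / κ) * w = w + w / κ := by ring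
      linarith
    calc (1 + Real.log x) * Real.log x ≤ ((1 + 1 / κ) * w) * (w / κ) := by gcongr
      _ = K * w ^ 2 := by rw [hK]; ring
  have hly : 6 * Real.log ℓ ≤ Real.log x := by
    have := Real.log_le_log (by positivity) hℓ6
    rw [Real.log_pow] at this
    exact_mod_cast this
  have hM : (MM ℓ : ℝ) ≤ CM * ((ℓ:ℝ) ^ 6 * (ℓ:ℝ) ^ ((-3 : ℝ) + δ)) := by
    refine (hMM ℓ (by omega)).trans (le_of_eq ?_)
    rw [← Real.rpow_natCast (ℓ:ℝ) 6, ← Real.rpow_add hy0]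
    congr 2; push_cast; ring
  have hq : 1 ≤ (ℓ:ℝ) ^ ((-3 : ℝ) + δ) * (ℓ:ℝ) ^ 3 := by
    rw [← Real.rpow_natCast (ℓ:ℝ) 3, ← Real.rpow_add hy0]
    apply Real.one_le_rpow (by linarith)
    push_cast; linarith
  have hcount := count_bound ε x hε ℓ R (by omega) hR1 _
    (fun c hc hc8 => moment ℓ R ⌊x⌋₊ c (by omega) hR1 hc hc8)
  have hfl : ((⌊x⌋₊ : ℕ) : ℝ) ≤ x := Nat.floor_le hx0.le
  have hcount2 : (((oddPrimesUpTo x).filter (fun p => ε * ℓ ≤ (S ℓ p : ℝ))).card : ℝ) ≤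
      R + 4 * (MM ℓ * (x / VV R + R ^ 4) + (ℓ:ℝ) ^ 6 * (R ^ 4 * (ℓ ^ 3 * (1 + 6 * Real.log ℓ))))
        / (ε * ℓ) ^ 6 := by
    refine hcount.trans ?_
    have hVp : 0 < VV R := by linarith
    gcongr
  have hpi := piOdd_lower x hx64
  have hpi0 : (0:ℝ) < piOdd x := by
    by_contra h
    have : (piOdd x : ℝ) * Real.log x ≤ 0 := mul_nonpos_of_nonpos_of_nonneg (not_lt.1 h) hL.le
    linarith
  have hP : Pdens ε ℓ x ≤ (((oddPrimesUpTo x).filter (fun p => ε * ℓ ≤ (S ℓ p : ℝ))).card : ℝ)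
      * (4 * Real.log x / x) := by
    unfold Pdens
    rw [div_eq_mul_inv]
    apply mul_le_mul_of_nonneg_left _ (Nat.cast_nonneg _)
    rw [inv_eq_one_div, div_le_div_iff₀ hpi0 hx0]
    linarith
  refine hP.trans ((mul_le_mul_of_nonneg_right hcount2 (by positivity)).trans ?_)
  exact final_ineq ε κ x ℓ w R (VV R) (Real.log x) K (MM ℓ) CM _ hε hκ (by linarith) (by linarith)
    hw1 (by linarith) hRw (by linarith) hL hVL hKw hly hxyw hM hCM hq (by positivity)
    (Nat.cast_nonneg _) (Real.log_nonneg (by linarith))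

end
end

section
/- Fix ε ∈ (0,1], ρ > 0 and δ ∈ (0,1). Then for all x ≥ 2 and all integers ℓ ≥ 2, one has the uniform bound P_ℓ(x) ≪_{ε,ρ,δ} (log x) · x^{ρ−1} · ℓ^{3ρ−3+δ} · (x + ℓ³). -/
open Finset Filter

noncomputable section

theorem aux_period (f : ℕ → ℤ) (P : ℕ) (hP : 0 < P) (hper : ∀ n, f (n + P) = f n)
    (hz : ∑ n ∈ range P, f n = 0) (hb : ∀ n, |f n| ≤ 1) (M : ℕ) :
    |∑ n ∈ range M, f n| ≤ P := by
  induction M using Nat.strong_induction_on with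
  | _ M ih =>
    by_cases h : M < P
    · calc |∑ n ∈ range M, f n| ≤ ∑ n ∈ range M, |f n| := abs_sum_le_sum_abs _ _
        _ ≤ ∑ n ∈ range M, 1 := sum_le_sum fun n _ => hb n
        _ ≤ P := by simp; omega
    · obtain ⟨m, rfl⟩ : ∃ m, M = P + m := ⟨M - P, by omega⟩
      rw [sum_range_add, hz, zero_add]
      have : ∀ n ∈ range m, f (P + n) = f n := fun n _ => by rw [add_comm, hper]
      rw [sum_congr rfl this]
      exact ih m (by omega)

theorem aux_zero (p q : ℕ) (hp : p.Prime) (hq : q.Prime) (hp2 : p ≠ 2) (hq2 : q ≠ 2)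
    (hpq : p ≠ q) :
    ∑ n ∈ range (p * q), jacobiSym (n : ℤ) p * jacobiSym (n : ℤ) q = 0 := by
  have : Fact p.Prime := ⟨hp⟩
  have : Fact q.Prime := ⟨hq⟩
  have : NeZero (p * q) := ⟨by simp [hp.ne_zero, hq.ne_zero]⟩
  have hc : p.Coprime q := (Nat.coprime_primes hp hq).2 hpq
  let F : ZMod p × ZMod q → ℤ := fun z => quadraticChar (ZMod p) z.1 * quadraticChar (ZMod q) z.2
  let e := ZMod.chineseRemainder hc
  have h1 : ∑ n ∈ range (p * q), jacobiSym (n : ℤ) p * jacobiSym (n : ℤ) q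
      = ∑ z : ZMod (p * q), F (e z) := by
    refine sum_bij' (fun n _ => (n : ZMod (p * q))) (fun z _ => z.val) ?_ ?_ ?_ ?_ ?_
    · simp
    · intro z _; simpa using ZMod.val_lt z
    · intro n hn; exact ZMod.val_cast_of_lt (by simpa using hn)
    · intro z _; simp
    · intro n _
      rw [← jacobiSym.legendreSym.to_jacobiSym, ← jacobiSym.legendreSym.to_jacobiSym]
      simp [F, e, legendreSym]
  rw [h1, show ∑ z, F (e z) = ∑ z, F z from Equiv.sum_comp e.toEquiv F, Fintype.sum_prod_type]
  simp only [F]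
  have h0 : ∑ a : ZMod p, quadraticChar (ZMod p) a = 0 :=
    quadraticChar_sum_zero (by rw [ZMod.ringChar_zmod_n]; exact hp2)
  simp_rw [← mul_sum]
  rw [← sum_mul, h0, zero_mul]

theorem jac_abs (a : ℤ) (p : ℕ) : |jacobiSym a p| ≤ 1 := by
  rcases jacobiSym.trichotomy a p with h | h | h <;> simp [h]

theorem aux_offdiag (p q : ℕ) (hp : p.Prime) (hq : q.Prime) (hp2 : p ≠ 2) (hq2 : q ≠ 2)
    (hpq : p ≠ q) (M : ℕ) :
    |∑ n ∈ Icc 1 M, jacobiSym (n : ℤ) p * jacobiSym (n : ℤ) q| ≤ p * q := by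
  have h := aux_period (fun n => jacobiSym (n : ℤ) p * jacobiSym (n : ℤ) q) (p * q)
    (Nat.mul_pos hp.pos hq.pos) ?_ (aux_zero p q hp hq hp2 hq2 hpq) ?_ (M + 1)
  · rw [range_eq_Ico, sum_eq_sum_Ico_succ_bot (by omega)] at h
    have h0 : jacobiSym ((0 : ℕ) : ℤ) p = 0 := by
      rw [Nat.cast_zero, jacobiSym.zero_left hp.one_lt]
    rw [h0] at h
    push_cast at h
    simpa using! h
  · intro n
    rw [jacobiSym.mod_left _ p, jacobiSym.mod_left _ q]
    rw [jacobiSym.mod_left (n : ℤ) p, jacobiSym.mod_left (n : ℤ) q]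
    simp
  · intro n
    rw [abs_mul]
    have := jac_abs n p
    have := jac_abs n q
    exact mul_le_one₀ (jac_abs n p) (abs_nonneg _) (jac_abs n q)

theorem aux_T (B : Finset ℕ) (X M : ℕ) (hB : ∀ p ∈ B, p.Prime ∧ p ≠ 2 ∧ p ≤ X) :
    ∑ n ∈ Icc 1 M, (∑ p ∈ B, jacobiSym (n : ℤ) p) ^ 2 ≤ M * #B + X ^ 2 * #B ^ 2 := by
  have h1 : ∑ n ∈ Icc 1 M, (∑ p ∈ B, jacobiSym (n : ℤ) p) ^ 2
      = ∑ p ∈ B, ∑ q ∈ B, ∑ n ∈ Icc 1 M, jacobiSym (n : ℤ) p * jacobiSym (n : ℤ) q := by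
    simp_rw [sq, sum_mul_sum]
    rw [sum_comm]
    refine sum_congr rfl fun p _ => ?_
    rw [sum_comm]
  rw [h1]
  have h2 : ∀ p ∈ B, ∀ q ∈ B, ∑ n ∈ Icc 1 M, jacobiSym (n : ℤ) p * jacobiSym (n : ℤ) q
      ≤ (if p = q then (M : ℤ) else 0) + X ^ 2 := by
    intro p hp q hq
    obtain ⟨p1, p2, p3⟩ := hB p hp
    obtain ⟨q1, q2, q3⟩ := hB q hq
    split_ifs with h
    · have : ∑ n ∈ Icc 1 M, jacobiSym (n : ℤ) p * jacobiSym (n : ℤ) q ≤ ∑ n ∈ Icc 1 M, 1 :=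
        sum_le_sum fun n _ => (le_abs_self _).trans (by
          rw [abs_mul]; exact mul_le_one₀ (jac_abs n p) (abs_nonneg _) (jac_abs n q))
      simp at this
      nlinarith [sq_nonneg (X : ℤ)]
    · refine (le_abs_self _).trans ((aux_offdiag p q p1 q1 p2 q2 h M).trans ?_)
      have : p * q ≤ X * X := Nat.mul_le_mul p3 q3
      rw [zero_add, sq]; exact_mod_cast this
  refine (sum_le_sum fun p hp => sum_le_sum fun q hq => h2 p hp q hq).trans ?_
  simp only [sum_add_distrib, sum_ite_eq]
  simp
  apply le_of_eq; ring

theorem aux_main (B : Finset ℕ) (X ℓ k A : ℕ) (ε : ℝ) (hε : 0 < ε) (hl : 2 ≤ ℓ)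
    (hB : ∀ p ∈ B, p.Prime ∧ p ≠ 2 ∧ p ≤ X) (hS : ∀ p ∈ B, ε * ℓ ≤ (S ℓ p : ℝ))
    (hk : X ^ 3 ≤ ℓ ^ k) (hA : ∀ n ∈ Icc 1 (ℓ ^ k), #n.divisors ^ k ≤ A) :
    (#B : ℝ) * ε ^ (2 * k) ≤ 2 * A := by
  classical
  set T : ℕ → ℤ := fun n => ∑ p ∈ B, jacobiSym (n : ℤ) p with hT
  set W : Finset (Fin k → ℕ) := Fintype.piFinset (fun _ => Icc 1 ℓ) with hW
  have hWc : #W = ℓ ^ k := by simp [hW]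
  have h1 : ∑ p ∈ B, (S ℓ p) ^ k = ∑ t ∈ W, T (∏ i, t i) := by
    simp only [hT]
    rw [sum_comm]
    refine sum_congr rfl fun p _ => ?_
    have : (S ℓ p) ^ k = ∏ i : Fin k, ∑ n ∈ Icc 1 ℓ, jacobiSym (n : ℤ) p := by
      simp [S]
    rw [this, prod_univ_sum]
    refine sum_congr rfl fun t _ => ?_
    have : ∀ s : Finset (Fin k), jacobiSym ((∏ i ∈ s, t i : ℕ) : ℤ) p
        = ∏ i ∈ s, jacobiSym (t i : ℤ) p := by
      intro s
      induction s using Finset.induction_on with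
      | empty => simp
      | insert a s ha ih => rw [prod_insert ha, prod_insert ha, ← ih]; push_cast; rw [jacobiSym.mul_left]
    exact (this univ).symm
  have hmap : ∀ t ∈ W, ∏ i, t i ∈ Icc 1 (ℓ ^ k) := by
    intro t ht
    rw [hW, Fintype.mem_piFinset] at ht
    simp only [mem_Icc] at ht ⊢
    refine ⟨Nat.one_le_iff_ne_zero.2 (prod_ne_zero_iff.2 fun i _ => by have := (ht i).1; omega), ?_⟩
    calc ∏ i, t i ≤ ∏ i : Fin k, ℓ := prod_le_prod' fun i _ => (ht i).2
      _ = ℓ ^ k := by simp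
  have h2 : ∑ t ∈ W, T (∏ i, t i) ^ 2 ≤ A * ∑ n ∈ Icc 1 (ℓ ^ k), T n ^ 2 := by
    rw [← sum_fiberwise_of_maps_to hmap, mul_sum]
    refine sum_le_sum fun n hn => ?_
    rw [sum_congr rfl (g := fun _ => T n ^ 2) (fun t ht => by rw [(mem_filter.1 ht).2])]
    rw [sum_const, nsmul_eq_mul]
    refine mul_le_mul_of_nonneg_right ?_ (sq_nonneg _)
    have hc : #{t ∈ W | ∏ i, t i = n} ≤ #n.divisors ^ k := by
      calc #{t ∈ W | ∏ i, t i = n} ≤ #(Fintype.piFinset (fun _ : Fin k => n.divisors)) := by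
            refine card_le_card fun t ht => ?_
            rw [Fintype.mem_piFinset]
            intro i
            rw [Nat.mem_divisors]
            refine ⟨?_, by simp at hn; omega⟩
            rw [← (mem_filter.1 ht).2]
            exact dvd_prod_of_mem _ (mem_univ i)
        _ = _ := by simp
    exact_mod_cast hc.trans (hA n hn)
  have h3 := aux_T B X (ℓ ^ k) hB
  have h4 : (∑ t ∈ W, T (∏ i, t i)) ^ 2 ≤ ℓ ^ k * ∑ t ∈ W, T (∏ i, t i) ^ 2 := by
    have := sq_sum_le_card_mul_sum_sq (s := W) (f := fun t => T (∏ i, t i))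
    rw [hWc] at this
    exact_mod_cast this
  have hN : #B ≤ X := by
    calc #B ≤ #(Icc 1 X) := card_le_card fun p hp => by
          have := hB p hp
          simp only [mem_Icc]; exact ⟨this.1.one_le, this.2.2⟩
      _ = X := by simp
  have h5 : (#B : ℝ) * (ε * ℓ) ^ k ≤ ((∑ p ∈ B, (S ℓ p) ^ k : ℤ) : ℝ) := by
    push_cast
    rw [← nsmul_eq_mul]
    exact card_nsmul_le_sum _ _ _ fun p hp => pow_le_pow_left₀ (by positivity) (hS p hp) k
  rcases Nat.eq_zero_or_pos (#B) with h0 | h0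
  · rw [h0]; simp
  have h6 : (∑ p ∈ B, (S ℓ p) ^ k) ^ 2 ≤ 2 * A * #B * (ℓ ^ k) ^ 2 := by
    rw [h1]
    refine h4.trans ?_
    have e1 : (X : ℤ) ^ 2 * #B ^ 2 ≤ ℓ ^ k * #B := by
      have : X ^ 2 * #B ^ 2 ≤ ℓ ^ k * #B := by
        calc X ^ 2 * #B ^ 2 = X ^ 2 * #B * #B := by ring
          _ ≤ X ^ 2 * X * #B := by gcongr
          _ = X ^ 3 * #B := by ring
          _ ≤ _ := by gcongr
      exact_mod_cast this
    have e2 : ∑ n ∈ Icc 1 (ℓ ^ k), T n ^ 2 ≤ 2 * (ℓ ^ k * #B) := by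
      push_cast at h3
      refine h3.trans ?_
      linarith
    calc (ℓ : ℤ) ^ k * ∑ t ∈ W, T (∏ i, t i) ^ 2
        ≤ ℓ ^ k * (A * (2 * (ℓ ^ k * #B))) := by
          refine mul_le_mul_of_nonneg_left (h2.trans ?_) (by positivity)
          exact mul_le_mul_of_nonneg_left e2 (by positivity)
      _ = _ := by ring
  have h7 : ((∑ p ∈ B, (S ℓ p) ^ k : ℤ) : ℝ) ^ 2 ≤ 2 * A * #B * ((ℓ : ℝ) ^ k) ^ 2 := by
    exact_mod_cast h6
  have h8 : ((#B : ℝ) * (ε * ℓ) ^ k) ^ 2 ≤ 2 * A * #B * ((ℓ : ℝ) ^ k) ^ 2 :=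
    (pow_le_pow_left₀ (by positivity) h5 2).trans h7
  have hpos : 0 < (#B : ℝ) * ((ℓ : ℝ) ^ k) ^ 2 := by positivity
  refine le_of_mul_le_mul_right ?_ hpos
  calc _ = ((#B : ℝ) * (ε * ℓ) ^ k) ^ 2 := by rw [mul_pow ε]; ring
    _ ≤ _ := h8
    _ = _ := by ring

theorem aux_divisor (η : ℝ) (hη : 0 < η) :
    ∃ C : ℝ, 1 ≤ C ∧ ∀ n : ℕ, n ≠ 0 → (#n.divisors : ℝ) ≤ C * (n : ℝ) ^ η := by
  set D : ℝ := 1 + 1 / (η * Real.log 2) with hD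
  have hl2 : 0 < Real.log 2 := Real.log_pos (by norm_num)
  have hD1 : 1 ≤ D := by rw [hD]; have : 0 < 1 / (η * Real.log 2) := by positivity
                         linarith
  set Q : ℕ := ⌈(2 : ℝ) ^ (1 / η)⌉₊ with hQ
  refine ⟨D ^ Q, one_le_pow₀ hD1, fun n hn => ?_⟩
  have key : ∀ p ∈ n.primeFactors, ((n.factorization p + 1 : ℕ) : ℝ)
      ≤ (if p < Q then D else 1) * ((p : ℝ) ^ n.factorization p) ^ η := by
    intro p hp
    have hpp := Nat.prime_of_mem_primeFactors hp
    have hp2 : (2 : ℝ) ≤ p := by exact_mod_cast hpp.two_le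
    set e := n.factorization p
    have hrw : ((p : ℝ) ^ e) ^ η = ((p : ℝ) ^ η) ^ e := by
      rw [← Real.rpow_natCast, ← Real.rpow_natCast, ← Real.rpow_mul (by positivity),
        ← Real.rpow_mul (by positivity), mul_comm]
    rw [hrw]
    split_ifs with h
    · have a1 : 1 + η * Real.log 2 ≤ (p : ℝ) ^ η := by
        calc 1 + η * Real.log 2 ≤ Real.exp (Real.log 2 * η) := by
              have := Real.add_one_le_exp (Real.log 2 * η); linarith
          _ = (2 : ℝ) ^ η := by rw [Real.rpow_def_of_pos (by norm_num)]
          _ ≤ _ := Real.rpow_le_rpow (by norm_num) hp2 hη.le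
      have a2 : 1 + e * (η * Real.log 2) ≤ ((p : ℝ) ^ η) ^ e := by
        refine (one_add_mul_le_pow (by have : 0 < η * Real.log 2 := by positivity
                                       linarith) e).trans ?_
        exact pow_le_pow_left₀ (by positivity) a1 e
      have a3 : ((e + 1 : ℕ) : ℝ) ≤ D * (1 + e * (η * Real.log 2)) := by
        have hc : 0 < η * Real.log 2 := by positivity
        rw [hD]; push_cast
        have : (1 + 1 / (η * Real.log 2)) * (1 + e * (η * Real.log 2))
          = 1 + e + 1 / (η * Real.log 2) + e * (η * Real.log 2) := by field_simp; ring
        rw [this]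
        have : 0 < 1 / (η * Real.log 2) := by positivity
        have : 0 ≤ e * (η * Real.log 2) := by positivity
        linarith
      exact a3.trans (mul_le_mul_of_nonneg_left a2 (by linarith))
    · have hq : (2 : ℝ) ^ (1 / η) ≤ p := (Nat.le_ceil _).trans (by exact_mod_cast not_lt.1 h)
      have a1 : (2 : ℝ) ≤ (p : ℝ) ^ η := by
        calc (2 : ℝ) = ((2 : ℝ) ^ (1 / η)) ^ η := by
              rw [← Real.rpow_mul (by norm_num), one_div_mul_cancel hη.ne', Real.rpow_one]
          _ ≤ _ := Real.rpow_le_rpow (by positivity) hq hη.le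
      rw [one_mul]
      calc ((e + 1 : ℕ) : ℝ) ≤ ((2 ^ e : ℕ) : ℝ) := by exact_mod_cast Nat.lt_two_pow_self
        _ = (2 : ℝ) ^ e := by push_cast; rfl
        _ ≤ _ := pow_le_pow_left₀ (by norm_num) a1 e
  rw [Nat.card_divisors hn]
  push_cast
  have hprod : (n : ℝ) ^ η = ∏ p ∈ n.primeFactors, ((p : ℝ) ^ n.factorization p) ^ η := by
    rw [Real.finsetProd_rpow _ _ (fun i _ => by positivity)]
    congr 1
    conv_lhs => rw [← Nat.prod_factorization_pow_eq_self hn]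
    rw [Finsupp.prod, Nat.support_factorization]
    push_cast; rfl
  calc ∏ p ∈ n.primeFactors, ((n.factorization p : ℝ) + 1)
      ≤ ∏ p ∈ n.primeFactors, ((if p < Q then D else 1) * ((p : ℝ) ^ n.factorization p) ^ η) :=
        prod_le_prod (fun p _ => by positivity) (fun p hp => by exact_mod_cast key p hp)
    _ = (∏ p ∈ n.primeFactors, if p < Q then D else 1) * (n : ℝ) ^ η := by
        rw [prod_mul_distrib, hprod]
    _ ≤ _ := by
        refine mul_le_mul_of_nonneg_right ?_ (by positivity)
        rw [← prod_filter, prod_const]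
        refine pow_le_pow_right₀ hD1 ?_
        calc _ ≤ #(range Q) := card_le_card fun p hp => by simpa using (mem_filter.1 hp).2
          _ = Q := by simp

theorem aux_pi (x : ℝ) (hx : 3 ≤ x) : x ≤ 10 * (piOdd x * Real.log x) := by
  have hfl : 3 ≤ ⌊x⌋₊ := Nat.le_floor (by exact_mod_cast hx)
  have hlog : 1 ≤ Real.log x := by
    rw [Real.le_log_iff_exp_le (by linarith)]
    have := Real.exp_one_lt_d9; linarith
  by_cases h9 : x ≤ 10
  · have : 1 ≤ piOdd x := by
      unfold piOdd oddPrimesUpTo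
      refine card_pos.2 ⟨3, ?_⟩
      simp only [mem_filter, mem_range]
      exact ⟨by omega, by norm_num, by norm_num⟩
    have : (1 : ℝ) ≤ piOdd x := by exact_mod_cast this
    nlinarith
  · push Not at h9
    have hpi : Nat.primeCounting ⌊x⌋₊ ≤ piOdd x + 1 := by
      rw [Nat.primeCounting, Nat.primeCounting', Nat.count_eq_card_filter_range]
      unfold piOdd oddPrimesUpTo
      calc _ ≤ #(insert 2 ((range (⌊x⌋₊ + 1)).filter (fun p => p.Prime ∧ p ≠ 2))) := by
            refine card_le_card fun p hp => ?_
            simp only [mem_filter, mem_insert] at hp ⊢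
            tauto
        _ ≤ _ := card_insert_le _ _
    have h1 := Chebyshev.pi_ge' (x := x) (by linarith)
    rw [div_le_iff₀ (by linarith)] at h1
    have h2 : (Nat.primeCounting ⌊x⌋₊ : ℝ) ≤ piOdd x + 1 := by exact_mod_cast hpi
    have h3 := Real.log_two_gt_d9
    have l10 : Real.log 10 ≤ 2.4 := by
      have : Real.log 10 ≤ Real.log (2 ^ 3 * (5/4)) := by norm_num
      rw [Real.log_mul (by norm_num) (by norm_num), Real.log_pow] at this
      have a := Real.log_two_lt_d9
      have b := Real.log_le_sub_one_of_pos (show (0:ℝ) < 5/4 by norm_num)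
      push_cast at this
      linarith
    have hy : ∀ y : ℝ, 0 < y → Real.log y ≤ y / 10 + 1.4 := by
      intro y hy
      have := Real.log_le_sub_one_of_pos (show (0:ℝ) < y / 10 by positivity)
      rw [Real.log_div hy.ne' (by norm_num)] at this
      linarith
    have h4 := hy x (by linarith)
    have h5 := hy (x + 2) (by linarith)
    have h6 : (Nat.primeCounting ⌊x⌋₊ : ℝ) * Real.log x ≤ (piOdd x + 1) * Real.log x :=
      mul_le_mul_of_nonneg_right h2 (by linarith)
    nlinarith

/-- For fixed `ε ∈ (0,1]`, `ρ > 0`, `δ ∈ (0,1)`: for all `x ≥ 2` and integers `ℓ ≥ 2`,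
`P_ℓ(x) ≪_{ε,ρ,δ} (log x) x^(ρ-1) ℓ^(3ρ-3+δ) (x + ℓ³)`. -/
theorem stmt6 (ε ρ δ : ℝ) (hε : 0 < ε) (hε1 : ε ≤ 1) (hρ : 0 < ρ)
    (hδ : 0 < δ) (hδ1 : δ < 1) :
    ∃ C : ℝ, 0 < C ∧ ∀ (x : ℝ) (ℓ : ℕ), 2 ≤ x → 2 ≤ ℓ →
      Pdens ε ℓ x ≤ C * Real.log x * x ^ (ρ - 1) * (ℓ : ℝ) ^ (3*ρ - 3 + δ)
        * (x + (ℓ : ℝ) ^ 3) := by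
  set k : ℕ := ⌈9 / ρ⌉₊ with hk
  have hkρ : 9 / ρ ≤ k := Nat.le_ceil _
  have hk0 : (0 : ℝ) < k := lt_of_lt_of_le (by positivity) hkρ
  obtain ⟨E, hE1, hE⟩ := aux_divisor (δ / (k * k)) (by positivity)
  set C1 : ℝ := 2 * (2 * E ^ k) / ε ^ (2 * k) with hC1
  have hE0 : 0 < E := by linarith
  have hC1p : 0 < C1 := by positivity
  refine ⟨10 * C1 + 2, by positivity, fun x ℓ hx hl => ?_⟩
  have hx0 : 0 < x := by linarith
  have hl1 : (1 : ℝ) ≤ ℓ := by exact_mod_cast (by omega : 1 ≤ ℓ)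
  have hl0 : (0 : ℝ) < ℓ := by linarith
  have hlogx : 1 / 2 ≤ Real.log x := by
    have := Real.log_two_gt_d9
    have := Real.log_le_log (by norm_num) hx
    linarith
  have hlog0 : 0 < Real.log x := by linarith
  have hsplit : (ℓ : ℝ) ^ (3*ρ - 3 + δ) = (ℓ : ℝ) ^ (3 * ρ) * (ℓ : ℝ) ^ δ / (ℓ : ℝ) ^ 3 := by
    rw [show 3*ρ - 3 + δ = 3 * ρ + δ - (3 : ℕ) by push_cast; ring, Real.rpow_sub hl0,
      Real.rpow_add hl0, Real.rpow_natCast]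
  have hsx : x ^ (ρ - 1) = x ^ ρ / x := by rw [Real.rpow_sub hx0, Real.rpow_one]
  have g1 : 1 ≤ (ℓ : ℝ) ^ (3 * ρ) := Real.one_le_rpow hl1 (by positivity)
  have g2 : 1 ≤ (ℓ : ℝ) ^ δ := Real.one_le_rpow hl1 (by positivity)
  have g3 : 1 ≤ x ^ ρ := Real.one_le_rpow (by linarith) hρ.le
  rw [hsplit, hsx]
  by_cases hcase : (ℓ : ℝ) ^ 3 ≤ x ^ ρ
  · have hP1 : Pdens ε ℓ x ≤ 1 := by
      unfold Pdens
      refine div_le_one_of_le₀ ?_ (by positivity)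
      unfold piOdd
      exact_mod_cast card_filter_le _ _
    refine hP1.trans ?_
    have a1 : 1 ≤ (10 * C1 + 2) * Real.log x := by nlinarith
    have a2 : 1 ≤ x ^ ρ / (ℓ : ℝ) ^ 3 := by rw [le_div_iff₀ (by positivity)]; linarith
    have a3 : 1 ≤ (ℓ : ℝ) ^ (3 * ρ) * (ℓ : ℝ) ^ δ := one_le_mul_of_one_le_of_one_le g1 g2
    have a4 : 1 ≤ (x + (ℓ : ℝ) ^ 3) / x := by
      rw [le_div_iff₀ hx0]
      have : 0 < (ℓ : ℝ) ^ 3 := by positivity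
      linarith
    calc (1 : ℝ) ≤ ((10 * C1 + 2) * Real.log x) * (x ^ ρ / (ℓ : ℝ) ^ 3)
          * ((ℓ : ℝ) ^ (3 * ρ) * (ℓ : ℝ) ^ δ) * ((x + (ℓ : ℝ) ^ 3) / x) :=
          one_le_mul_of_one_le_of_one_le (one_le_mul_of_one_le_of_one_le
            (one_le_mul_of_one_le_of_one_le a1 a2) a3) a4
      _ = _ := by ring
  · push Not at hcase
    have hRHS : 10 * C1 * Real.log x / x * (ℓ : ℝ) ^ δ ≤
        (10 * C1 + 2) * Real.log x * (x ^ ρ / x) * ((ℓ : ℝ) ^ (3 * ρ) * (ℓ : ℝ) ^ δ / (ℓ : ℝ) ^ 3)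
          * (x + (ℓ : ℝ) ^ 3) := by
      have b1 : 1 ≤ (x + (ℓ : ℝ) ^ 3) / (ℓ : ℝ) ^ 3 := by
        rw [le_div_iff₀ (by positivity)]; linarith
      have b2 : 1 ≤ x ^ ρ * (ℓ : ℝ) ^ (3 * ρ) * ((x + (ℓ : ℝ) ^ 3) / (ℓ : ℝ) ^ 3) :=
        one_le_mul_of_one_le_of_one_le (one_le_mul_of_one_le_of_one_le g3 g1) b1
      calc 10 * C1 * Real.log x / x * (ℓ : ℝ) ^ δ
          ≤ (10 * C1 + 2) * Real.log x / x * (ℓ : ℝ) ^ δ := by gcongr; linarith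
        _ ≤ (10 * C1 + 2) * Real.log x / x * (ℓ : ℝ) ^ δ *
            (x ^ ρ * (ℓ : ℝ) ^ (3 * ρ) * ((x + (ℓ : ℝ) ^ 3) / (ℓ : ℝ) ^ 3)) :=
            le_mul_of_one_le_right (by positivity) b2
        _ = _ := by ring
    refine le_trans ?_ hRHS
    by_cases hx3 : 3 ≤ x
    swap
    · have hp0 : piOdd x = 0 := by
        unfold piOdd oddPrimesUpTo
        rw [card_eq_zero, filter_eq_empty_iff]
        intro p hp hpp
        have : ⌊x⌋₊ < 3 := by rw [Nat.floor_lt hx0.le]; exact_mod_cast not_le.1 hx3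
        simp only [mem_range] at hp
        have := hpp.1.two_le
        have := hpp.2
        omega
      unfold Pdens
      rw [hp0]
      simp
      positivity
    have hpi := aux_pi x hx3
    set B := (oddPrimesUpTo x).filter (fun p => ε * ℓ ≤ (S ℓ p : ℝ)) with hBdef
    have hXk : ⌊x⌋₊ ^ 3 ≤ ℓ ^ k := by
      have c1 : x ^ (3 : ℝ) ≤ (ℓ : ℝ) ^ (k : ℝ) := by
        calc x ^ (3 : ℝ) ≤ x ^ (ρ * (k / 3)) := by
              refine Real.rpow_le_rpow_of_exponent_le (by linarith) ?_
              rw [div_le_iff₀ hρ] at hkρ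
              linarith
          _ = (x ^ ρ) ^ ((k : ℝ) / 3) := by rw [Real.rpow_mul hx0.le]
          _ ≤ ((ℓ : ℝ) ^ 3) ^ ((k : ℝ) / 3) :=
              Real.rpow_le_rpow (by positivity) hcase.le (by positivity)
          _ = (ℓ : ℝ) ^ (k : ℝ) := by
              rw [← Real.rpow_natCast, ← Real.rpow_mul hl0.le]; congr 1; push_cast; ring
      have c2 : x ^ 3 ≤ (ℓ : ℝ) ^ k := by
        rw [← Real.rpow_natCast, ← Real.rpow_natCast]; exact_mod_cast c1
      have c3 : ((⌊x⌋₊ : ℝ)) ^ 3 ≤ (ℓ : ℝ) ^ k :=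
        (pow_le_pow_left₀ (by positivity) (Nat.floor_le hx0.le) 3).trans c2
      exact_mod_cast c3
    have hmain := aux_main B ⌊x⌋₊ ℓ k ⌊E ^ k * (ℓ : ℝ) ^ δ⌋₊ ε hε hl ?_ ?_ hXk ?_
    · have hA : (⌊E ^ k * (ℓ : ℝ) ^ δ⌋₊ : ℝ) ≤ E ^ k * (ℓ : ℝ) ^ δ :=
        Nat.floor_le (by positivity)
      have hN : (#B : ℝ) ≤ C1 * (ℓ : ℝ) ^ δ := by
        rw [hC1, div_mul_eq_mul_div, le_div_iff₀ (by positivity)]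
        have : 0 ≤ E ^ k * (ℓ : ℝ) ^ δ := by positivity
        linarith
      have hpp : 0 < (piOdd x : ℝ) := by
        by_contra hcon
        have : (piOdd x : ℝ) = 0 := le_antisymm (not_lt.1 hcon) (by positivity)
        rw [this] at hpi
        linarith
      unfold Pdens
      rw [← hBdef, div_le_iff₀ hpp]
      refine hN.trans ?_
      have : 1 ≤ 10 * (piOdd x * Real.log x) / x := by rw [le_div_iff₀ hx0]; linarith
      calc C1 * (ℓ : ℝ) ^ δ ≤ C1 * (ℓ : ℝ) ^ δ * (10 * (piOdd x * Real.log x) / x) :=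
            le_mul_of_one_le_right (by positivity) this
        _ = _ := by ring
    · intro p hp
      rw [hBdef, mem_filter] at hp
      have := hp.1
      unfold oddPrimesUpTo at this
      simp only [mem_filter, mem_range] at this
      exact ⟨this.2.1, this.2.2, by omega⟩
    · intro p hp
      exact (mem_filter.1 hp).2
    · intro n hn
      rw [mem_Icc] at hn
      refine Nat.le_floor ?_
      push_cast
      have hnl : (n : ℝ) ≤ (ℓ : ℝ) ^ k := by exact_mod_cast hn.2
      calc (#n.divisors : ℝ) ^ k ≤ (E * (n : ℝ) ^ (δ / (k * k))) ^ k :=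
            pow_le_pow_left₀ (by positivity) (hE n (by omega)) k
        _ ≤ (E * ((ℓ : ℝ) ^ k) ^ (δ / (k * k))) ^ k := by gcongr
        _ = E ^ k * (ℓ : ℝ) ^ δ := by
            rw [mul_pow, ← Real.rpow_natCast (ℓ : ℝ) k, ← Real.rpow_mul hl0.le,
              ← Real.rpow_natCast (_ ^ _) k, ← Real.rpow_mul hl0.le]
            congr 2
            field_simp

end
end
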